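/- arXiv:2112.14720 — 6 statements merged into one kernel-verified Lean document; each statement's English description precedes it below -/
import Mathlib

section
/- (Existence of generalised solutions of open differential relations, Corollary 7.3 of del Pino–Toussaint, stated over the n-torus in standard coordinates.) Fix integers n ≥ 1, ℓ ≥ 1, r ≥ 1. Let R be an open subset of ℝⁿ × Sym^0(ℝⁿ,ℝ^ℓ) × Sym^1(ℝⁿ,ℝ^ℓ) × ⋯ × Sym^r(ℝⁿ,ℝ^ℓ) that is invariant under integer base translations, i.e. (x, z_0,…,z_r) ∈ R implies (x+m, z_0,…,z_r) ∈ R for every m ∈ ℤⁿ. Suppose R admits a formal solution: a formal section (σ_0,…,σ_r) of J^r over the n-torus with (x, σ_0(x),…,σ_r(x)) ∈ R for every x ∈ ℝⁿ. Then R admits a multi-solution: there exists a ℤⁿ-equivariant integral r-jet tuple (X, ζ_0,…,ζ_r) of smooth maps on ℝⁿ, with {p : fderiv ℝ X p is a linear isomorphism} dense in ℝⁿ and with front p ↦ (X p, ζ_0 p) injective modulo ℤⁿ, such that (X p, ζ_0 p, …, ζ_r p) ∈ R for every p ∈ ℝⁿ. -/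
/- `ℝⁿ` in standard coordinates. -/
noncomputable section

abbrev Vec (n : ℕ) := Fin n → ℝ

/-- The ambient space of `Sym^i(ℝⁿ, ℝ^ℓ)`: continuous `i`-multilinear maps `(ℝⁿ)^i → ℝ^ℓ`. -/
abbrev SymMap (n ℓ i : ℕ) := ContinuousMultilinearMap ℝ (fun _ : Fin i => Vec n) (Vec ℓ)

/-- A multilinear map is symmetric if it is invariant under permutations of its arguments. -/
def IsSymmMap {n ℓ i : ℕ} (A : SymMap n ℓ i) : Prop :=
  ∀ (e : Equiv.Perm (Fin i)) (v : Fin i → Vec n), A (v ∘ e) = A v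

/-- The inclusion `ℤⁿ → ℝⁿ`. -/
def zcast {n : ℕ} (m : Fin n → ℤ) : Vec n := fun j => (m j : ℝ)


open scoped ContDiff Topology

set_option linter.unusedSectionVars false

/-! ### Parametric jets -/

/-- The partial `i`-th iterated derivative in the first variable. -/
def PJ {E Q V : Type*} [NormedAddCommGroup E] [NormedSpace ℝ E]
    [NormedAddCommGroup V] [NormedSpace ℝ V] (G : E × Q → V) (i : ℕ) (z : E × Q) :
    ContinuousMultilinearMap ℝ (fun _ : Fin i => E) V :=
  iteratedFDeriv ℝ i (fun x => G (x, z.2)) z.1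

section PJ

variable {E Q V : Type} [NormedAddCommGroup E] [NormedSpace ℝ E]
    [NormedAddCommGroup Q] [NormedSpace ℝ Q] [NormedAddCommGroup V] [NormedSpace ℝ V]

lemma contDiff_slice {G : E × Q → V} (hG : ContDiff ℝ ∞ G) (q : Q) :
    ContDiff ℝ ∞ (fun x => G (x, q)) :=
  hG.comp (contDiff_id.prodMk contDiff_const)

lemma contDiff_PJ {G : E × Q → V} (hG : ContDiff ℝ ∞ G) (i : ℕ) :
    ContDiff ℝ ∞ (PJ G i) := by
  induction i with
  | zero =>
    have : PJ G 0 = fun z => (continuousMultilinearCurryFin0 ℝ E V).symm (G z) := by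
      funext z
      simp only [PJ]
      rw [iteratedFDeriv_zero_eq_comp]; rfl
    rw [this]
    exact (LinearIsometryEquiv.contDiff _).comp hG
  | succ i ih =>
    have : PJ G (i + 1) = fun z => (continuousMultilinearCurryLeftEquiv ℝ (fun _ : Fin (i+1) => E) V).symm
        (fderiv ℝ (fun x => PJ G i (x, z.2)) z.1) := by
      funext z
      simp only [PJ]
      rw [iteratedFDeriv_succ_eq_comp_left]; rfl
    rw [this]
    have hL := LinearIsometryEquiv.contDiff (𝕜 := ℝ) (n := ∞)
      (E := E →L[ℝ] (ContinuousMultilinearMap ℝ (fun _ : Fin i => E) V))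
      (F := ContinuousMultilinearMap ℝ (fun _ : Fin (i+1) => E) V)
      (continuousMultilinearCurryLeftEquiv ℝ (fun _ : Fin (i+1) => E) V).symm
    refine hL.comp ?_
    refine ContDiff.fderiv (f := fun (z : E × Q) (x : E) => PJ G i (x, z.2)) (g := fun z => z.1)
      (m := ∞) (n := ∞) ?_ contDiff_fst (by simp)
    exact ih.comp (contDiff_snd.prodMk (contDiff_snd.comp contDiff_fst))

lemma PJ_succ_apply {G : E × Q → V} (i : ℕ) (z : E × Q) (v : E) (w : Fin i → E) :
    PJ G (i + 1) z (Fin.cons v w) = (fderiv ℝ (fun x => PJ G i (x, z.2)) z.1 v) w := by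
  simp only [PJ]
  rw [iteratedFDeriv_succ_apply_left]
  simp

/-- Differentiating in the parameter commutes with jets. -/
lemma PJ_param {G : E × Q → V} (hG : ContDiff ℝ ∞ G) (q q' : Q) (i : ℕ) (x : E) :
    fderiv ℝ (PJ G i) (x, q) (0, q') =
      iteratedFDeriv ℝ i (fun x => fderiv ℝ G (x, q) (0, q')) x := by
  induction i generalizing x with
  | zero =>
    have : PJ G 0 = fun z => (continuousMultilinearCurryFin0 ℝ E V).symm (G z) := by
      funext z
      simp only [PJ]
      rw [iteratedFDeriv_zero_eq_comp]; rfl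
    rw [this, iteratedFDeriv_zero_eq_comp]
    have := LinearIsometryEquiv.comp_fderiv (𝕜 := ℝ) (iso := (continuousMultilinearCurryFin0 ℝ E V).symm) (f := G) (x := (x,q))
    simp only [Function.comp_def] at this ⊢
    rw [this]
    rfl
  | succ i ih =>
    have hs := contDiff_PJ hG i
    have hs1 := contDiff_PJ hG (i+1)
    have hd : ContDiff ℝ ∞ (fderiv ℝ (PJ G i)) := hs.fderiv_right (by simp)
    have hpart : ∀ (z : E × Q) (v : E), fderiv ℝ (fun x => PJ G i (x, z.2)) z.1 v
        = fderiv ℝ (PJ G i) z (v, 0) := by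
      intro z v
      have h1 : HasFDerivAt (fun x : E => (x, z.2)) (ContinuousLinearMap.inl ℝ E Q) z.1 :=
        hasFDerivAt_prodMk_left _ _
      have h2 : HasFDerivAt (PJ G i) (fderiv ℝ (PJ G i) z) (z.1, z.2) :=
        (hs.differentiable (by simp) z).hasFDerivAt
      have := (h2.comp z.1 h1).fderiv
      simp only [Function.comp_def] at this
      rw [this]; simp
    ext v
    obtain ⟨v0, w, rfl⟩ : ∃ v0 w, v = Fin.cons v0 w := ⟨v 0, Fin.tail v, (Fin.cons_self_tail v).symm⟩
    rw [iteratedFDeriv_succ_apply_left]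
    simp only [Fin.cons_zero, Fin.tail_cons]
    have hih : iteratedFDeriv ℝ i (fun x => fderiv ℝ G (x, q) (0, q')) =
        fun x => fderiv ℝ (PJ G i) (x, q) (0, q') := by
      funext x; exact (ih x).symm
    rw [hih]
    -- left side
    let ev : ContinuousMultilinearMap ℝ (fun _ : Fin (i+1) => E) V →L[ℝ] V :=
      ContinuousMultilinearMap.apply ℝ _ _ (Fin.cons v0 w)
    have e1 : fderiv ℝ (PJ G (i+1)) (x, q) (0, q') (Fin.cons v0 w)
        = fderiv ℝ (fun z => (fderiv ℝ (PJ G i) z (v0, 0)) w) (x, q) (0, q') := by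
      have h1 : (fun z => (fderiv ℝ (PJ G i) z (v0, 0)) w) = fun z => ev (PJ G (i+1) z) := by
        funext z
        rw [← hpart]
        exact (PJ_succ_apply i z v0 w).symm
      rw [h1]
      have := (ev.hasFDerivAt.comp (x, q) (hs1.differentiable (by simp) (x,q)).hasFDerivAt).fderiv
      simp only [Function.comp_def] at this
      rw [this]; rfl
    rw [e1]
    let ev' : ContinuousMultilinearMap ℝ (fun _ : Fin i => E) V →L[ℝ] V :=
      ContinuousMultilinearMap.apply ℝ _ _ w
    have hdd := (hd.differentiable (by simp) (x,q)).hasFDerivAt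
    have e2 : fderiv ℝ (fun z => (fderiv ℝ (PJ G i) z (v0, 0)) w) (x, q) (0, q')
        = (fderiv ℝ (fderiv ℝ (PJ G i)) (x,q) (0,q') (v0, 0)) w := by
      have h3 := hdd.clm_apply (hasFDerivAt_const ((v0, 0) : E × Q) (x,q))
      have h4 := (ev'.hasFDerivAt.comp (x,q) h3).fderiv
      simp only [Function.comp_def] at h4
      change fderiv ℝ (fun z => ev' (fderiv ℝ (PJ G i) z (v0, 0))) (x, q) (0, q') = _
      rw [h4]; simp [ev']
    have e3 : (fderiv ℝ (fun x => fderiv ℝ (PJ G i) (x, q) (0, q')) x v0)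
        = (fderiv ℝ (fderiv ℝ (PJ G i)) (x,q) (v0, 0) (0,q')) := by
      have h3 := hdd.clm_apply (hasFDerivAt_const ((0, q') : E × Q) (x,q))
      have h4 := (HasFDerivAt.comp x (f := fun e : E => (e, q)) h3 (hasFDerivAt_prodMk_left x q)).fderiv
      simp only [Function.comp_def] at h4
      rw [h4]; simp
    rw [e2, e3]
    have hsym := (hs.contDiffAt (x := (x,q))).isSymmSndFDerivAt (by
      simp only [minSmoothness_of_isRCLikeNormedField]; exact WithTop.coe_le_coe.2 le_top)
    rw [hsym.eq]

/-- Vanishing of low order jets of `φ ^ r • Ψ` at zeros of `φ`. -/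
lemma iteratedFDeriv_pow_smul_eq_zero {φ : E → ℝ} (hφ : ContDiff ℝ ∞ φ) (x : E) (hx : φ x = 0)
    (i : ℕ) : ∀ (r : ℕ) {V : Type} [NormedAddCommGroup V] [NormedSpace ℝ V] (Ψ : E → V),
      ContDiff ℝ ∞ Ψ → i < r → iteratedFDeriv ℝ i (fun y => φ y ^ r • Ψ y) x = 0 := by
  induction i with
  | zero =>
    intro r V _ _ Ψ hΨ hr
    ext v
    rw [iteratedFDeriv_zero_apply, hx, zero_pow (by omega)]; simp
  | succ i ih =>
    intro r V _ _ Ψ hΨ hr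
    obtain ⟨r, rfl⟩ : ∃ k, r = k + 1 := ⟨r - 1, by omega⟩
    rw [← norm_eq_zero, ← norm_iteratedFDeriv_fderiv, norm_eq_zero]
    have h : fderiv ℝ (fun y => φ y ^ (r+1) • Ψ y) = fun y => φ y ^ r •
        (((r : ℝ) + 1) • (fderiv ℝ φ y).smulRight (Ψ y) + φ y • fderiv ℝ Ψ y) := by
      funext y
      have h1 := (hφ.differentiable (by simp) y).hasFDerivAt
      have h2 := (hΨ.differentiable (by simp) y).hasFDerivAt
      have h3 := ((h1.pow (r+1)).smul h2).fderiv
      have h4 : (fun y => φ y ^ (r+1) • Ψ y) = (fun y => φ y ^ (r+1)) • Ψ := rfl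
      rw [h4]
      rw [h3]
      ext v
      simp [pow_succ, smul_smul]
      rw [add_comm]
      congr 2; ring
    rw [h]
    refine ih r _ ?_ (by omega)
    have h1 : ContDiff ℝ ∞ (fderiv ℝ φ) := hφ.fderiv_right (by simp)
    have h2 : ContDiff ℝ ∞ (fderiv ℝ Ψ) := hΨ.fderiv_right (by simp)
    exact ((h1.smulRight hΨ).const_smul _).add (hφ.smul h2)

end PJ

/-! ### Symmetry of iterated derivatives, and the integral lift -/

section Lift

variable {E Q V : Type} [NormedAddCommGroup E] [NormedSpace ℝ E]
    [NormedAddCommGroup Q] [NormedSpace ℝ Q] [NormedAddCommGroup V] [NormedSpace ℝ V]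

lemma iteratedFDeriv_swap {f : E → V} (hf : ContDiff ℝ ∞ f) (n : ℕ) :
    ∀ (x : E) (i : Fin n) (v : Fin (n + 1) → E),
      iteratedFDeriv ℝ (n + 1) f x (v ∘ Equiv.swap i.castSucc i.succ) =
        iteratedFDeriv ℝ (n + 1) f x v := by
  induction n with
  | zero => intro x i; exact i.elim0
  | succ n ih =>
    intro x i v
    have hs : ∀ k, ContDiff ℝ ∞ (iteratedFDeriv ℝ k f) := fun k =>
      hf.iteratedFDeriv_right (m := ∞) (by exact_mod_cast le_top)
    rcases Fin.eq_zero_or_eq_succ i with rfl | ⟨j, rfl⟩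
    · have key : ∀ u : Fin (n + 2) → E, iteratedFDeriv ℝ (n + 1 + 1) f x u =
          (fderiv ℝ (fderiv ℝ (iteratedFDeriv ℝ n f)) x (u 0) (u 1)) (Fin.tail (Fin.tail u)) := by
        intro u
        rw [iteratedFDeriv_succ_apply_left, iteratedFDeriv_succ_eq_comp_left]
        have hL := LinearIsometryEquiv.comp_fderiv (𝕜 := ℝ)
          (E := E →L[ℝ] (ContinuousMultilinearMap ℝ (fun _ : Fin n => E) V))
          (F := ContinuousMultilinearMap ℝ (fun _ : Fin (n+1) => E) V)
          (iso := (continuousMultilinearCurryLeftEquiv ℝ (fun _ : Fin (n+1) => E) V).symm)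
          (f := fderiv ℝ (iteratedFDeriv ℝ n f)) (x := x)
        erw [hL]
        rfl
      rw [key, key]
      have hsym := ((hs n).contDiffAt (x := x)).isSymmSndFDerivAt (by
        simp only [minSmoothness_of_isRCLikeNormedField]; exact WithTop.coe_le_coe.2 le_top)
      have h0 : (v ∘ Equiv.swap (Fin.castSucc (0 : Fin (n+1))) (Fin.succ 0)) 0 = v 1 := by
        simp
      have h1 : (v ∘ Equiv.swap (Fin.castSucc (0 : Fin (n+1))) (Fin.succ 0)) 1 = v 0 := by
        have : (1 : Fin (n+2)) = Fin.succ 0 := rfl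
        rw [this]; simp only [Function.comp, Equiv.swap_apply_right]; rfl
      have h2 : Fin.tail (Fin.tail (v ∘ Equiv.swap (Fin.castSucc (0 : Fin (n+1))) (Fin.succ 0)))
          = Fin.tail (Fin.tail v) := by
        funext k
        simp only [Fin.tail, Function.comp]
        rw [Equiv.swap_apply_of_ne_of_ne]
        · simp [Fin.ext_iff]
        · simp [Fin.ext_iff]
      rw [h0, h1, h2, hsym.eq]
    · rw [iteratedFDeriv_succ_apply_left, iteratedFDeriv_succ_apply_left]
      have h0 : (v ∘ Equiv.swap (Fin.castSucc j.succ) (Fin.succ j.succ)) 0 = v 0 := by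
        simp only [Function.comp]
        rw [Equiv.swap_apply_of_ne_of_ne]
        · simp [Fin.ext_iff]
        · simp [Fin.ext_iff]
      have h1 : Fin.tail (v ∘ Equiv.swap (Fin.castSucc j.succ) (Fin.succ j.succ)) =
          Fin.tail v ∘ Equiv.swap j.castSucc j.succ := by
        funext k
        simp only [Fin.tail, Function.comp]
        congr 1
        rw [← Fin.succ_castSucc]
        exact (Fin.succ_injective _).swap_apply _ _ _
      rw [h0, h1]
      have hd := ((hs (n+1)).differentiable (by simp) x).hasFDerivAt
      have e : ∀ w : Fin (n+1) → E, (fderiv ℝ (iteratedFDeriv ℝ (n+1) f) x (v 0)) w =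
          fderiv ℝ (fun y => iteratedFDeriv ℝ (n+1) f y w) x (v 0) := by
        intro w
        let ev : ContinuousMultilinearMap ℝ (fun _ : Fin (n+1) => E) V →L[ℝ] V :=
          ContinuousMultilinearMap.apply ℝ _ _ w
        have := (ev.hasFDerivAt.comp x hd).fderiv
        change _ = fderiv ℝ (⇑ev ∘ iteratedFDeriv ℝ (n+1) f) x (v 0)
        rw [this]; rfl
      rw [e, e]
      congr 2
      funext y
      exact ih y j _

lemma iteratedFDeriv_perm {f : E → V} (hf : ContDiff ℝ ∞ f) (n : ℕ) (x : E)
    (e : Equiv.Perm (Fin n)) (v : Fin n → E) :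
      iteratedFDeriv ℝ n f x (v ∘ e) = iteratedFDeriv ℝ n f x v := by
  cases n with
  | zero => congr 1; funext i; exact i.elim0
  | succ n =>
    have he : e ∈ Submonoid.closure (Set.range fun i : Fin n ↦ Equiv.swap i.castSucc i.succ) := by
      rw [Equiv.Perm.mclosure_swap_castSucc_succ]; trivial
    induction he using Submonoid.closure_induction generalizing v with
    | mem y hy =>
      obtain ⟨i, rfl⟩ := hy
      exact iteratedFDeriv_swap hf n x i v
    | one => rfl
    | mul a b _ _ ha hb =>
      have : v ∘ ⇑(a * b) = (v ∘ a) ∘ b := rfl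
      rw [this, hb, ha]

/-- Truncated Taylor polynomial. -/
def TP {Y : Type} [NormedAddCommGroup Y] [NormedSpace ℝ Y] (r : ℕ) (η : Fin (r + 1) → Y) (z : ℝ) : Y :=
  ∑ k : Fin (r + 1), (z ^ (k : ℕ) / (k : ℕ).factorial) • η k

lemma TP_zero {Y : Type} [NormedAddCommGroup Y] [NormedSpace ℝ Y] (r : ℕ) (η : Fin (r + 1) → Y) :
    TP r η 0 = η 0 := by
  rw [TP, Fin.sum_univ_succ]; simp

lemma contDiff_TP {Y : Type} [NormedAddCommGroup Y] [NormedSpace ℝ Y] (r : ℕ) :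
    ContDiff ℝ ∞ (fun p : (Fin (r + 1) → Y) × ℝ => TP r p.1 p.2) := by
  unfold TP
  refine ContDiff.sum fun k _ => ?_
  refine ContDiff.smul (by fun_prop) ?_
  exact (contDiff_apply ℝ Y k).comp contDiff_fst

variable {Y : Type} [NormedAddCommGroup Y] [NormedSpace ℝ Y]

/-- The local extension used to define the integral lift. -/
def LG (r : ℕ) (F : E × Y → V) (U : E → ℝ) (z : E × ((Fin (r + 1) → Y) × ℝ)) : V :=
  F (z.1, TP r z.2.1 (U z.1 - z.2.2))

lemma contDiff_LG (r : ℕ) {F : E × Y → V} {U : E → ℝ} (hF : ContDiff ℝ ∞ F) (hU : ContDiff ℝ ∞ U) :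
    ContDiff ℝ ∞ (LG r F U) := by
  unfold LG
  refine hF.comp (contDiff_fst.prodMk ?_)
  have := (contDiff_TP (Y := Y) r)
  exact this.comp ((contDiff_fst.comp contDiff_snd).prodMk
    ((hU.comp contDiff_fst).sub (contDiff_snd.comp contDiff_snd)))

/-- Integrality of the lift. -/
lemma LG_integral (r : ℕ) {F : E × Y → V} {U : E → ℝ} (hF : ContDiff ℝ ∞ F) (hU : ContDiff ℝ ∞ U)
    {X : E → E} (hX : ContDiff ℝ ∞ X) {η : Fin (r + 1) → E → Y} (hη : ∀ k, ContDiff ℝ ∞ (η k))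
    {υ : E → ℝ} (hυ : ContDiff ℝ ∞ υ) (hUX : ∀ p, U (X p) = υ p)
    (hrec : ∀ k : Fin r, ∀ p v, fderiv ℝ (η k.castSucc) p v = fderiv ℝ υ p v • η k.succ p)
    (i : ℕ) (hi : i < r) (p v : E) (w : Fin i → E) :
    (fderiv ℝ (fun p => PJ (LG r F U) i (X p, (fun k => η k p, υ p))) p v) w =
      PJ (LG r F U) (i + 1) (X p, (fun k => η k p, υ p)) (Fin.cons (fderiv ℝ X p v) w) := by
  have hG := contDiff_LG r hF hU
  have hJ := contDiff_PJ hG i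
  set q : E → (Fin (r + 1) → Y) × ℝ := fun p => (fun k => η k p, υ p) with hq
  have hqs : ContDiff ℝ ∞ q := (contDiff_pi.2 hη).prodMk hυ
  have hXd := (hX.differentiable (by simp) p).hasFDerivAt
  have hqd := (hqs.differentiable (by simp) p).hasFDerivAt
  have hJd := (hJ.differentiable (by simp) (X p, q p)).hasFDerivAt
  have h1 := (HasFDerivAt.comp p (f := fun p => (X p, q p)) hJd (hXd.prodMk hqd)).fderiv
  simp only [Function.comp_def] at h1
  rw [h1]
  rw [PJ_succ_apply]
  have hpart : fderiv ℝ (fun x => PJ (LG r F U) i (x, q p)) (X p) (fderiv ℝ X p v)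
        = fderiv ℝ (PJ (LG r F U) i) (X p, q p) (fderiv ℝ X p v, 0) := by
    have := (HasFDerivAt.comp (X p) (f := fun e => (e, q p)) hJd (hasFDerivAt_prodMk_left (X p) (q p))).fderiv
    simp only [Function.comp_def] at this
    rw [this]; simp
  simp only
  rw [hpart]
  have hsplit : ((fderiv ℝ X p).prod (fderiv ℝ q p)) v = (fderiv ℝ X p v, 0) + (0, fderiv ℝ q p v) := by
    simp
  rw [ContinuousLinearMap.comp_apply, hsplit, map_add]
  suffices h : fderiv ℝ (PJ (LG r F U) i) (X p, q p) (0, fderiv ℝ q p v) = 0 by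
    rw [h]; simp
  rw [PJ_param hG]
  -- the parameter derivative is divisible by the `r`-th power
  have hmain : ∀ x, fderiv ℝ (LG r F U) (x, q p) (0, fderiv ℝ q p v) =
      (U x - υ p) ^ r • fderiv ℝ F (x, TP r (fun k => η k p) (U x - υ p))
        (0, (1 / (r.factorial : ℝ)) • fderiv ℝ (η (Fin.last r)) p v) := by
    intro x
    have hGd := (hG.differentiable (by simp) (x, q p)).hasFDerivAt
    have e1 := (HasFDerivAt.comp p (f := fun p => (x, q p)) hGd ((hasFDerivAt_const x p).prodMk hqd)).fderiv
    have e2 : fderiv ℝ (LG r F U) (x, q p) (0, fderiv ℝ q p v) =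
        fderiv ℝ (LG r F U ∘ fun p => (x, q p)) p v := by
      rw [e1]; simp
    rw [e2]
    have hT : HasFDerivAt (fun p' => TP r (fun k => η k p') (U x - υ p'))
        (∑ k : Fin (r+1), (((U x - υ p) ^ (k:ℕ) / (k:ℕ).factorial) • fderiv ℝ (η k) p +
          (((((k:ℕ):ℝ) * (U x - υ p) ^ ((k:ℕ) - 1) / (k:ℕ).factorial)) • (-fderiv ℝ υ p)).smulRight (η k p))) p := by
      unfold TP
      refine HasFDerivAt.fun_sum fun k _ => ?_
      have a1 := ((hη k).differentiable (by simp) p).hasFDerivAt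
      have a2 := (hυ.differentiable (by simp) p).hasFDerivAt
      have a3 := ((a2.const_sub (U x)).pow (k:ℕ)).mul_const (((k:ℕ).factorial : ℝ)⁻¹)
      have a4 := a3.smul a1
      simp only [div_eq_mul_inv]
      refine a4.congr_fderiv ?_
      ext u
      simp only [_root_.add_apply, _root_.smul_apply, ContinuousLinearMap.smulRight_apply, _root_.neg_apply, smul_eq_mul, nsmul_eq_mul]
      congr 2
      ring
    have hFd := (hF.differentiable (by simp) (x, TP r (fun k => η k p) (U x - υ p))).hasFDerivAt
    have e3 := (HasFDerivAt.comp p (f := fun p' => (x, TP r (fun k => η k p') (U x - υ p'))) hFd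
      ((hasFDerivAt_const x p).prodMk hT)).fderiv
    have e4 : (LG r F U ∘ fun p => (x, q p)) = F ∘ fun p' => (x, TP r (fun k => η k p') (U x - υ p')) := rfl
    rw [e4, e3, ← map_smul]
    simp only [ContinuousLinearMap.comp_apply]
    congr 1
    simp only [ContinuousLinearMap.prod_apply, Prod.smul_mk, smul_zero]
    congr 1
    set s := U x - υ p
    simp only [_root_.sum_apply, _root_.add_apply, Finset.sum_add_distrib]
    rw [Fin.sum_univ_castSucc, Fin.sum_univ_succ (n := r) (f := fun k : Fin (r+1) => (((((k:ℕ):ℝ) * s ^ ((k:ℕ) - 1) / (k:ℕ).factorial)) • (-fderiv ℝ υ p)).smulRight (η k p) v)]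
    simp only [_root_.smul_apply, hrec, ContinuousLinearMap.smulRight_apply,
      _root_.neg_apply, Fin.val_castSucc, Fin.val_succ, Fin.val_last, Fin.val_zero]
    have : ∀ k : Fin r, ((((k:ℕ) + 1 : ℕ):ℝ) * s ^ ((k:ℕ) + 1 - 1) / (((k:ℕ) + 1).factorial : ℝ)) = s ^ (k:ℕ) / ((k:ℕ).factorial) := by
      intro k
      rw [Nat.factorial_succ]; push_cast
      have : ((k:ℕ):ℝ) + 1 ≠ 0 := by positivity
      have : (((k:ℕ).factorial:ℕ):ℝ) ≠ 0 := by positivity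
      field_simp
    have h5 : ∑ i : Fin r, ((((i:ℕ) + 1 : ℕ) * s ^ ((i:ℕ) + 1 - 1) / (((i:ℕ) + 1).factorial : ℝ)) •
        -(fderiv ℝ υ p) v) • η i.succ p = ∑ i : Fin r, ((s ^ (i:ℕ) / ((i:ℕ).factorial)) •
        -(fderiv ℝ υ p) v) • η i.succ p := Finset.sum_congr rfl fun k _ => by rw [this k]
    rw [h5]
    simp only [smul_smul, smul_eq_mul]
    simp only [mul_neg, neg_smul, Finset.sum_neg_distrib]
    simp
    rw [div_eq_mul_inv]
  have hfun : (fun x => fderiv ℝ (LG r F U) (x, q p) (0, fderiv ℝ q p v)) = fun x =>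
      (U x - υ p) ^ r • fderiv ℝ F (x, TP r (fun k => η k p) (U x - υ p))
        (0, (1 / (r.factorial : ℝ)) • fderiv ℝ (η (Fin.last r)) p v) := funext hmain
  rw [hfun]
  refine iteratedFDeriv_pow_smul_eq_zero (hU.sub contDiff_const) (X p) (by rw [hUX]; simp) i r _ ?_ hi
  have hF' : ContDiff ℝ ∞ (fderiv ℝ F) := hF.fderiv_right (by simp)
  refine ContDiff.clm_apply (hF'.comp (contDiff_id.prodMk ?_)) contDiff_const
  exact (contDiff_TP (Y := Y) r).comp (contDiff_const.prodMk (hU.sub contDiff_const))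

end Lift

/-! ### One dimensional zig-zags -/

section Zig

inductive Tame : (ℕ → ℝ → ℝ) → Prop
  | const (c : ℝ) : Tame (fun _ _ => c)
  | invN : Tame (fun N _ => 1 / (N : ℝ))
  | sN : Tame (fun N t => Real.sin (2 * Real.pi * t / N))
  | cN : Tame (fun N t => Real.cos (2 * Real.pi * t / N))
  | s1 : Tame (fun _ t => Real.sin (2 * Real.pi * t))
  | c1 : Tame (fun _ t => Real.cos (2 * Real.pi * t))
  | add {p q : ℕ → ℝ → ℝ} : Tame p → Tame q → Tame (fun N t => p N t + q N t)
  | mul {p q : ℕ → ℝ → ℝ} : Tame p → Tame q → Tame (fun N t => p N t * q N t)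

lemma Tame.pow {p : ℕ → ℝ → ℝ} (hp : Tame p) (k : ℕ) : Tame (fun N t => p N t ^ k) := by
  induction k with
  | zero => simpa using Tame.const 1
  | succ k ih => simpa only [pow_succ] using ih.mul hp

lemma Tame.bounded {p : ℕ → ℝ → ℝ} (hp : Tame p) : ∃ C : ℝ, 0 ≤ C ∧ ∀ N : ℕ, ∀ t, |p N t| ≤ C := by
  induction hp with
  | const c => exact ⟨|c|, abs_nonneg _, fun _ _ => le_rfl⟩
  | invN =>
    refine ⟨1, by norm_num, fun N t => ?_⟩
    rcases Nat.eq_zero_or_pos N with rfl | h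
    · simp
    · have : (1:ℝ) ≤ N := by exact_mod_cast h
      rw [abs_of_nonneg (by positivity)]
      exact (div_le_one (by positivity)).2 this
  | sN => exact ⟨1, by norm_num, fun N t => Real.abs_sin_le_one _⟩
  | cN => exact ⟨1, by norm_num, fun N t => Real.abs_cos_le_one _⟩
  | s1 => exact ⟨1, by norm_num, fun N t => Real.abs_sin_le_one _⟩
  | c1 => exact ⟨1, by norm_num, fun N t => Real.abs_cos_le_one _⟩
  | add _ _ h1 h2 =>
    obtain ⟨C1, h1, h1'⟩ := h1
    obtain ⟨C2, h2, h2'⟩ := h2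
    exact ⟨C1 + C2, by positivity, fun N t => (abs_add_le _ _).trans (add_le_add (h1' N t) (h2' N t))⟩
  | mul _ _ h1 h2 =>
    obtain ⟨C1, h1, h1'⟩ := h1
    obtain ⟨C2, h2, h2'⟩ := h2
    refine ⟨C1 * C2, by positivity, fun N t => ?_⟩
    rw [abs_mul]
    exact mul_le_mul (h1' N t) (h2' N t) (abs_nonneg _) h1

lemma Tame.analytic {p : ℕ → ℝ → ℝ} (hp : Tame p) (N : ℕ) : AnalyticOnNhd ℝ (p N) Set.univ := by
  induction hp with
  | const c => exact analyticOnNhd_const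
  | invN => exact analyticOnNhd_const
  | sN => intro t _; fun_prop
  | cN => intro t _; fun_prop
  | s1 => intro t _; fun_prop
  | c1 => intro t _; fun_prop
  | add _ _ h1 h2 => exact h1.add h2
  | mul _ _ h1 h2 => exact h1.mul h2

lemma Tame.contDiff {p : ℕ → ℝ → ℝ} (hp : Tame p) (N : ℕ) : ContDiff ℝ ∞ (p N) :=
  contDiffOn_univ.1 ((hp.analytic N).contDiffOn uniqueDiffOn_univ)

lemma Tame.periodic {p : ℕ → ℝ → ℝ} (hp : Tame p) (N : ℕ) (hN : 1 ≤ N) :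
    Function.Periodic (p N) N := by
  have hN' : (N:ℝ) ≠ 0 := by positivity
  have e1 : ∀ t : ℝ, 2 * Real.pi * (t + N) / N = 2 * Real.pi * t / N + 2 * Real.pi := by
    intro t; field_simp
  have e2 : ∀ t : ℝ, 2 * Real.pi * (t + N) = 2 * Real.pi * t + N * (2 * Real.pi) := by
    intro t; ring
  induction hp with
  | const c => intro t; rfl
  | invN => intro t; rfl
  | sN => intro t; simp only [e1, Real.sin_add_two_pi]
  | cN => intro t; simp only [e1, Real.cos_add_two_pi]
  | s1 => intro t; simp only [e2, Real.sin_add_nat_mul_two_pi]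
  | c1 => intro t; simp only [e2, Real.cos_add_nat_mul_two_pi]
  | add _ _ h1 h2 => intro t; simp only [h1 t, h2 t]
  | mul _ _ h1 h2 => intro t; simp only [h1 t, h2 t]

lemma Tame.hasDeriv {p : ℕ → ℝ → ℝ} (hp : Tame p) :
    ∃ p', Tame p' ∧ ∀ (N : ℕ) (t : ℝ), HasDerivAt (p N) (p' N t) t := by
  have eN : ∀ (N : ℕ) (t : ℝ), HasDerivAt (fun t : ℝ => 2 * Real.pi * t / N) (2 * Real.pi * (1 / (N:ℝ))) t := by
    intro N t
    have := ((hasDerivAt_id t).const_mul (2 * Real.pi)).div_const (N:ℝ)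
    simp only [id] at this
    exact this.congr_deriv (by ring)
  have e1 : ∀ (t : ℝ), HasDerivAt (fun t : ℝ => 2 * Real.pi * t) (2 * Real.pi) t := by
    intro t
    have := ((hasDerivAt_id t).const_mul (2 * Real.pi))
    simp only [id] at this
    exact this.congr_deriv (by ring)
  induction hp with
  | const c => exact ⟨_, Tame.const 0, fun N t => hasDerivAt_const _ _⟩
  | invN => exact ⟨_, Tame.const 0, fun N t => hasDerivAt_const _ _⟩
  | sN => exact ⟨_, Tame.cN.mul ((Tame.const (2 * Real.pi)).mul Tame.invN), fun N t => (eN N t).sin⟩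
  | cN => 
    refine ⟨_, (Tame.const (-1)).mul (Tame.sN.mul ((Tame.const (2 * Real.pi)).mul Tame.invN)), fun N t => ?_⟩
    convert (eN N t).cos using 1; ring
  | s1 => exact ⟨_, Tame.c1.mul (Tame.const (2 * Real.pi)), fun N t => (e1 t).sin⟩
  | c1 => 
    refine ⟨_, (Tame.const (-1)).mul (Tame.s1.mul ((Tame.const (2 * Real.pi)))), fun N t => ?_⟩
    convert (e1 t).cos using 1; ring
  | add _ _ h1 h2 =>
    obtain ⟨p1, h1, h1'⟩ := h1
    obtain ⟨p2, h2, h2'⟩ := h2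
    exact ⟨_, h1.add h2, fun N t => (h1' N t).add (h2' N t)⟩
  | mul hp hq h1 h2 =>
    obtain ⟨p1, h1, h1'⟩ := h1
    obtain ⟨p2, h2, h2'⟩ := h2
    exact ⟨_, (h1.mul hq).add (hp.mul h2), fun N t => (h1' N t).mul (h2' N t)⟩

/-- Tower of divided derivatives. -/
lemma Tame.tower {s : ℕ → ℝ → ℝ} (hs : Tame s) (m : ℕ) : ∀ {q : ℕ → ℝ → ℝ}, Tame q →
    ∃ β : ℕ → ℕ → ℝ → ℝ, (∀ k, Tame (β k)) ∧ (β 0 = fun N t => s N t ^ (2 * m + 1) * q N t) ∧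
      ∀ k < m, ∀ N t, HasDerivAt (β k N) (β (k + 1) N t * s N t) t := by
  obtain ⟨s', hs', hss'⟩ := hs.hasDeriv
  induction m with
  | zero =>
    intro q hq
    exact ⟨fun _ => fun N t => s N t ^ (2 * 0 + 1) * q N t, fun _ => (hs.pow _).mul hq, rfl, by simp⟩
  | succ m ih =>
    intro q hq
    obtain ⟨q', hq', hqq'⟩ := hq.hasDeriv
    obtain ⟨β, hβ, hβ0, hβd⟩ := ih (q := fun N t => (2 * m + 3) * (s' N t * q N t) + s N t * q' N t)
      (((Tame.const (2 * m + 3)).mul (hs'.mul hq)).add (hs.mul hq'))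
    refine ⟨fun k => Nat.casesOn k (fun N t => s N t ^ (2 * (m + 1) + 1) * q N t) β, ?_, rfl, ?_⟩
    · intro k
      cases k with
      | zero => exact (hs.pow _).mul hq
      | succ k => exact hβ k
    · intro k hk N t
      cases k with
      | zero =>
        have := ((hss' N t).pow (2 * (m + 1) + 1)).mul (hqq' N t)
        refine this.congr_deriv ?_
        simp only [hβ0]
        push_cast
        simp only [Pi.pow_apply]
        ring
      | succ k => exact hβd k (by omega) N t

lemma quasi_linear {f : ℝ → ℝ} (hf : Monotone f) (h0 : f 0 = 0) {P : ℝ} (hP : 0 < P)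
    (hper : ∀ t, f (t + P) = f t + 1) (t : ℝ) : |f t - t / P| ≤ 1 := by
  have hn : ∀ (k : ℕ) (t : ℝ), f (t + k * P) = f t + k := by
    intro k
    induction k with
    | zero => intro t; simp
    | succ k ih =>
      intro t
      have : t + ((k + 1 : ℕ) : ℝ) * P = (t + k * P) + P := by push_cast; ring
      rw [this, hper, ih]; push_cast; ring
  have hz : ∀ (k : ℤ) (t : ℝ), f (t + k * P) = f t + k := by
    intro k t
    obtain ⟨k, rfl | rfl⟩ := k.eq_nat_or_neg
    · exact_mod_cast hn k t
    · have := hn k (t + ((-(k:ℤ) : ℤ) : ℝ) * P)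
      push_cast at this ⊢
      rw [show t + -(k:ℝ) * P + k * P = t by ring] at this
      linarith
  set k := ⌊t / P⌋
  have h1 : (k:ℝ) ≤ t / P := Int.floor_le _
  have h2 : t / P < k + 1 := Int.lt_floor_add_one _
  have h3 : (k:ℝ) * P ≤ t := (le_div_iff₀ hP).1 h1
  have h4 : t ≤ ((k + 1 : ℤ):ℝ) * P := by push_cast; exact ((div_lt_iff₀ hP).1 h2).le
  have h5 := hf h3
  have h6 := hf h4
  have h7 := hz k 0
  have h8 := hz (k+1) 0
  rw [zero_add, h0, zero_add] at h7 h8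
  rw [h7] at h5
  rw [h8] at h6
  push_cast at h6
  rw [abs_le]; constructor <;> linarith

lemma prim_hasDeriv {h : ℝ → ℝ} (hh : Continuous h) (t : ℝ) :
    HasDerivAt (fun t => ∫ u in (0:ℝ)..t, h u) (h t) t :=
  (hh.integral_hasStrictDerivAt 0 t).hasDerivAt

lemma contDiff_of_hasDeriv {f h : ℝ → ℝ} (hh : ContDiff ℝ ∞ h) (hf : ∀ t, HasDerivAt f (h t) t) :
    ContDiff ℝ ∞ f := by
  rw [contDiff_infty_iff_deriv]
  refine ⟨fun t => (hf t).differentiableAt, ?_⟩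
  have : deriv f = h := funext fun t => (hf t).deriv
  rwa [this]

lemma prim_periodic {h : ℝ → ℝ} (hh : Continuous h) {P : ℝ} (hP : Function.Periodic h P) (t : ℝ) :
    (∫ u in (0:ℝ)..(t + P), h u) = (∫ u in (0:ℝ)..t, h u) + ∫ u in (0:ℝ)..P, h u := by
  have h1 := hP.intervalIntegral_add_eq t 0
  rw [zero_add] at h1
  rw [← h1, intervalIntegral.integral_add_adjacent_intervals] <;>
  exact hh.intervalIntegrable _ _

/-- The speed of the zig-zag. -/
def zs (N : ℕ) (t : ℝ) : ℝ :=
  1 / (N:ℝ) + 1 / (N:ℝ) * (Real.sin (2 * Real.pi * t / N) * (Real.cos (2 * Real.pi * t / N) * Real.sin (2 * Real.pi * t))) +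
    1 / 2 * (Real.sin (2 * Real.pi * t / N) ^ 2 * Real.cos (2 * Real.pi * t))

/-- The zig-zag. -/
def zx (N : ℕ) (t : ℝ) : ℝ :=
  t / N + 1 / (4 * Real.pi) * (Real.sin (2 * Real.pi * t / N) ^ 2 * Real.sin (2 * Real.pi * t))

lemma tame_zs : Tame zs :=
  (Tame.invN.add (Tame.invN.mul (Tame.sN.mul (Tame.cN.mul Tame.s1)))).add
    ((Tame.const (1/2)).mul ((Tame.sN.pow 2).mul Tame.c1))

lemma zx_hasDeriv (N : ℕ) (t : ℝ) : HasDerivAt (zx N) (zs N t) t := by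
  have eN : HasDerivAt (fun t : ℝ => 2 * Real.pi * t / N) (2 * Real.pi * (1 / (N:ℝ))) t := by
    have := ((hasDerivAt_id t).const_mul (2 * Real.pi)).div_const (N:ℝ)
    simp only [id] at this
    exact this.congr_deriv (by ring)
  have e1 : HasDerivAt (fun t : ℝ => 2 * Real.pi * t) (2 * Real.pi) t := by
    have := ((hasDerivAt_id t).const_mul (2 * Real.pi))
    simp only [id] at this
    exact this.congr_deriv (by ring)
  have h := ((hasDerivAt_id t).div_const (N:ℝ)).add (((eN.sin.pow 2).mul e1.sin).const_mul (1 / (4 * Real.pi)))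
  refine h.congr_deriv ?_
  have := Real.pi_ne_zero
  simp only [zs, Pi.pow_apply]
  field_simp
  ring

lemma zs_even (N : ℕ) (t : ℝ) : zs N (-t) = zs N t := by
  simp only [zs, mul_neg, neg_div, Real.sin_neg, Real.cos_neg]
  ring

lemma integral_cos_zero (N : ℕ) (hN : 1 ≤ N) (k : ℕ) (hk : 1 ≤ k) :
    ∫ t in (0:ℝ)..N, Real.cos (2 * Real.pi * k / N * t) = 0 := by
  have hN' : (N:ℝ) ≠ 0 := by positivity
  have hk' : (k:ℝ) ≠ 0 := by positivity
  have := Real.pi_ne_zero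
  rw [intervalIntegral.integral_comp_mul_left (fun u => Real.cos u) (by positivity), integral_cos]
  have : 2 * Real.pi * k / N * N = ((2 * k : ℕ):ℝ) * Real.pi := by push_cast; field_simp
  rw [this, Real.sin_nat_mul_pi]
  simp

lemma zs_lower (r N : ℕ) (hN : 1 ≤ N) (t : ℝ) :
    (1/64:ℝ)^r * ((1/2 + (r:ℝ)/2 - 128 * r / N) + r * Real.cos (2 * Real.pi * (2 * N : ℕ) / N * t)
      - (5/2 * r + 1/2) * Real.cos (2 * Real.pi * (2:ℕ) / N * t) - 3/2 * r * (Real.cos (2 * Real.pi * (2 * N + 2 : ℕ) / N * t)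
        + Real.cos (2 * Real.pi * (2 * N - 2 : ℕ) / N * t))) 
      ≤ zs N t ^ (2 * r) * Real.sin (2 * Real.pi * t / N) ^ 2 := by
  have hN' : (1:ℝ) ≤ N := by exact_mod_cast hN
  have hN0 : (N:ℝ) ≠ 0 := by positivity
  set S := Real.sin (2 * Real.pi * t / N) with hS
  set Co := Real.cos (2 * Real.pi * t / N) with hCo
  set s1 := Real.sin (2 * Real.pi * t) with hs1
  set c1 := Real.cos (2 * Real.pi * t) with hc1
  have eSC : S ^ 2 + Co ^ 2 = 1 := Real.sin_sq_add_cos_sq _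
  have esc : s1 ^ 2 + c1 ^ 2 = 1 := Real.sin_sq_add_cos_sq _
  have c2 : Real.cos (2 * Real.pi * (2:ℕ) / N * t) = 1 - 2 * S ^ 2 := by
    have : 2 * Real.pi * (2:ℕ) / N * t = 2 * (2 * Real.pi * t / N) := by push_cast; ring
    rw [this, Real.cos_two_mul, ← hCo]; linarith
  have c2N : Real.cos (2 * Real.pi * (2 * N : ℕ) / N * t) = 2 * c1 ^ 2 - 1 := by
    have : 2 * Real.pi * (2 * N:ℕ) / N * t = 2 * (2 * Real.pi * t) := by push_cast; field_simp
    rw [this, Real.cos_two_mul]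
  have cpm : Real.cos (2 * Real.pi * (2 * N + 2 : ℕ) / N * t)
        + Real.cos (2 * Real.pi * (2 * N - 2 : ℕ) / N * t) = 2 * ((2 * c1 ^ 2 - 1) * (1 - 2 * S ^ 2)) := by
    have e1 : 2 * Real.pi * (2 * N + 2:ℕ) / N * t = 2 * Real.pi * (2 * N:ℕ) / N * t + 2 * Real.pi * (2:ℕ) / N * t := by
      push_cast; ring
    have e2 : 2 * Real.pi * (2 * N - 2:ℕ) / N * t = 2 * Real.pi * (2 * N:ℕ) / N * t - 2 * Real.pi * (2:ℕ) / N * t := by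
      rw [Nat.cast_sub (by omega)]; push_cast; ring
    rw [e1, e2, Real.cos_add, Real.cos_sub, c2, c2N]; ring
  rw [cpm, c2N, c2]
  set s := zs N t with hs
  -- pointwise bound on the square
  have hsw : s ^ 2 * S ^ 2 ≥ 1/4 * (3/4 * S^2 - 1/4) * c1^2 - 2 / N := by
    have hse : s = 1 / N * (1 + S * (Co * s1)) + 1/2 * (S^2 * c1) := by
      rw [hs, zs]; ring
    have b1 : |S| ≤ 1 := Real.abs_sin_le_one _
    have b2 : |Co| ≤ 1 := Real.abs_cos_le_one _
    have b3 : |s1| ≤ 1 := Real.abs_sin_le_one _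
    have b4 : |c1| ≤ 1 := Real.abs_cos_le_one _
    have b5 : |S * (Co * s1)| ≤ 1 := by
      rw [abs_mul, abs_mul]
      exact mul_le_one₀ b1 (by positivity) (mul_le_one₀ b2 (by positivity) b3)
    have b6 : |S ^ 2 * c1| ≤ 1 := by
      rw [abs_mul, abs_pow]
      exact mul_le_one₀ (pow_le_one₀ (abs_nonneg _) b1) (by positivity) b4
    set e := 1 / (N:ℝ) * (1 + S * (Co * s1)) with he
    have b7 : |e| ≤ 2 / N := by
      rw [he, abs_mul, abs_of_nonneg (show (0:ℝ) ≤ 1 / N by positivity)]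
      have : |1 + S * (Co * s1)| ≤ 2 := by
        have := abs_le.1 b5
        rw [abs_le]; constructor <;> linarith
      calc 1 / (N:ℝ) * |1 + S * (Co * s1)| ≤ 1 / N * 2 := by gcongr
        _ = 2 / N := by ring
    have b8 : s ^ 2 ≥ (1/2 * (S^2 * c1))^2 - 2 / N := by
      have : |e * (S^2 * c1)| ≤ 2 / N := by
        rw [abs_mul]
        calc |e| * |S^2 * c1| ≤ 2 / N * 1 := by gcongr
          _ = _ := by ring
      have := abs_le.1 this
      rw [hse]
      nlinarith [sq_nonneg e]
    have b9 : S^2 ≤ 1 := by nlinarith [sq_nonneg Co]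
    have b10 : (0:ℝ) ≤ 2 / N := by positivity
    have b11 : s^2 * S^2 ≥ ((1/2 * (S^2 * c1))^2 - 2 / N) * S^2 := by
      exact mul_le_mul_of_nonneg_right b8 (sq_nonneg _)
    have b12 : (S^2)^3 ≥ 3/4 * S^2 - 1/4 := by
      nlinarith [mul_nonneg (sq_nonneg (S^2 - 1/2)) (show (0:ℝ) ≤ S^2 + 1 by positivity)]
    have b13 : (S^2)^3 * c1^2 ≥ (3/4 * S^2 - 1/4) * c1^2 := mul_le_mul_of_nonneg_right b12 (sq_nonneg _)
    have b14 : 2 / N * S^2 ≤ 2 / N := by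
      calc 2 / N * S^2 ≤ 2 / N * 1 := by gcongr
        _ = _ := by ring
    have b15 : ((1/2 * (S^2 * c1))^2 - 2 / N) * S^2 = 1/4 * ((S^2)^3 * c1^2) - 2 / N * S^2 := by ring
    linarith
  have hB : 1 + (r:ℝ) * (64 * s^2 - 1) ≤ (64 * s^2)^r := by
    have := one_add_mul_le_pow (a := 64 * s^2 - 1) (by nlinarith [sq_nonneg s]) r
    rwa [add_sub_cancel] at this
  have hP : zs N t ^ (2 * r) = (1/64:ℝ)^r * (64 * s^2)^r := by
    rw [← mul_pow, pow_mul]; congr 1; ring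
  rw [← hs] at hP
  rw [hP, mul_assoc ((1/64:ℝ)^r) ((64 * s^2)^r)]
  refine mul_le_mul_of_nonneg_left ?_ (pow_nonneg (by norm_num) r)
  have h2 : (1 + (r:ℝ) * (64 * s^2 - 1)) * S^2 ≤ (64 * s^2)^r * S^2 := mul_le_mul_of_nonneg_right hB (sq_nonneg _)
  refine le_trans ?_ h2
  have h3 : 64 * (r:ℝ) * (s ^ 2 * S ^ 2) ≥ 64 * (r:ℝ) * (1/4 * (3/4 * S^2 - 1/4) * c1^2 - 2 / N) :=
    mul_le_mul_of_nonneg_left hsw (by positivity)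
  have h4 : 64 * (r:ℝ) * (1/4 * (3/4 * S^2 - 1/4) * c1^2 - 2 / N) + (1 - r) * S^2 =
      1 / 2 + (r:ℝ) / 2 - 128 * r / N + r * (2 * c1 ^ 2 - 1) - (5 / 2 * r + 1 / 2) * (1 - 2 * S ^ 2) -
        3 / 2 * r * (2 * ((2 * c1 ^ 2 - 1) * (1 - 2 * S ^ 2))) := by ring
  have h5 : (1 + (r:ℝ) * (64 * s ^ 2 - 1)) * S ^ 2 = 64 * (r:ℝ) * (s ^ 2 * S ^ 2) + (1 - r) * S^2 := by ring
  rw [← h4, h5]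
  linarith

lemma zI_lower (r N : ℕ) (hN : 256 ≤ N) :
    (1/64:ℝ)^r * (N / 2) ≤ ∫ t in (0:ℝ)..N, zs N t ^ (2 * r) * Real.sin (2 * Real.pi * t / N) ^ 2 := by
  have hN' : (256:ℝ) ≤ N := by exact_mod_cast hN
  have h1 := intervalIntegral.integral_mono_on (μ := MeasureTheory.volume) (a := 0) (b := (N:ℝ)) (by positivity)
    (f := fun t => (1/64:ℝ)^r * ((1/2 + (r:ℝ)/2 - 128 * r / N) + r * Real.cos (2 * Real.pi * (2 * N : ℕ) / N * t)
      - (5/2 * r + 1/2) * Real.cos (2 * Real.pi * (2:ℕ) / N * t) - 3/2 * r * (Real.cos (2 * Real.pi * (2 * N + 2 : ℕ) / N * t)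
        + Real.cos (2 * Real.pi * (2 * N - 2 : ℕ) / N * t))))
    (g := fun t => zs N t ^ (2 * r) * Real.sin (2 * Real.pi * t / N) ^ 2)
    (Continuous.intervalIntegrable (by fun_prop) _ _)
    (Continuous.intervalIntegrable (((tame_zs.pow (2 * r)).mul (Tame.sN.pow 2)).contDiff N).continuous _ _)
    (fun t _ => zs_lower r N (by omega) t)
  refine le_trans ?_ h1
  rw [intervalIntegral.integral_const_mul]
  refine mul_le_mul_of_nonneg_left ?_ (pow_nonneg (by norm_num) r)
  have ci : ∀ (c : ℝ) (k : ℕ), IntervalIntegrable (fun t => c * Real.cos (2 * Real.pi * k / N * t)) MeasureTheory.volume 0 N :=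
    fun c k => Continuous.intervalIntegrable (by fun_prop) _ _
  have ci1 : ∀ (k : ℕ), IntervalIntegrable (fun t => Real.cos (2 * Real.pi * k / N * t)) MeasureTheory.volume 0 N :=
    fun k => Continuous.intervalIntegrable (by fun_prop) _ _
  have cc : IntervalIntegrable (fun t : ℝ => (1/2 + (r:ℝ)/2 - 128 * r / N)) MeasureTheory.volume 0 N :=
    Continuous.intervalIntegrable (by fun_prop) _ _
  rw [intervalIntegral.integral_sub ((cc.add (ci _ _)).sub (ci _ _)) (((ci1 _).add (ci1 _)).const_mul _),
    intervalIntegral.integral_sub (cc.add (ci _ _)) (ci _ _), intervalIntegral.integral_add cc (ci _ _),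
    intervalIntegral.integral_const_mul, intervalIntegral.integral_const_mul, intervalIntegral.integral_const_mul,
    intervalIntegral.integral_add (ci1 _) (ci1 _)]
  rw [integral_cos_zero N (by omega) _ (by omega), integral_cos_zero N (by omega) _ (by omega),
    integral_cos_zero N (by omega) _ (by omega), integral_cos_zero N (by omega) _ (by omega)]
  simp only [intervalIntegral.integral_const, smul_eq_mul]
  have : (N:ℝ) ≠ 0 := by positivity
  have e : (N - 0) * (1/2 + (r:ℝ)/2 - 128 * r / N) = N / 2 + r * (N / 2 - 128) := by field_simp; ring
  rw [e]
  have : 0 ≤ (r:ℝ) * ((N:ℝ) / 2 - 128) := mul_nonneg (by positivity) (by linarith)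
  linarith

lemma zx_side (N : ℕ) (hN : 1 ≤ N) (t : ℝ) (j : ℤ) : (j:ℝ) ≤ 2 * zx N t ↔ (j:ℝ) ≤ 2 * (t / N) := by
  have key : |2 * zx N t - 2 * (t / N)| ≤ 1/2 * |2 * (t / N) - j| := by
    have e : 2 * zx N t - 2 * (t / N) = 1 / (2 * Real.pi) * (Real.sin (2 * Real.pi * t / N) ^ 2 * Real.sin (2 * Real.pi * t)) := by
      rw [zx]; have := Real.pi_ne_zero; field_simp; ring
    have e2 : |Real.sin (2 * Real.pi * t / N)| ≤ Real.pi * |2 * (t / N) - j| := by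
      have h1 : 2 * Real.pi * t / N = Real.pi * (2 * (t / N) - j) + j * Real.pi := by ring
      rw [h1]
      have h2 : |Real.sin (Real.pi * (2 * (t / N) - j) + j * Real.pi)| = |Real.sin (Real.pi * (2 * (t / N) - j))| := by
        rw [Real.sin_add_int_mul_pi, abs_mul]
        simp
      rw [h2]
      refine (Real.abs_sin_le_abs).trans ?_
      rw [abs_mul, abs_of_pos Real.pi_pos]
    have e3 : |Real.sin (2 * Real.pi * t / N)| ≤ 1 := Real.abs_sin_le_one _
    have e4 : |Real.sin (2 * Real.pi * t)| ≤ 1 := Real.abs_sin_le_one _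
    rw [e, abs_mul, abs_mul, abs_pow, abs_of_pos (show 0 < 1 / (2 * Real.pi) by positivity)]
    calc 1 / (2 * Real.pi) * (|Real.sin (2 * Real.pi * t / N)| ^ 2 * |Real.sin (2 * Real.pi * t)|)
        ≤ 1 / (2 * Real.pi) * ((1 * (Real.pi * |2 * (t / N) - j|)) * 1) := by
          gcongr
          rw [sq]
          gcongr
      _ = _ := by have := Real.pi_ne_zero; field_simp
  have k := abs_le.1 key
  constructor
  · intro h
    by_contra h'
    push Not at h'
    rw [abs_of_neg (by linarith)] at k
    linarith
  · intro h
    rw [abs_of_nonneg (by linarith)] at k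
    linarith

end Zig

section Zig2

lemma zx_period (N : ℕ) (hN : 1 ≤ N) (t : ℝ) : zx N (t + N) = zx N t + 1 := by
  have h1 := (((Tame.sN.pow 2).mul Tame.s1).periodic N hN) t
  have hN' : (N:ℝ) ≠ 0 := by positivity
  rw [zx, h1, zx, add_div, div_self hN']; ring

lemma period_int {f : ℝ → ℝ} {P c : ℝ} (hf : ∀ t, f (t + P) = f t + c) (k : ℤ) (t : ℝ) :
    f (t + k * P) = f t + k * c := by
  have hn : ∀ (k : ℕ) (t : ℝ), f (t + k * P) = f t + k * c := by
    intro k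
    induction k with
    | zero => intro t; simp
    | succ k ih =>
      intro t
      have : t + ((k + 1 : ℕ) : ℝ) * P = (t + k * P) + P := by push_cast; ring
      rw [this, hf, ih]; push_cast; ring
  obtain ⟨k, rfl | rfl⟩ := k.eq_nat_or_neg
  · exact_mod_cast hn k t
  · have := hn k (t + ((-(k:ℤ) : ℤ) : ℝ) * P)
    push_cast at this ⊢
    rw [show t + -(k:ℝ) * P + k * P = t by ring] at this
    linarith

lemma zx_near (N : ℕ) (t : ℝ) : |zx N t - t / N| ≤ 1 := by
  have e : zx N t - t / N = 1 / (4 * Real.pi) * (Real.sin (2 * Real.pi * t / N) ^ 2 * Real.sin (2 * Real.pi * t)) := by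
    rw [zx]; ring
  have e3 : |Real.sin (2 * Real.pi * t / N)| ≤ 1 := Real.abs_sin_le_one _
  have e4 : |Real.sin (2 * Real.pi * t)| ≤ 1 := Real.abs_sin_le_one _
  have e5 : 1 / (4 * Real.pi) ≤ 1 := by
    rw [div_le_one (by positivity)]; linarith [Real.pi_gt_three]
  rw [e, abs_mul, abs_mul, abs_pow, abs_of_pos (show 0 < 1 / (4 * Real.pi) by positivity)]
  exact mul_le_one₀ e5 (by positivity) (mul_le_one₀ (pow_le_one₀ (abs_nonneg _) e3) (abs_nonneg _) e4)

/-- `∫ s^{2r} S²`. -/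
def zB (r N : ℕ) (t : ℝ) : ℝ := ∫ u in (0:ℝ)..t, zs N u ^ (2 * r) * Real.sin (2 * Real.pi * u / N) ^ 2
/-- `∫ s^{2r} S`. -/
def zG (r N : ℕ) (t : ℝ) : ℝ := ∫ u in (0:ℝ)..t, zs N u ^ (2 * r) * Real.sin (2 * Real.pi * u / N)

lemma tame_h (r : ℕ) : Tame (fun N u => zs N u ^ (2 * r) * Real.sin (2 * Real.pi * u / N) ^ 2) :=
  (tame_zs.pow _).mul (Tame.sN.pow 2)
lemma tame_h' (r : ℕ) : Tame (fun N u => zs N u ^ (2 * r) * Real.sin (2 * Real.pi * u / N)) :=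
  (tame_zs.pow _).mul Tame.sN

lemma zB_hasDeriv (r N : ℕ) (t : ℝ) :
    HasDerivAt (zB r N) (zs N t ^ (2 * r) * Real.sin (2 * Real.pi * t / N) ^ 2) t :=
  prim_hasDeriv ((tame_h r).contDiff N).continuous t

lemma zG_hasDeriv (r N : ℕ) (t : ℝ) :
    HasDerivAt (zG r N) (zs N t ^ (2 * r) * Real.sin (2 * Real.pi * t / N)) t :=
  prim_hasDeriv ((tame_h' r).contDiff N).continuous t

lemma zB_zero (r N : ℕ) : zB r N 0 = 0 := by simp [zB]

lemma zB_mono (r N : ℕ) : Monotone (zB r N) := by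
  refine monotone_of_deriv_nonneg (fun t => (zB_hasDeriv r N t).differentiableAt) fun t => ?_
  rw [(zB_hasDeriv r N t).deriv]
  rw [pow_mul]; positivity

lemma zB_period (r N : ℕ) (hN : 1 ≤ N) (t : ℝ) : zB r N (t + N) = zB r N t + zB r N N :=
  prim_periodic ((tame_h r).contDiff N).continuous ((tame_h r).periodic N hN) t

lemma zG_N (r N : ℕ) (hN : 1 ≤ N) : zG r N N = 0 := by
  have hper := (tame_h' r).periodic N hN
  set f : ℝ → ℝ := (fun u => zs N u ^ (2 * r) * Real.sin (2 * Real.pi * u / N)) with hf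
  have h1 : ∀ t, f ((N:ℝ) - t) = - f t := by
    intro t
    have h2 : f (-t + N) = f (-t) := hper (-t)
    rw [show (N:ℝ) - t = -t + N by ring, h2]
    simp only [hf, zs_even, mul_neg, neg_div, Real.sin_neg]
  have h3 := intervalIntegral.integral_comp_sub_left (a := 0) (b := (N:ℝ)) f (N:ℝ)
  simp only [h1, intervalIntegral.integral_neg, sub_self, sub_zero] at h3
  have : zG r N N = ∫ u in (0:ℝ)..N, f u := rfl
  linarith

lemma zG_period (r N : ℕ) (hN : 1 ≤ N) (t : ℝ) : zG r N (t + N) = zG r N t := by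
  have := prim_periodic ((tame_h' r).contDiff N).continuous ((tame_h' r).periodic N hN) t
  have h2 := zG_N r N hN
  unfold zG at h2 ⊢
  rw [this, h2, add_zero]

lemma zB_N (r N : ℕ) (hN : 256 ≤ N) : (1/64:ℝ)^r * (N / 2) ≤ zB r N N := zI_lower r N hN

lemma zh_dense (r N : ℕ) (hN : 256 ≤ N) :
    Dense {t : ℝ | zs N t ^ (2 * r) * Real.sin (2 * Real.pi * t / N) ^ 2 ≠ 0} := by
  rw [dense_iff_inter_open]
  intro U hU ⟨x, hx⟩
  by_contra hne
  have h0 : ∀ᶠ t in 𝓝 x, zs N t ^ (2 * r) * Real.sin (2 * Real.pi * t / N) ^ 2 = 0 := by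
    filter_upwards [hU.mem_nhds hx] with t ht
    by_contra h
    exact hne ⟨t, ht, h⟩
  have h1 := ((tame_h r).analytic N).eqOn_zero_of_preconnected_of_eventuallyEq_zero
    isPreconnected_univ (Set.mem_univ x) h0
  have h2 : zB r N N = 0 := by
    have : ∀ u, zs N u ^ (2 * r) * Real.sin (2 * Real.pi * u / N) ^ 2 = 0 := fun u => h1 (Set.mem_univ u)
    simp only [zB, this, intervalIntegral.integral_zero]
  have h3 := zB_N r N hN
  have : (0:ℝ) < N := by exact_mod_cast (by omega : 0 < N)
  have : 0 < (1/64:ℝ)^r * (N / 2) := by positivity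
  linarith

lemma zB_strict (r N : ℕ) (hN : 256 ≤ N) : StrictMono (zB r N) := by
  refine (zB_mono r N).strictMono_of_injective ?_
  have key : ∀ x y, x < y → zB r N x ≠ zB r N y := by
    intro x y hxy he
    obtain ⟨t, ht, h⟩ := (zh_dense r N hN).inter_open_nonempty (Set.Ioo x y) isOpen_Ioo (Set.nonempty_Ioo.2 hxy)
    have hc : zB r N =ᶠ[𝓝 t] fun _ => zB r N x := by
      filter_upwards [isOpen_Ioo.mem_nhds ht] with u hu
      refine le_antisymm ?_ (zB_mono r N hu.1.le)
      rw [he]; exact zB_mono r N hu.2.le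
    have h2 := hc.deriv_eq
    rw [(zB_hasDeriv r N t).deriv, deriv_const] at h2
    exact h h2
  intro x y he
  rcases lt_trichotomy x y with h | h | h
  · exact absurd he (key x y h)
  · exact h
  · exact absurd he.symm (key y x h)

lemma z_fiber (r N : ℕ) (hN : 1 ≤ N) (t t' : ℝ) (htt : t ≤ t') (h : zx N t = zx N t') :
    zB r N t' - zB r N t ≤ |zG r N t' - zG r N t| := by
  have hN' : (0:ℝ) < N := by exact_mod_cast hN
  set j := ⌊2 * zx N t⌋ with hj
  have a1 : (j:ℝ) ≤ 2 * (t / N) := (zx_side N hN t j).1 (Int.floor_le _)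
  have a2 : 2 * (t' / N) < j + 1 := by
    have := mt (zx_side N hN t' (j+1)).2 (by rw [← h]; push_cast; exact not_le.2 (Int.lt_floor_add_one _))
    push_cast at this
    exact not_le.1 this
  obtain ⟨ε, hε, hεS⟩ : ∃ ε : ℝ, |ε| = 1 ∧ ∀ u ∈ Set.Icc t t', 0 ≤ ε * Real.sin (2 * Real.pi * u / N) := by
    refine ⟨(-1) ^ j, by simp, fun u hu => ?_⟩
    have e1 : 2 * Real.pi * u / N = (Real.pi * (2 * (u / N) - j)) + j * Real.pi := by ring
    rw [e1, Real.sin_add_int_mul_pi, ← mul_assoc, ← mul_zpow]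
    have : ((-1 : ℝ) * -1) ^ j = 1 := by norm_num
    rw [this, one_mul]
    have b1 : t / N ≤ u / N := by gcongr; exact hu.1
    have b2 : u / N ≤ t' / N := by gcongr; exact hu.2
    refine Real.sin_nonneg_of_nonneg_of_le_pi ?_ ?_
    · exact mul_nonneg Real.pi_pos.le (by linarith)
    · calc _ ≤ Real.pi * 1 := by gcongr; linarith
        _ = _ := mul_one _
  have hm : MonotoneOn (fun u => ε * zG r N u - zB r N u) (Set.Icc t t') := by
    have hd : ∀ u, HasDerivAt (fun u => ε * zG r N u - zB r N u)
      (ε * (zs N u ^ (2 * r) * Real.sin (2 * Real.pi * u / N)) - zs N u ^ (2 * r) * Real.sin (2 * Real.pi * u / N) ^ 2) u :=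
      fun u => ((zG_hasDeriv r N u).const_mul ε).sub (zB_hasDeriv r N u)
    refine monotoneOn_of_deriv_nonneg (convex_Icc _ _) (fun u _ => (hd u).continuousAt.continuousWithinAt)
      (fun u _ => (hd u).differentiableAt.differentiableWithinAt) fun u hu => ?_
    rw [(hd u).deriv]
    rw [interior_Icc] at hu
    have b := hεS u (Set.Ioo_subset_Icc_self hu)
    set S := Real.sin (2 * Real.pi * u / N)
    have b1 : |S| ≤ 1 := Real.abs_sin_le_one _
    have b2 : ε * S = |S| := by rw [← abs_of_nonneg b, abs_mul, hε, one_mul]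
    have b3 : S^2 ≤ |S| := by rw [← sq_abs, sq]; exact mul_le_of_le_one_left (abs_nonneg _) b1
    have b4 : 0 ≤ zs N u ^ (2 * r) := by rw [pow_mul]; positivity
    have : ε * (zs N u ^ (2 * r) * S) - zs N u ^ (2 * r) * S ^ 2 = zs N u ^ (2 * r) * (|S| - S^2) := by
      rw [← b2]; ring
    rw [this]
    exact mul_nonneg b4 (by linarith)
  have h1 := hm (Set.left_mem_Icc.2 htt) (Set.right_mem_Icc.2 htt) htt
  simp only at h1
  calc zB r N t' - zB r N t ≤ ε * (zG r N t' - zG r N t) := by linarith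
    _ ≤ |ε * (zG r N t' - zG r N t)| := le_abs_self _
    _ = _ := by rw [abs_mul, hε, one_mul]

lemma z_fiber' (r N : ℕ) (hN : 1 ≤ N) (t t' : ℝ) (h : zx N t = zx N t') :
    |zB r N t - zB r N t'| ≤ |zG r N t - zG r N t'| := by
  rcases le_total t t' with htt | htt
  · have := z_fiber r N hN t t' htt h
    rw [abs_sub_comm (zG r N t), abs_sub_comm (zB r N t),
      abs_of_nonneg (a := zB r N t' - zB r N t) (by linarith [zB_mono r N htt])]
    exact this
  · have := z_fiber r N hN t' t htt h.symm
    rw [abs_of_nonneg (a := zB r N t - zB r N t') (by linarith [zB_mono r N htt])]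
    exact this

lemma zG_bound (r : ℕ) : ∃ C : ℝ, 0 ≤ C ∧ ∀ N : ℕ, 1 ≤ N → ∀ t, |zG r N t| ≤ C * N := by
  obtain ⟨C, hC, hb⟩ := (tame_h' r).bounded
  refine ⟨C, hC, fun N hN t => ?_⟩
  have hN' : (0:ℝ) < N := by exact_mod_cast hN
  have key : ∀ t ∈ Set.Icc (0:ℝ) N, |zG r N t| ≤ C * N := by
    intro t ht
    have := intervalIntegral.norm_integral_le_of_norm_le_const (a := 0) (b := t) (C := C)
      (f := fun u => zs N u ^ (2 * r) * Real.sin (2 * Real.pi * u / N)) (fun u _ => hb N u)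
    rw [Real.norm_eq_abs, sub_zero, abs_of_nonneg ht.1] at this
    exact this.trans (by gcongr; exact ht.2)
  have hp := period_int (f := zG r N) (P := N) (c := 0) (by simpa using zG_period r N hN) (-⌊t / N⌋) t
  rw [mul_zero, add_zero] at hp
  rw [← hp]
  refine key _ ⟨?_, ?_⟩
  · have := (le_div_iff₀ hN').1 (Int.floor_le (t / N)); push_cast; linarith
  · have := (div_lt_iff₀ hN').1 (Int.lt_floor_add_one (t / N)); push_cast; linarith

lemma zigzag (r : ℕ) (hr : 1 ≤ r) (C a δ : ℝ) (hC : 0 ≤ C) (ha : 0 < a) (hδ : 0 < δ) :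
    ∃ (ξ dξ : ℝ → ℝ) (b g : ℕ → ℝ → ℝ),
      ContDiff ℝ ∞ ξ ∧ (∀ k, ContDiff ℝ ∞ (b k)) ∧ (∀ k, ContDiff ℝ ∞ (g k)) ∧
      (∀ t, HasDerivAt ξ (dξ t) t) ∧
      (∀ k < r, ∀ t, HasDerivAt (b k) (b (k + 1) t * dξ t) t) ∧
      (∀ k < r, ∀ t, HasDerivAt (g k) (g (k + 1) t * dξ t) t) ∧
      (∀ (m : ℤ) t, ξ (t + m) = ξ t + m) ∧ (∀ (m : ℤ) t, b 0 (t + m) = b 0 t + m) ∧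
      (∀ k, ∀ (m : ℤ) t, b (k + 1) (t + m) = b (k + 1) t) ∧
      (∀ k, ∀ (m : ℤ) t, g k (t + m) = g k t) ∧
      (∀ t, |b 0 t - ξ t| ≤ a) ∧ (∀ k < r, ∀ t, |b (k + 1) t| ≤ δ) ∧ (∀ k ≤ r, ∀ t, |g k t| ≤ δ) ∧
      Dense {t | dξ t ≠ 0} ∧
      (∀ t t', ξ t = ξ t' → |g 0 t - g 0 t'| ≤ C * |b 0 t - b 0 t'| → t = t') := by
  obtain ⟨β, hβ, hβ0, hβd⟩ := tame_zs.tower (r - 1) (Tame.sN.pow 2)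
  obtain ⟨γ, hγ, hγ0, hγd⟩ := tame_zs.tower (r - 1) Tame.sN
  obtain ⟨C', hC', hG⟩ := zG_bound r
  choose Cβ hCβ hCβ' using fun k => (hβ k).bounded
  choose Cγ hCγ hCγ' using fun k => (hγ k).bounded
  set K := C + 1 with hK
  have hKpos : 0 < K := by linarith
  set D := ∑ k ∈ Finset.range r, (Cβ k + Cγ k) with hD
  have hDβ : ∀ k < r, Cβ k ≤ D ∧ Cγ k ≤ D := by
    intro k hk
    have : Cβ k + Cγ k ≤ D := Finset.single_le_sum (f := fun k => Cβ k + Cγ k)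
      (fun i _ => add_nonneg (hCβ i) (hCγ i)) (Finset.mem_range.2 hk)
    exact ⟨by linarith [hCγ k], by linarith [hCβ k]⟩
  have hDn : 0 ≤ D := Finset.sum_nonneg fun i _ => add_nonneg (hCβ i) (hCγ i)
  set κ : ℝ := (1/64:ℝ)^r / 2 with hκ
  have hκpos : 0 < κ := by positivity
  obtain ⟨M0, hM0⟩ := exists_nat_ge (max (2 / a) (K * C' / (κ * δ)))
  set M := M0 + 1 with hM
  have hM1 : (1:ℝ) ≤ M := by rw [hM]; push_cast; linarith [(Nat.cast_nonneg M0 : (0:ℝ) ≤ M0)]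
  have hMa : 2 / a ≤ M := by rw [hM]; push_cast; linarith [le_max_left (2 / a) (K * C' / (κ * δ))]
  have hMg : K * C' / (κ * δ) ≤ M := by rw [hM]; push_cast; linarith [le_max_right (2 / a) (K * C' / (κ * δ))]
  obtain ⟨N0, hN0⟩ := exists_nat_ge ((1 + K) * M ^ r * D / (κ * δ))
  set N := N0 + 256 with hN
  have hN256 : 256 ≤ N := by omega
  have hN1 : 1 ≤ N := by omega
  have hNR : (0:ℝ) < N := by exact_mod_cast hN1
  have hNb : (1 + K) * M ^ r * D / (κ * δ) ≤ N := by rw [hN]; push_cast; linarith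
  set I := zB r N N with hI
  have hIl : κ * N ≤ I := by
    have := zB_N r N hN256
    have e : κ * N = (1/64:ℝ)^r * (N / 2) := by rw [hκ]; ring
    rw [e]; exact this
  have hIpos : 0 < I := lt_of_lt_of_le (by positivity) hIl
  have hMpos : (0:ℝ) < M := by linarith
  set Λ : ℝ := M * N with hΛ
  have hΛpos : 0 < Λ := by positivity
  have hlin : ∀ t : ℝ, HasDerivAt (fun t => Λ * t) Λ t := fun t => by
    simpa using (hasDerivAt_id t).const_mul Λ
  have hcomp : ∀ (f : ℝ → ℝ) (f' t : ℝ), HasDerivAt f f' (Λ * t) → HasDerivAt (fun t => f (Λ * t)) (f' * Λ) t :=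
    fun f f' t hf => hf.comp t (hlin t)
  have hlinC : ContDiff ℝ ∞ (fun t : ℝ => Λ * t) := by fun_prop
  have hzxC : ContDiff ℝ ∞ (zx N) := contDiff_of_hasDeriv (tame_zs.contDiff N) (zx_hasDeriv N)
  have hzBC : ContDiff ℝ ∞ (zB r N) := contDiff_of_hasDeriv ((tame_h r).contDiff N) (zB_hasDeriv r N)
  have hzGC : ContDiff ℝ ∞ (zG r N) := contDiff_of_hasDeriv ((tame_h' r).contDiff N) (zG_hasDeriv r N)
  have hshift : ∀ (m : ℤ) (t : ℝ), Λ * (t + m) = Λ * t + ((M * m : ℤ) : ℝ) * N := by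
    intro m t; rw [hΛ]; push_cast; ring
  have hpow : 2 * (r - 1) + 1 + 1 = 2 * r := by omega
  have hMk : ∀ k < r, (M:ℝ) ^ k ≤ M ^ r := fun k hk => pow_le_pow_right₀ hM1 hk.le
  refine ⟨fun t => zx N (Λ * t) / M, fun t => N * zs N (Λ * t),
    fun k => Nat.casesOn k (fun t => zB r N (Λ * t) / (I * M)) (fun k t => M ^ k * β k N (Λ * t) / I),
    fun k => Nat.casesOn k (fun t => K * zG r N (Λ * t) / (I * M)) (fun k t => K * (M ^ k * γ k N (Λ * t)) / I),
    ?_, ?_, ?_, ?_, ?_, ?_, ?_, ?_, ?_, ?_, ?_, ?_, ?_, ?_, ?_⟩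
  · exact (hzxC.comp hlinC).div_const _
  · rintro (_ | k)
    · exact (hzBC.comp hlinC).div_const _
    · exact (contDiff_const.mul (((hβ k).contDiff N).comp hlinC)).div_const _
  · rintro (_ | k)
    · exact (contDiff_const.mul (hzGC.comp hlinC)).div_const _
    · exact (contDiff_const.mul (contDiff_const.mul (((hγ k).contDiff N).comp hlinC))).div_const _
  · intro t
    have := (hcomp _ _ t (zx_hasDeriv N (Λ * t))).div_const (M:ℝ)
    refine this.congr_deriv ?_
    rw [hΛ]; field_simp
  · rintro (_ | k) hk t
    · have := (hcomp _ _ t (zB_hasDeriv r N (Λ * t))).div_const (I * M)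
      refine this.congr_deriv ?_
      simp only [hβ0, pow_zero, one_mul]
      rw [← hpow, pow_succ, hΛ]; field_simp
    · have := ((hcomp _ _ t (hβd k (by omega) N (Λ * t))).const_mul ((M:ℝ) ^ k)).div_const I
      refine this.congr_deriv ?_
      simp only [pow_succ]
      rw [hΛ]; field_simp
  · rintro (_ | k) hk t
    · have := ((hcomp _ _ t (zG_hasDeriv r N (Λ * t))).const_mul K).div_const (I * M)
      refine this.congr_deriv ?_
      simp only [hγ0, pow_zero, one_mul]
      rw [← hpow, pow_succ, hΛ]; field_simp
    · have := (((hcomp _ _ t (hγd k (by omega) N (Λ * t))).const_mul ((M:ℝ) ^ k)).const_mul K).div_const I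
      refine this.congr_deriv ?_
      simp only [pow_succ]
      rw [hΛ]; field_simp
  · intro m t
    try simp only [Nat.rec_zero, Nat.rec_add_one]
    rw [hshift, period_int (zx_period N hN1)]
    push_cast; field_simp
  · intro m t
    try simp only [Nat.rec_zero, Nat.rec_add_one]
    rw [hshift, period_int (zB_period r N hN1)]
    push_cast; rw [← hI]; field_simp
  · intro k m t
    try simp only [Nat.rec_zero, Nat.rec_add_one]
    rw [hshift, period_int (f := β k N) (P := N) (c := 0) (by simpa using (hβ k).periodic N hN1)]
    simp
  · rintro (_ | k) m t
    · try simp only [Nat.rec_zero, Nat.rec_add_one]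
      rw [hshift, period_int (f := zG r N) (P := N) (c := 0) (by simpa using zG_period r N hN1)]
      simp
    · try simp only [Nat.rec_zero, Nat.rec_add_one]
      rw [hshift, period_int (f := γ k N) (P := N) (c := 0) (by simpa using (hγ k).periodic N hN1)]
      simp
  · intro t
    try simp only [Nat.rec_zero, Nat.rec_add_one]
    have h1 := zx_near N (Λ * t)
    have h2 := quasi_linear (f := fun t => zB r N t / I) (fun x y h => by
      simp only; gcongr; exact zB_mono r N h) (by simp [zB_zero]) hNR (fun t => by
        rw [zB_period r N hN1, ← hI]; field_simp) (Λ * t)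
    have e : zB r N (Λ * t) / (I * M) - zx N (Λ * t) / M =
        ((zB r N (Λ * t) / I - Λ * t / N) - (zx N (Λ * t) - Λ * t / N)) / M := by
      field_simp; ring
    rw [e, abs_div, abs_of_pos hMpos, div_le_iff₀ hMpos]
    have h3 := (abs_sub (zB r N (Λ * t) / I - Λ * t / N) (zx N (Λ * t) - Λ * t / N))
    have h4 : 2 ≤ M * a := (div_le_iff₀ ha).1 hMa
    linarith
  · intro k hk t
    try simp only [Nat.rec_zero, Nat.rec_add_one]
    rw [abs_div, abs_mul, abs_of_pos hIpos, abs_of_nonneg (by positivity : (0:ℝ) ≤ (M:ℝ) ^ k), div_le_iff₀ hIpos]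
    have h1 : (1 + K) * M ^ r * D ≤ N * (κ * δ) := (div_le_iff₀ (by positivity)).1 hNb
    calc (M:ℝ) ^ k * |β k N (Λ * t)| ≤ M ^ r * D := by
          exact mul_le_mul (hMk k hk) ((hCβ' k N _).trans (hDβ k hk).1) (abs_nonneg _) (by positivity)
      _ ≤ (1 + K) * M ^ r * D := by
          rw [mul_assoc]
          exact le_mul_of_one_le_left (by positivity) (by linarith)
      _ ≤ δ * (κ * N) := by linarith
      _ ≤ δ * I := by gcongr
  · rintro (_ | k) hk t
    · try simp only [Nat.rec_zero, Nat.rec_add_one]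
      rw [abs_div, abs_mul, abs_of_pos hKpos, abs_of_pos (by positivity : 0 < I * M), div_le_iff₀ (by positivity)]
      have h1 : K * C' ≤ M * (κ * δ) := (div_le_iff₀ (by positivity)).1 hMg
      calc K * |zG r N (Λ * t)| ≤ K * (C' * N) := by
            gcongr
            exact hG N hN1 _
        _ = (K * C') * N := by ring
        _ ≤ (M * (κ * δ)) * N := by gcongr
        _ = δ * ((κ * N) * M) := by ring
        _ ≤ δ * (I * M) := by gcongr
    · try simp only [Nat.rec_zero, Nat.rec_add_one]
      rw [abs_div, abs_mul, abs_mul, abs_of_pos hKpos, abs_of_pos hIpos, abs_of_nonneg (by positivity : (0:ℝ) ≤ (M:ℝ) ^ k), div_le_iff₀ hIpos]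
      have h1 : (1 + K) * M ^ r * D ≤ N * (κ * δ) := (div_le_iff₀ (by positivity)).1 hNb
      calc K * ((M:ℝ) ^ k * |γ k N (Λ * t)|) ≤ K * (M ^ r * D) := by
            exact mul_le_mul_of_nonneg_left (mul_le_mul (hMk k hk) ((hCγ' k N _).trans (hDβ k hk).2)
              (abs_nonneg _) (by positivity)) hKpos.le
        _ ≤ (1 + K) * (M ^ r * D) := by gcongr; linarith
        _ = (1 + K) * M ^ r * D := by ring
        _ ≤ δ * (κ * N) := by linarith
        _ ≤ δ * I := by gcongr
  · have hd := zh_dense r N hN256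
    have hs : {t : ℝ | zs N t ^ (2 * r) * Real.sin (2 * Real.pi * t / N) ^ 2 ≠ 0} ⊆ {t | zs N t ≠ 0} := by
      intro t ht h
      exact ht (by simp only [Set.mem_ofPred_eq] at *; rw [h, zero_pow (by omega), zero_mul])
    have hd2 := hd.mono hs
    have hopen : IsOpenMap (fun t : ℝ => Λ * t) := (Homeomorph.mulLeft₀ Λ hΛpos.ne').isOpenMap
    refine (hd2.preimage hopen).mono ?_
    intro t ht
    exact mul_ne_zero hNR.ne' ht
  · intro t t' h1 h2
    simp only [Nat.rec_zero] at h1 h2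
    have h1' : zx N (Λ * t) = zx N (Λ * t') := by
      field_simp at h1; exact h1
    have h3 := z_fiber' r N hN1 _ _ h1'
    have e1 : K * zG r N (Λ * t) / (I * M) - K * zG r N (Λ * t') / (I * M) =
        (K / (I * M)) * (zG r N (Λ * t) - zG r N (Λ * t')) := by ring
    have e2 : zB r N (Λ * t) / (I * M) - zB r N (Λ * t') / (I * M) =
        (1 / (I * M)) * (zB r N (Λ * t) - zB r N (Λ * t')) := by ring
    rw [e1, e2, abs_mul, abs_mul, abs_of_pos (by positivity : 0 < K / (I * M)),
      abs_of_pos (by positivity : 0 < 1 / (I * M))] at h2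
    set p := |zB r N (Λ * t) - zB r N (Λ * t')|
    set q := |zG r N (Λ * t) - zG r N (Λ * t')|
    have h4 : K * q ≤ C * p := by
      have hIM : 0 < I * M := by positivity
      have := mul_le_mul_of_nonneg_left h2 hIM.le
      have e3 : I * M * (K / (I * M) * q) = K * q := by field_simp
      have e4 : I * M * (C * (1 / (I * M) * p)) = C * p := by field_simp
      rwa [e3, e4] at this
    have h5 : p = 0 := by
      have : 0 ≤ p := abs_nonneg _
      have h7 : K * p ≤ K * q := mul_le_mul_of_nonneg_left h3 hKpos.le
      have h8 : K * p = C * p + p := by rw [hK]; ring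
      linarith
    have h6 := (zB_strict r N hN256).injective (sub_eq_zero.1 (abs_eq_zero.1 h5))
    exact mul_left_cancel₀ hΛpos.ne' h6

end Zig2

section Stair

lemma staircase : ∃ A : ℝ → ℝ, ContDiff ℝ ∞ A ∧ (∀ s, A (s + 2) = A s + 2) ∧ (∀ s, |A s - s| ≤ 2) ∧
    ∀ s0, -Real.cos (Real.pi * s0) < 0.9 → ∀ᶠ s in 𝓝 s0, A s = A s0 := by
  set ρ : ℝ → ℝ := fun s => expNegInvGlue (-Real.cos (Real.pi * s) - 0.9) with hρ
  have hρC : ContDiff ℝ ∞ ρ := expNegInvGlue.contDiff.comp (by fun_prop)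
  have hρ0 : ∀ s, 0 ≤ ρ s := fun s => expNegInvGlue.nonneg _
  have hρp : Function.Periodic ρ 2 := by
    intro s
    simp only [hρ]
    rw [show Real.pi * (s + 2) = Real.pi * s + 2 * Real.pi by ring, Real.cos_add_two_pi]
  set I := ∫ u in (0:ℝ)..2, ρ u with hI
  have hIpos : 0 < I := by
    refine intervalIntegral.integral_pos (by norm_num) hρC.continuous.continuousOn (fun x _ => hρ0 x)
      ⟨1, by norm_num, ?_⟩
    refine expNegInvGlue.pos_of_pos ?_
    rw [mul_one, Real.cos_pi]; norm_num
  have hd : ∀ s, HasDerivAt (fun s => 2 / I * ∫ u in (0:ℝ)..s, ρ u) (2 / I * ρ s) s := fun s =>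
    (prim_hasDeriv hρC.continuous s).const_mul _
  refine ⟨fun s => 2 / I * ∫ u in (0:ℝ)..s, ρ u, contDiff_of_hasDeriv (contDiff_const.mul hρC) hd, ?_, ?_, ?_⟩
  · intro s
    simp only
    rw [prim_periodic hρC.continuous hρp s, ← hI]; field_simp
  · intro s
    have hm : Monotone (fun s => (∫ u in (0:ℝ)..s, ρ u) / I) := by
      refine monotone_of_deriv_nonneg (fun t => ((prim_hasDeriv hρC.continuous t).div_const I).differentiableAt) fun t => ?_
      rw [((prim_hasDeriv hρC.continuous t).div_const I).deriv]
      have := hρ0 t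
      positivity
    have := quasi_linear hm (by simp) (P := 2) (by norm_num) (fun t => by
      rw [prim_periodic hρC.continuous hρp t, ← hI]; field_simp) s
    have e : (2 / I * ∫ u in (0:ℝ)..s, ρ u) - s = 2 * ((∫ u in (0:ℝ)..s, ρ u) / I - s / 2) := by
      field_simp
    simp only
    rw [e, abs_mul, abs_two]
    linarith
  · intro s0 hs0
    have hc : ContinuousAt (fun s => -Real.cos (Real.pi * s)) s0 := by fun_prop
    have hev : ∀ᶠ s in 𝓝 s0, -Real.cos (Real.pi * s) < 0.9 := hc.eventually (gt_mem_nhds hs0)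
    obtain ⟨ε, hε, hball⟩ := Metric.eventually_nhds_iff_ball.1 hev
    filter_upwards [Metric.ball_mem_nhds s0 hε] with s hs
    refine Metric.isOpen_ball.is_const_of_deriv_eq_zero (convex_ball s0 ε).isPreconnected
      (fun t _ => (hd t).differentiableAt.differentiableWithinAt) (fun t ht => ?_) hs (Metric.mem_ball_self hε)
    rw [(hd t).deriv]
    have : ρ t = 0 := expNegInvGlue.zero_of_nonpos (by have := hball t ht; linarith)
    simp [this]

end Stair

section Good

variable {n ℓ r : ℕ} {Q : Type} [NormedAddCommGroup Q] [NormedSpace ℝ Q]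

/-- The jet of `G (·, q)` at `x` lies in `R`. -/
def Good (R : Set (Vec n × ((i : Fin (r + 1)) → SymMap n ℓ i.1))) (G : Vec n × Q → Vec ℓ)
    (z : Vec n × Q) : Prop := (z.1, fun i : Fin (r + 1) => PJ G i.1 z) ∈ R

lemma isOpen_good {R : Set (Vec n × ((i : Fin (r + 1)) → SymMap n ℓ i.1))} (hR : IsOpen R)
    {G : Vec n × Q → Vec ℓ} (hG : ContDiff ℝ ∞ G) : IsOpen {z | Good R G z} := by
  refine hR.preimage (f := fun z : Vec n × Q => (z.1, fun i : Fin (r + 1) => PJ G i.1 z)) ?_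
  exact continuous_fst.prodMk (continuous_pi fun i => (contDiff_PJ hG i.1).continuous)

lemma PJ_shift {G : Vec n × Q → Vec ℓ} {q q' : Q} {a : Vec n} (h : ∀ y, G (y + a, q') = G (y, q))
    (i : ℕ) (x : Vec n) : PJ G i (x + a, q') = PJ G i (x, q) := by
  simp only [PJ]
  have : (fun x => G (x, q)) = fun y => (fun x => G (x, q')) (y + a) := by
    funext y; exact (h y).symm
  rw [this]
  exact (iteratedFDeriv_comp_add_right (f := fun x => G (x, q')) i a x).symm

lemma Good.shift {R : Set (Vec n × ((i : Fin (r + 1)) → SymMap n ℓ i.1))}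
    (hRinv : ∀ (x : Vec n) (z : (i : Fin (r + 1)) → SymMap n ℓ i.1) (m : Fin n → ℤ),
      (x, z) ∈ R → (x + zcast m, z) ∈ R) {G : Vec n × Q → Vec ℓ} {q q' : Q} {m : Fin n → ℤ}
    (h : ∀ y, G (y + zcast m, q') = G (y, q)) {x : Vec n} (hx : Good R G (x, q)) :
    Good R G (x + zcast m, q') := by
  have := hRinv _ _ m hx
  simp only [Good]
  simpa only [PJ_shift h] using this

/-- Goodness only depends on the germ. -/
lemma Good.congr {R : Set (Vec n × ((i : Fin (r + 1)) → SymMap n ℓ i.1))} {Q' : Type}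
    {G : Vec n × Q → Vec ℓ} {G' : Vec n × Q' → Vec ℓ} {q : Q} {q' : Q'} {x : Vec n}
    (h : (fun y => G (y, q)) =ᶠ[𝓝 x] fun y => G' (y, q')) (hx : Good R G (x, q)) :
    (x, fun i : Fin (r + 1) => PJ G' i.1 (x, q')) ∈ R := by
  have e : ∀ i : Fin (r+1), PJ G' i.1 (x, q') = PJ G i.1 (x, q) := fun i =>
    ((h.iteratedFDeriv ℝ i.1).eq_of_nhds).symm
  simp only [e]
  exact hx

lemma zcast_neg (m : Fin n → ℤ) : zcast (-m) = -zcast m := by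
  funext j; simp [zcast]

lemma reduce_cube (x : Vec n) : ∃ m : Fin n → ℤ, x + zcast m ∈ Set.Icc (0 : Vec n) 1 := by
  refine ⟨fun j => -⌊x j⌋, fun j => ?_, fun j => ?_⟩
  · have := Int.floor_le (x j); simp [zcast]; exact this
  · have := Int.lt_floor_add_one (x j); simp [zcast]; linarith

lemma tube {Z : Type} [PseudoMetricSpace Z] {K O : Set Z} (hK : IsCompact K) (hO : IsOpen O) (h : K ⊆ O) :
    ∃ δ > 0, ∀ z ∈ K, ∀ z', dist z' z < δ → z' ∈ O := by
  obtain ⟨δ, hδ, hs⟩ := hK.exists_thickening_subset_open hO h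
  exact ⟨δ, hδ, fun z hz z' hzz => hs (Metric.mem_thickening_iff.2 ⟨z, hz, hzz⟩)⟩

end Good

section Wiggle

variable {n ℓ r : ℕ}

/-- Wiggled holonomic families: `F (·, c)` solves near the wiggled cell with centre `c`, and `F` does not
depend on the coordinates `c j` for `j ∈ S`. -/
def WS (R : Set (Vec n × ((i : Fin (r + 1)) → SymMap n ℓ i.1))) (o : Fin n) (S : Finset (Fin n)) : Prop :=
  ∃ (F : Vec n × Vec n → Vec ℓ) (W : Vec n → ℝ) (a : ℝ), 0 < a ∧ ContDiff ℝ ∞ F ∧ ContDiff ℝ ∞ W ∧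
    (∀ x c (m : Fin n → ℤ), F (x + zcast m, c + zcast m) = F (x, c)) ∧
    (∀ x (m : Fin n → ℤ), W (x + zcast m) = W x) ∧
    (∀ x v, W (Function.update x o v) = W x) ∧
    (∀ j ∈ S, ∀ x c v, F (x, Function.update c j v) = F (x, c)) ∧
    (∀ x c, |x o - c o - W x| ≤ a → (∀ i, i ≠ o → |x i - c i| ≤ a) → Good R F (x, c))

lemma contDiff_update' {E : Type} [NormedAddCommGroup E] [NormedSpace ℝ E] {f : E → Vec n} {g : E → ℝ}
    (j : Fin n) (hf : ContDiff ℝ ∞ f) (hg : ContDiff ℝ ∞ g) :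
    ContDiff ℝ ∞ (fun z => Function.update (f z) j (g z)) := by
  refine contDiff_pi.2 fun i => ?_
  by_cases h : i = j
  · subst h; simpa using hg
  · simp only [Function.update_of_ne h]
    exact (contDiff_apply ℝ ℝ i).comp hf

lemma update_add_zcast (c : Vec n) (j : Fin n) (v : ℝ) (m : Fin n → ℤ) :
    Function.update (c + zcast m) j (v + m j) = Function.update c j v + zcast m := by
  funext i
  by_cases h : i = j
  · subst h; simp [zcast]
  · simp [Function.update_of_ne h]

lemma WS_step {R : Set (Vec n × ((i : Fin (r + 1)) → SymMap n ℓ i.1))} (hR : IsOpen R)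
    (hRinv : ∀ (x : Vec n) (z : (i : Fin (r + 1)) → SymMap n ℓ i.1) (m : Fin n → ℤ),
      (x, z) ∈ R → (x + zcast m, z) ∈ R) {o j : Fin n} (hj : j ≠ o) {S : Finset (Fin n)} (hjS : j ∉ S) (hoS : o ∉ S)
    (h : WS R o S) : WS R o (insert j S) := by
  obtain ⟨F, W, a, ha, hF, hW, hFm, hWm, hWo, hFS, hgood⟩ := h
  obtain ⟨A, hA, hA2, hAs, hAc⟩ := staircase
  have hA2' : ∀ (k : ℤ) s, A (s + 2 * k) = A s + 2 * k := fun k s => by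
    have := period_int hA2 k s
    rw [mul_comm (2:ℝ)]; exact this
  set h := a / 2 with hh
  have hh0 : 0 < h := by positivity
  set χ : ℝ → ℝ := fun v => Real.smoothTransition (v + 1/2) with hχ
  have hχC : ContDiff ℝ ∞ χ := Real.smoothTransition.contDiff.comp (by fun_prop)
  set G : Vec n × (Vec n × (ℝ × ℝ)) → Vec ℓ := fun z =>
    F (z.1, Function.update z.2.1 j (z.2.2.1 + z.2.2.2 * χ ((z.1 o - z.2.1 o - W z.1) / h))) with hG
  have hGC : ContDiff ℝ ∞ G := by
    refine hF.comp (contDiff_fst.prodMk (contDiff_update' j (by fun_prop) ?_))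
    refine ContDiff.add (by fun_prop) (ContDiff.mul (by fun_prop) (hχC.comp ?_))
    refine ContDiff.div_const (ContDiff.sub (by fun_prop) (hW.comp contDiff_fst)) _
  set φ : Vec n × Vec n × ℝ → Vec n × (Vec n × (ℝ × ℝ)) := fun y =>
    (y.1, (y.1 - y.2.1 - Pi.single o (W y.1), (y.1 j + y.2.2, 0))) with hφ
  have hφC : Continuous φ := by
    have hWc := hW.continuous
    have : Continuous fun y : Vec n × Vec n × ℝ => (Pi.single o (W y.1) : Vec n) :=
      (continuous_single (A := fun _ : Fin n => ℝ) o).comp (hWc.comp continuous_fst)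
    fun_prop
  set K : Set (Vec n × (Vec n × (ℝ × ℝ))) := φ '' (Set.Icc 0 1 ×ˢ (Set.Icc (fun _ => -a) (fun _ => a) ×ˢ Set.Icc (-a) a)) with hK
  have hKc : IsCompact K := (isCompact_Icc.prod (isCompact_Icc.prod isCompact_Icc)).image hφC
  have hKO : K ⊆ {z | Good R G z} := by
    rintro _ ⟨⟨x, d, e⟩, ⟨hx, hd, he⟩, rfl⟩
    simp only [hφ, Set.mem_ofPred_eq]
    have key : Good R F (x, Function.update (x - d - Pi.single o (W x)) j (x j + e)) := by
      refine hgood _ _ ?_ fun i hi => ?_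
      · rw [Function.update_of_ne hj.symm]
        simp only [Pi.sub_apply, Pi.single_eq_same]
        rw [show x o - (x o - d o - W x) - W x = d o by ring]
        exact abs_le.2 ⟨hd.1 o, hd.2 o⟩
      · by_cases hij : i = j
        · subst hij; simp only [Function.update_self]
          rw [abs_le]; exact ⟨by linarith [he.2], by linarith [he.1]⟩
        · rw [Function.update_of_ne hij]
          simp only [Pi.sub_apply, Pi.single_eq_of_ne hi]
          rw [show x i - (x i - d i - 0) = d i by ring]
          exact abs_le.2 ⟨hd.1 i, hd.2 i⟩
    refine key.congr (G' := G) (Filter.Eventually.of_forall fun y => ?_)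
    simp [hG]
  obtain ⟨δ, hδ, htube⟩ := tube hKc (isOpen_good hR hGC) hKO
  obtain ⟨L, hL⟩ := exists_nat_gt (max (1 / a) (2 / δ))
  have hL1 : 1 / a < L := lt_of_le_of_lt (le_max_left _ _) hL
  have hL2 : 2 / δ < L := lt_of_le_of_lt (le_max_right _ _) hL
  have hL0 : (0:ℝ) < L := lt_trans (by positivity) hL1
  set ε : ℝ := 1 / (2 * L) with hε
  have hε0 : 0 < ε := by positivity
  have hεL : ε * L = 1/2 := by rw [hε]; field_simp
  have hε1 : 2 * ε ≤ a := by
    rw [div_lt_iff₀ ha] at hL1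
    have := mul_lt_mul_of_pos_left hL1 hε0
    nlinarith
  have hε2 : 4 * ε < δ := by
    rw [div_lt_iff₀ hδ] at hL2
    have := mul_lt_mul_of_pos_left hL2 hε0
    nlinarith
  set Bh : ℝ → ℝ := fun s => A (s - 1) + 1 with hBh
  have hBhC : ContDiff ℝ ∞ Bh := (hA.comp (by fun_prop)).add contDiff_const
  have hBs : ∀ s, |Bh s - s| ≤ 2 := fun s => by
    have := hAs (s - 1)
    rw [hBh]; simp only
    rwa [show A (s-1) + 1 - s = A (s-1) - (s-1) by ring]
  set w : ℝ → ℝ := fun s => -Real.cos (Real.pi * s) with hw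
  have hwC : ContDiff ℝ ∞ w := by rw [hw]; fun_prop
  have hwb : ∀ s, |w s| ≤ 1 := fun s => by rw [hw]; simp only [abs_neg]; exact Real.abs_cos_le_one _
  have hBc : ∀ s0, -0.9 < w s0 → ∀ᶠ s in 𝓝 s0, Bh s = Bh s0 := by
    intro s0 hs0
    have h1 : -Real.cos (Real.pi * (s0 - 1)) < 0.9 := by
      rw [show Real.pi * (s0 - 1) = Real.pi * s0 - Real.pi by ring, Real.cos_sub_pi]
      simp only [hw] at hs0; linarith
    have hc : Filter.Tendsto (fun s : ℝ => s - 1) (𝓝 s0) (𝓝 (s0 - 1)) := by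
      exact (continuous_id.sub continuous_const).tendsto s0
    filter_upwards [hc.eventually (hAc _ h1)] with s hs
    simp only [hBh, hs]
  have hBh2 : ∀ (k : ℤ) s, Bh (s + 2 * k) = Bh s + 2 * k := fun k s => by
    simp only [hBh]
    rw [show s + 2 * (k:ℝ) - 1 = (s - 1) + 2 * k by ring, hA2']; ring
  have hw2 : ∀ (k : ℤ) s, w (s + 2 * k) = w s := fun k s => by
    simp only [hw]
    rw [show Real.pi * (s + 2 * k) = Real.pi * s + k * (2 * Real.pi) by ring, Real.cos_add_int_mul_two_pi]
  set s : Vec n → ℝ := fun x => 2 * L * x j with hs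
  have hsC : ContDiff ℝ ∞ s := by rw [hs]; fun_prop
  have hsm : ∀ x (m : Fin n → ℤ), s (x + zcast m) = s x + 2 * ((L * m j : ℤ) : ℝ) := fun x m => by
    simp only [hs, Pi.add_apply, zcast]; push_cast; ring
  have hεs : ∀ x, ε * s x = x j := fun x => by
    simp only [hs]; linear_combination 2 * x j * hεL
  set V : Vec n × Vec n → ℝ := fun z => (z.1 o - z.2 o - W z.1) / h with hV
  have hVC : ContDiff ℝ ∞ V := by
    refine ContDiff.div_const (ContDiff.sub (by fun_prop) (hW.comp contDiff_fst)) _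
  have hVm : ∀ x c (m : Fin n → ℤ), V (x + zcast m, c + zcast m) = V (x, c) := fun x c m => by
    simp only [hV, hWm, Pi.add_apply]; congr 1; ring
  set B : Vec n × Vec n → ℝ := fun z => ε * (A (s z.1) + (Bh (s z.1) - A (s z.1)) * χ (V z)) with hB
  have hBC : ContDiff ℝ ∞ B := by
    have h1 := hsC.comp (contDiff_fst (E := Vec n) (F := Vec n))
    exact contDiff_const.mul ((hA.comp h1).add (((hBhC.comp h1).sub (hA.comp h1)).mul (hχC.comp hVC)))
  have hBm : ∀ x c (m : Fin n → ℤ), B (x + zcast m, c + zcast m) = B (x, c) + m j := fun x c m => by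
    simp only [hB, hVm, hsm, hA2', hBh2]
    push_cast
    linear_combination 2 * (m j : ℝ) * hεL
  set F' : Vec n × Vec n → Vec ℓ := fun z => F (z.1, Function.update z.2 j (B z)) with hF'
  have hF'm : ∀ x c (m : Fin n → ℤ), F' (x + zcast m, c + zcast m) = F' (x, c) := fun x c m => by
    simp only [hF', hBm, update_add_zcast, hFm]
  refine ⟨F', fun x => W x + h * w (s x), a / 10, by positivity,
    hF.comp (contDiff_fst.prodMk (contDiff_update' j contDiff_snd hBC)),
    hW.add (contDiff_const.mul (hwC.comp hsC)), hF'm, ?_, ?_, ?_, ?_⟩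
  · intro x m
    simp only [hWm, hsm, hw2]
  · intro x v
    simp only [hWo, hs, Function.update_of_ne hj]
  · intro k hk x c v
    simp only [hF']
    have hBk : ∀ k, k ≠ o → B (x, Function.update c k v) = B (x, c) := fun k hk => by
      simp only [hB, hV, Function.update_of_ne hk.symm]
    by_cases hkj : k = j
    · subst hkj
      rw [hBk _ hj, Function.update_idem]
    · have hkS : k ∈ S := (Finset.mem_insert.1 hk).resolve_left hkj
      rw [hBk _ (fun h => hoS (h ▸ hkS)), Function.update_comm hkj, hFS k hkS]
  · have main : ∀ x c, x ∈ Set.Icc (0 : Vec n) 1 → |x o - c o - (W x + h * w (s x))| ≤ a / 10 →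
        (∀ i, i ≠ o → |x i - c i| ≤ a / 10) → Good R F' (x, c) := by
      intro x c hx h1 h2
      have hvw : |V (x, c) - w (s x)| ≤ 1/5 := by
        have e : V (x, c) - w (s x) = (x o - c o - (W x + h * w (s x))) / h := by
          simp only [hV]; field_simp; ring
        rw [e, abs_div, abs_of_pos hh0, div_le_iff₀ hh0]
        calc _ ≤ a / 10 := h1
          _ = _ := by rw [hh]; ring
      -- it suffices to freeze the two staircases
      have suff : ∀ A0 κ, |A0 - x j| ≤ 2 * ε → |κ| ≤ 4 * ε →
          (∀ᶠ y in 𝓝 x, B (y, c) = A0 + κ * χ (V (y, c))) → Good R F' (x, c) := by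
        intro A0 κ hA0 hκ hev
        have hmem : (x, (c, (A0, (0:ℝ)))) ∈ K := by
          refine ⟨(x, x - c - Pi.single o (W x), A0 - x j), ⟨hx, ?_, ?_⟩, ?_⟩
          · have : ∀ i, |(x - c - Pi.single o (W x) : Vec n) i| ≤ a := by
              intro i
              by_cases hi : i = o
              · subst hi
                simp only [Pi.sub_apply, Pi.single_eq_same]
                have h3 := hwb (s x)
                have h4 : |h * w (s x)| ≤ h := by
                  rw [abs_mul, abs_of_pos hh0]; nlinarith
                rw [abs_le] at h1 h4 ⊢
                constructor <;> linarith [h1.1, h1.2, h4.1, h4.2]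
              · simp only [Pi.sub_apply, Pi.single_eq_of_ne hi, sub_zero]
                linarith [h2 i hi]
            exact ⟨fun i => (abs_le.1 (this i)).1, fun i => (abs_le.1 (this i)).2⟩
          · exact abs_le.1 (hA0.trans hε1)
          · simp [hφ]
            abel
        have hg : Good R G (x, (c, (A0, κ))) := by
          refine htube _ hmem _ ?_
          simp only [Prod.dist_eq, dist_self, Real.dist_eq, sub_zero]
          have := abs_nonneg κ
          simp only [this, max_eq_right]
          linarith
        refine hg.congr (G' := F') ?_
        filter_upwards [hev] with y hy
        simp only [hG, hF', hy, hV]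
      have hsx : Filter.Tendsto s (𝓝 x) (𝓝 (s x)) := hsC.continuous.tendsto x
      have hVx : ContinuousAt (fun y => V (y, c)) x :=
        (hVC.continuous.comp (continuous_id.prodMk continuous_const)).continuousAt
      have bA : |ε * A (s x) - x j| ≤ 2 * ε := by
        rw [← hεs x, ← mul_sub, abs_mul, abs_of_pos hε0]; nlinarith [hAs (s x)]
      have bB : |ε * Bh (s x) - x j| ≤ 2 * ε := by
        rw [← hεs x, ← mul_sub, abs_mul, abs_of_pos hε0]; nlinarith [hBs (s x)]
      rw [abs_le] at hvw
      by_cases c1 : 0.8 ≤ w (s x)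
      · refine suff (ε * Bh (s x)) 0 bB (by simp; positivity) ?_
        have hv : (1/2 : ℝ) < V (x, c) := by linarith [hvw.1]
        filter_upwards [hsx.eventually (hBc (s x) (by linarith)), hVx.eventually (lt_mem_nhds hv)] with y hy1 hy2
        have : χ (V (y, c)) = 1 := Real.smoothTransition.one_of_one_le (by linarith)
        simp only [hB, this, hy1]; ring
      by_cases c2 : w (s x) ≤ -0.8
      · refine suff (ε * A (s x)) 0 bA (by simp; positivity) ?_
        have hv : V (x, c) < -(1/2 : ℝ) := by linarith [hvw.2]
        have hws : -Real.cos (Real.pi * s x) < 0.9 := by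
          have : w (s x) < 0.9 := by linarith
          exact this
        filter_upwards [hsx.eventually (hAc (s x) hws), hVx.eventually (gt_mem_nhds hv)] with y hy1 hy2
        have : χ (V (y, c)) = 0 := Real.smoothTransition.zero_of_nonpos (by linarith)
        simp only [hB, this, hy1]; ring
      · refine suff (ε * A (s x)) (ε * (Bh (s x) - A (s x))) bA ?_ ?_
        · rw [abs_mul, abs_of_pos hε0]
          have : |Bh (s x) - A (s x)| ≤ 4 := by
            have e1 := abs_le.1 (hAs (s x)); have e2 := abs_le.1 (hBs (s x))
            rw [abs_le]; constructor <;> linarith [e1.1, e1.2, e2.1, e2.2]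
          nlinarith
        · have hws : -Real.cos (Real.pi * s x) < 0.9 := by
            have : w (s x) < 0.9 := by linarith
            exact this
          filter_upwards [hsx.eventually (hAc (s x) hws), hsx.eventually (hBc (s x) (by linarith))] with y hy1 hy2
          simp only [hB, hy1, hy2]; ring
    intro x c h1 h2
    obtain ⟨m, hm⟩ := reduce_cube x
    have hg := main (x + zcast m) (c + zcast m) hm (by
      simp only [hWm, hsm, hw2, Pi.add_apply]
      rwa [add_sub_add_right_eq_sub]) (fun i hi => by
        simp only [Pi.add_apply]; rw [add_sub_add_right_eq_sub]; exact h2 i hi)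
    have hsft := Good.shift hRinv (m := -m) (q' := c) (fun y => by
      have := hF'm (y + zcast (-m)) c m
      rw [← this, zcast_neg, neg_add_cancel_right]) hg
    rwa [zcast_neg, add_neg_cancel_right] at hsft

lemma WS_all {R : Set (Vec n × ((i : Fin (r + 1)) → SymMap n ℓ i.1))} (hR : IsOpen R)
    (hRinv : ∀ (x : Vec n) (z : (i : Fin (r + 1)) → SymMap n ℓ i.1) (m : Fin n → ℤ),
      (x, z) ∈ R → (x + zcast m, z) ∈ R) {o : Fin n} (h : WS R o ∅) (S : Finset (Fin n)) (hS : o ∉ S) :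
    WS R o S := by
  induction S using Finset.induction_on with
  | empty => exact h
  | insert j S hj ih =>
    rw [Finset.mem_insert, not_or] at hS
    exact WS_step hR hRinv (Ne.symm hS.1) hj hS.2 (ih hS.2)

end Wiggle

section Base

variable {n ℓ r : ℕ}

lemma smooth_approx {V : Type} [NormedAddCommGroup V] [NormedSpace ℝ V] [CompleteSpace V]
    {f : Vec n → V} (hf : Continuous f) (hper : ∀ (m : Fin n → ℤ) p, f (p + zcast m) = f p)
    {ε : ℝ} (hε : 0 < ε) :
    ∃ g : Vec n → V, ContDiff ℝ ∞ g ∧ (∀ (m : Fin n → ℤ) p, g (p + zcast m) = g p) ∧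
      (∀ x, dist (g x) (f x) ≤ ε) ∧
      ∀ {V' : Type} [NormedAddCommGroup V'] [NormedSpace ℝ V'] [CompleteSpace V'] (T : V →L[ℝ] V'),
        (∀ x, T (f x) = 0) → ∀ x, T (g x) = 0 := by
  have hu : ∃ δ > 0, ∀ x y : Vec n, dist x y < δ → dist (f x) (f y) < ε := by
    have h1 := (isCompact_Icc (a := (0 : Vec n)) (b := 1)).uniformContinuousAt_of_continuousAt f
      (fun a _ => hf.continuousAt) (Metric.dist_mem_uniformity hε)
    obtain ⟨δ, hδ, h2⟩ := Metric.mem_uniformity_dist.1 h1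
    refine ⟨δ, hδ, fun x y hxy => ?_⟩
    obtain ⟨m, hm⟩ := reduce_cube x
    have := h2 (a := x + zcast m) (b := y + zcast m) (by rwa [dist_add_right]) hm
    simpa [hper] using this
  obtain ⟨δ, hδ, hu⟩ := hu
  let φ : ContDiffBump (0 : Vec n) := ⟨δ / 2, δ, by positivity, by linarith⟩
  let μ : MeasureTheory.Measure (Vec n) := MeasureTheory.volume
  refine ⟨MeasureTheory.convolution (φ.normed μ) f (ContinuousLinearMap.lsmul ℝ ℝ) μ, ?_, ?_, ?_, ?_⟩
  · exact φ.hasCompactSupport_normed.contDiff_convolution_left _ φ.contDiff_normed hf.locallyIntegrable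
  · intro m p
    simp only [MeasureTheory.convolution]
    congr 1; funext t
    rw [add_sub_right_comm, hper]
  · intro x
    exact φ.dist_normed_convolution_le hf.aestronglyMeasurable fun y hy => (hu y x hy).le
  · intro V' _ _ _ T hT x
    have hint := φ.hasCompactSupport_normed.convolutionExists_left (μ := μ) (ContinuousLinearMap.lsmul ℝ ℝ)
      (φ.contDiff_normed (μ := μ) (n := 0)).continuous (hf.locallyIntegrable (μ := μ)) x
    simp only [MeasureTheory.convolution]
    rw [← ContinuousLinearMap.integral_comp_comm T hint]
    simp [hT]

lemma contDiff_diag (i : ℕ) : ContDiff ℝ ∞ (fun z : SymMap n ℓ i × Vec n => z.1 (fun _ => z.2)) := by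
  induction i with
  | zero =>
    have : (fun z : SymMap n ℓ 0 × Vec n => z.1 (fun _ => z.2)) =
        fun z => continuousMultilinearCurryFin0 ℝ (Vec n) (Vec ℓ) z.1 := by
      funext z
      simp only [continuousMultilinearCurryFin0_apply]
      congr 1; funext k; exact k.elim0
    rw [this]
    exact (continuousMultilinearCurryFin0 ℝ (Vec n) (Vec ℓ)).contDiff.comp contDiff_fst
  | succ i ih =>
    have : (fun z : SymMap n ℓ (i+1) × Vec n => z.1 (fun _ => z.2)) =
        fun z => (fun y : SymMap n ℓ i × Vec n => y.1 (fun _ => y.2))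
          ((continuousMultilinearCurryLeftEquiv ℝ (fun _ : Fin (i+1) => Vec n) (Vec ℓ) z.1) z.2, z.2) := by
      funext z
      simp only [continuousMultilinearCurryLeftEquiv_apply]
      congr 1; funext k
      refine Fin.cases ?_ (fun k => ?_) k <;> simp
    rw [this]
    refine ih.comp (ContDiff.prodMk ?_ contDiff_snd)
    exact ((continuousMultilinearCurryLeftEquiv ℝ (fun _ : Fin (i+1) => Vec n) (Vec ℓ)).contDiff.comp
      contDiff_fst).clm_apply contDiff_snd

lemma base_family {R : Set (Vec n × ((i : Fin (r + 1)) → SymMap n ℓ i.1))} (hR : IsOpen R)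
    (hRinv : ∀ (x : Vec n) (z : (i : Fin (r + 1)) → SymMap n ℓ i.1) (m : Fin n → ℤ),
      (x, z) ∈ R → (x + zcast m, z) ∈ R) (o : Fin n)
    (σ : (i : ℕ) → Vec n → SymMap n ℓ i)
    (hσcont : ∀ i ≤ r, ContDiff ℝ ∞ (σ i))
    (hσper : ∀ i ≤ r, ∀ (m : Fin n → ℤ) (p : Vec n), σ i (p + zcast m) = σ i p)
    (hσsym : ∀ i ≤ r, ∀ p : Vec n, IsSymmMap (σ i p))
    (hσR : ∀ x : Vec n, (x, fun i : Fin (r + 1) => σ i.1 x) ∈ R) : WS R o ∅ := by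
  set F : Vec n × Vec n → Vec ℓ := fun z =>
    ∑ i ∈ Finset.range (r + 1), ((i.factorial : ℝ)⁻¹) • σ i z.2 (fun _ => z.1 - z.2) with hF
  have hFC : ContDiff ℝ ∞ F := by
    refine ContDiff.sum fun i hi => ContDiff.const_smul _ ?_
    have hi' : i ≤ r := by simpa [Nat.lt_succ_iff] using hi
    exact (contDiff_diag i).comp (((hσcont i hi').comp contDiff_snd).prodMk (contDiff_fst.sub contDiff_snd))
  have hFm : ∀ x c (m : Fin n → ℤ), F (x + zcast m, c + zcast m) = F (x, c) := by
    intro x c m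
    refine Finset.sum_congr rfl fun i hi => ?_
    have hi' : i ≤ r := by simpa [Nat.lt_succ_iff] using hi
    simp only [hσper i hi', add_sub_add_right_eq_sub]
  have hPJ : ∀ i ≤ r, ∀ c, PJ F i (c, c) = σ i c := by
    intro i hi c
    let p : FormalMultilinearSeries ℝ (Vec n) (Vec ℓ) := fun i =>
      if i < r + 1 then ((i.factorial : ℝ)⁻¹) • σ i c else 0
    have hp : HasFiniteFPowerSeriesOnBall (fun x => F (x, c)) p c (r + 1) ⊤ := by
      refine .mk' (fun m hm => if_neg (by omega)) (by simp) fun y _ => ?_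
      refine Finset.sum_congr rfl fun i hi => ?_
      simp only [p, if_pos (Finset.mem_range.1 hi)]
      simp
    ext1 v
    simp only [PJ]
    rw [hp.toHasFPowerSeriesOnBall.iteratedFDeriv_eq_sum_of_completeSpace v]
    simp only [p, if_pos (Nat.lt_succ_of_le hi)]
    have : ∀ e : Equiv.Perm (Fin i), (((i.factorial : ℝ)⁻¹) • σ i c) (fun k => v (e k)) =
        ((i.factorial : ℝ)⁻¹) • σ i c v := fun e => by
      have := hσsym i hi c e v
      rw [_root_.smul_apply, ← this]; rfl
    rw [Finset.sum_congr rfl fun e _ => this e]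
    rw [Finset.sum_const, Finset.card_univ, Fintype.card_perm, Fintype.card_fin, ← Nat.cast_smul_eq_nsmul ℝ,
      smul_smul, mul_inv_cancel₀ (by exact_mod_cast i.factorial_ne_zero), one_smul]
  have hKc : IsCompact ((fun c : Vec n => (c, c)) '' Set.Icc 0 1) := isCompact_Icc.image (by fun_prop)
  obtain ⟨δ, hδ, ht⟩ := tube hKc (isOpen_good hR hFC) (by
    rintro _ ⟨c, hc, rfl⟩
    have := hσR c
    have e : (fun i : Fin (r+1) => PJ F i.1 (c, c)) = fun i : Fin (r+1) => σ i.1 c :=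
      funext fun i => hPJ i.1 (Nat.lt_succ_iff.1 i.2) c
    simp only [Set.mem_ofPred_eq, Good, e]
    exact this)
  refine ⟨F, fun _ => 0, δ / 2, by positivity, hFC, contDiff_const, hFm, fun _ _ => rfl, fun _ _ => rfl,
    by simp, ?_⟩
  intro x c h1 h2
  have hall : ∀ i, |x i - c i| ≤ δ / 2 := fun i => by
    by_cases h : i = o
    · subst h; simpa using h1
    · exact h2 i h
  obtain ⟨m, hm⟩ := reduce_cube c
  have hg : Good R F (x + zcast m, c + zcast m) := by
    refine ht (c + zcast m, c + zcast m) ⟨_, hm, rfl⟩ _ ?_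
    rw [Prod.dist_eq, dist_self, dist_add_right]
    have : dist x c ≤ δ / 2 := (dist_pi_le_iff (by positivity)).2 fun i => by rw [Real.dist_eq]; exact hall i
    rw [max_eq_left dist_nonneg]; linarith
  have hsft := Good.shift hRinv (m := -m) (q' := c) (fun y => by
      have := hFm (y + zcast (-m)) c m
      rw [← this, zcast_neg, neg_add_cancel_right]) hg
  rwa [zcast_neg, add_neg_cancel_right] at hsft

lemma smoothing {R : Set (Vec n × ((i : Fin (r + 1)) → SymMap n ℓ i.1))} (hR : IsOpen R)
    (hRinv : ∀ (x : Vec n) (z : (i : Fin (r + 1)) → SymMap n ℓ i.1) (m : Fin n → ℤ),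
      (x, z) ∈ R → (x + zcast m, z) ∈ R)
    (σ : (i : ℕ) → Vec n → SymMap n ℓ i)
    (hσcont : ∀ i ≤ r, Continuous (σ i))
    (hσper : ∀ i ≤ r, ∀ (m : Fin n → ℤ) (p : Vec n), σ i (p + zcast m) = σ i p)
    (hσsym : ∀ i ≤ r, ∀ p : Vec n, IsSymmMap (σ i p))
    (hσR : ∀ x : Vec n, (x, fun i : Fin (r + 1) => σ i.1 x) ∈ R) :
    ∃ τ : (i : ℕ) → Vec n → SymMap n ℓ i, (∀ i ≤ r, ContDiff ℝ ∞ (τ i)) ∧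
    (∀ i ≤ r, ∀ (m : Fin n → ℤ) (p : Vec n), τ i (p + zcast m) = τ i p) ∧
    (∀ i ≤ r, ∀ p : Vec n, IsSymmMap (τ i p)) ∧
    (∀ x : Vec n, (x, fun i : Fin (r + 1) => τ i.1 x) ∈ R) := by
  have hcont : Continuous fun x : Vec n => (x, fun i : Fin (r + 1) => σ i.1 x) :=
    continuous_id.prodMk (continuous_pi fun i => hσcont i.1 (Nat.lt_succ_iff.1 i.2))
  obtain ⟨δ, hδ, ht⟩ := tube ((isCompact_Icc (a := (0 : Vec n)) (b := 1)).image hcont) hR (by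
    rintro _ ⟨x, _, rfl⟩; exact hσR x)
  have key : ∀ i, ∃ g : Vec n → SymMap n ℓ i, i ≤ r → ContDiff ℝ ∞ g ∧
      (∀ (m : Fin n → ℤ) p, g (p + zcast m) = g p) ∧ (∀ x, dist (g x) (σ i x) ≤ δ / 2) ∧
      ∀ p, IsSymmMap (g p) := by
    intro i
    by_cases hi : i ≤ r
    · obtain ⟨g, h1, h2, h3, h4⟩ := smooth_approx (hσcont i hi) (hσper i hi) (half_pos hδ)
      refine ⟨g, fun _ => ⟨h1, h2, h3, fun p e v => ?_⟩⟩
      have := h4 (ContinuousMultilinearMap.apply ℝ (fun _ : Fin i => Vec n) (Vec ℓ) (v ∘ e) -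
        ContinuousMultilinearMap.apply ℝ (fun _ : Fin i => Vec n) (Vec ℓ) v) (fun x => by
          have := hσsym i hi x e v
          simp [this]) p
      simpa [sub_eq_zero] using this
    · exact ⟨0, fun h => absurd h hi⟩
  choose τ hτ using key
  refine ⟨τ, fun i hi => (hτ i hi).1, fun i hi => (hτ i hi).2.1, fun i hi => (hτ i hi).2.2.2, fun x => ?_⟩
  obtain ⟨m, hm⟩ := reduce_cube x
  have h1 : (x + zcast m, fun i : Fin (r + 1) => τ i.1 (x + zcast m)) ∈ R := by
    refine ht _ ⟨x + zcast m, hm, rfl⟩ _ ?_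
    rw [Prod.dist_eq, dist_self]
    have : dist (fun i : Fin (r + 1) => τ i.1 (x + zcast m)) (fun i : Fin (r + 1) => σ i.1 (x + zcast m)) ≤ δ / 2 :=
      (dist_pi_le_iff (by positivity)).2 fun i => (hτ i.1 (Nat.lt_succ_iff.1 i.2)).2.2.1 _
    rw [max_eq_right dist_nonneg]; linarith
  have h2 := hRinv _ _ (-m) h1
  rw [zcast_neg, add_neg_cancel_right] at h2
  have e : (fun i : Fin (r+1) => τ i.1 (x + zcast m)) = fun i : Fin (r+1) => τ i.1 x :=
    funext fun i => (hτ i.1 (Nat.lt_succ_iff.1 i.2)).2.1 m x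
  rwa [e] at h2

end Base

section Assembly

variable {n ℓ r : ℕ}

lemma lipschitz_family {Q : Vec n × ℝ → Vec ℓ} (hQ : ContDiff ℝ ∞ Q) {U : Vec n → ℝ} (hU : Continuous U)
    {o : Fin n} (hUm : ∀ x (m : Fin n → ℤ), U (x + zcast m) = U x + m o)
    (hQm : ∀ x c (m : Fin n → ℤ), Q (x + zcast m, c + m o) = Q (x, c)) {a : ℝ} :
    ∃ C : ℝ, 0 ≤ C ∧ ∀ x c c', |c - U x| ≤ a → |c' - U x| ≤ a → ‖Q (x, c) - Q (x, c')‖ ≤ C * |c - c'| := by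
  obtain ⟨M, hM⟩ := (isCompact_Icc (a := (0 : Vec n)) (b := 1)).exists_bound_of_continuousOn hU.continuousOn
  set K : Set (Vec n × ℝ) := Set.Icc 0 1 ×ˢ Set.Icc (-(M + a)) (M + a) with hK
  have hKc : IsCompact K := isCompact_Icc.prod isCompact_Icc
  have hKv : Convex ℝ K := (convex_Icc _ _).prod (convex_Icc _ _)
  obtain ⟨C, hC⟩ : ∃ C, LipschitzOnWith C Q K :=
    (hQ.of_le (by exact_mod_cast le_top) : ContDiff ℝ 1 Q).contDiffOn.exists_lipschitzOnWith (by simp) hKv hKc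
  refine ⟨C, C.2, fun x c c' h1 h2 => ?_⟩
  obtain ⟨m, hm⟩ := reduce_cube x
  have hin : ∀ c, |c - U x| ≤ a → (x + zcast m, c + m o) ∈ K := by
    intro c hc
    have h3 := hM _ hm
    rw [hUm, Real.norm_eq_abs] at h3
    rw [abs_le] at h3 hc
    exact ⟨hm, by constructor <;> linarith [h3.1, h3.2, hc.1, hc.2]⟩
  have := hC.dist_le_mul _ (hin c h1) _ (hin c' h2)
  rw [hQm, hQm, dist_eq_norm, Prod.dist_eq, dist_self, dist_add_right, max_eq_right dist_nonneg, Real.dist_eq] at this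
  exact this

lemma reduce_family {R : Set (Vec n × ((i : Fin (r + 1)) → SymMap n ℓ i.1))} {o : Fin n}
    (h : WS R o (Finset.univ.erase o)) :
    ∃ (Q : Vec n × ℝ → Vec ℓ) (W : Vec n → ℝ) (a : ℝ), 0 < a ∧ ContDiff ℝ ∞ Q ∧ ContDiff ℝ ∞ W ∧
    (∀ x c (m : Fin n → ℤ), Q (x + zcast m, c + m o) = Q (x, c)) ∧
    (∀ x (m : Fin n → ℤ), W (x + zcast m) = W x) ∧
    (∀ x v, W (Function.update x o v) = W x) ∧
    (∀ x c, |c - (x o - W x)| ≤ a → Good R Q (x, c)) := by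
  obtain ⟨F, W, a, ha, hF, hW, hFm, hWm, hWo, hFS, hgood⟩ := h
  have hpw : ∀ (T : Finset (Fin n)), o ∉ T → ∀ x c c' : Vec n, F (x, T.piecewise c' c) = F (x, c) := by
    intro T
    induction T using Finset.induction_on with
    | empty => intro _ x c c'; simp
    | insert j T hj ih =>
      intro ho x c c'
      rw [Finset.mem_insert, not_or] at ho
      rw [Finset.piecewise_insert, hFS j (by simp [Ne.symm ho.1]), ih ho.2]
  have hind : ∀ x c c' : Vec n, c o = c' o → F (x, c) = F (x, c') := by
    intro x c c' hcc
    rw [← hpw (Finset.univ.erase o) (by simp) x c c']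
    congr 2
    funext i
    by_cases hi : i = o
    · subst hi; simp [hcc]
    · simp [hi]
  refine ⟨fun z => F (z.1, Pi.single o z.2), W, a, ha, ?_, hW, ?_, hWm, hWo, ?_⟩
  · refine hF.comp (contDiff_fst.prodMk ?_)
    exact contDiff_update' o contDiff_const contDiff_snd
  · intro x c m
    simp only
    rw [← hFm x _ m]
    exact hind _ _ _ (by simp [zcast])
  · intro x c hc
    have hg : Good R F (x, Function.update x o c) := by
      refine hgood _ _ ?_ fun i hi => ?_
      · rw [Function.update_self, show x o - c - W x = -(c - (x o - W x)) by ring, abs_neg]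
        exact hc
      · simp [Function.update_of_ne hi, ha.le]
    refine hg.congr (Filter.Eventually.of_forall fun y => ?_)
    exact hind _ _ _ (by simp)

lemma TP_single (v : ℝ × ℝ) (z : ℝ) : TP r (Pi.single 0 v) z = v := by
  rw [TP, Fin.sum_univ_succ]
  simp

lemma TP_add (η η' : Fin (r + 1) → ℝ × ℝ) (z : ℝ) : TP r (η + η') z = TP r η z + TP r η' z := by
  simp [TP, smul_add, Finset.sum_add_distrib]

end Assembly
/-- Existence of generalised (multi-)solutions of open differential relations
(del Pino–Toussaint, Corollary 7.3), over the `n`-torus in standard coordinates. -/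
theorem generalised_solutions_of_open_relations
    (n ℓ r : ℕ) (hn : 1 ≤ n) (hℓ : 1 ≤ ℓ) (hr : 1 ≤ r)
    (R : Set (Vec n × ((i : Fin (r + 1)) → SymMap n ℓ i.1)))
    (hRopen : IsOpen R)
    (hRinv : ∀ (x : Vec n) (z : (i : Fin (r + 1)) → SymMap n ℓ i.1) (m : Fin n → ℤ),
      (x, z) ∈ R → (x + zcast m, z) ∈ R)
    -- a formal solution
    (σ : (i : ℕ) → Vec n → SymMap n ℓ i)
    (hσcont : ∀ i ≤ r, Continuous (σ i))
    (hσper : ∀ i ≤ r, ∀ (m : Fin n → ℤ) (p : Vec n), σ i (p + zcast m) = σ i p)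
    (hσsym : ∀ i ≤ r, ∀ p : Vec n, IsSymmMap (σ i p))
    (hσR : ∀ x : Vec n, (x, fun i : Fin (r + 1) => σ i.1 x) ∈ R) :
    -- a multi-solution
    ∃ (X : Vec n → Vec n) (ζ : (i : ℕ) → Vec n → SymMap n ℓ i),
      ContDiff ℝ (⊤ : ℕ∞) X ∧ (∀ i ≤ r, ContDiff ℝ (⊤ : ℕ∞) (ζ i)) ∧
      (∀ i ≤ r, ∀ p : Vec n, IsSymmMap (ζ i p)) ∧
      -- ℤⁿ-equivariance
      (∀ (m : Fin n → ℤ) (p : Vec n), X (p + zcast m) = X p + zcast m) ∧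
      (∀ i ≤ r, ∀ (m : Fin n → ℤ) (p : Vec n), ζ i (p + zcast m) = ζ i p) ∧
      -- integrality
      (∀ i < r, ∀ (p v : Vec n) (w : Fin i → Vec n),
        (fderiv ℝ (ζ i) p v) w = ζ (i + 1) p (Fin.cons (fderiv ℝ X p v) w)) ∧
      -- dense graphicality locus
      Dense {p : Vec n | Function.Bijective ⇑(fderiv ℝ X p)} ∧
      -- the front is injective modulo ℤⁿ
      (∀ (p q : Vec n) (m : Fin n → ℤ),
        X p = X q + zcast m → ζ 0 p = ζ 0 q → p = q + zcast m) ∧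
      -- it solves the relation
      (∀ p : Vec n, (X p, fun i : Fin (r + 1) => ζ i.1 p) ∈ R) := by
  obtain ⟨τ, hτ1, hτ2, hτ3, hτ4⟩ := smoothing hRopen hRinv σ hσcont hσper hσsym hσR
  set o : Fin n := ⟨0, hn⟩
  obtain ⟨Q, W, a, ha, hQ, hW, hQm, hWm, hWo, hgood⟩ := reduce_family
    (WS_all hRopen hRinv (base_family hRopen hRinv o τ hτ1 hτ2 hτ3 hτ4) (Finset.univ.erase o) (by simp))
  set U : Vec n → ℝ := fun x => x o - W x with hUdef
  have hU : ContDiff ℝ ∞ U := (contDiff_apply ℝ ℝ o).sub hW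
  have hUm : ∀ x (m : Fin n → ℤ), U (x + zcast m) = U x + m o := fun x m => by
    simp only [hUdef, hWm, Pi.add_apply, zcast]; ring
  obtain ⟨C, hC, hlip⟩ := lipschitz_family hQ hU.continuous hUm hQm (a := a)
  set e : Vec ℓ := fun _ => 1 with he
  set Fh : Vec n × (ℝ × ℝ) → Vec ℓ := fun z => Q (z.1, z.2.1) + z.2.2 • e with hFh
  have hFhC : ContDiff ℝ ∞ Fh := by
    refine ContDiff.add (hQ.comp (contDiff_fst.prodMk (contDiff_fst.comp contDiff_snd))) ((contDiff_snd.comp contDiff_snd).smul contDiff_const)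
  have hFhm : ∀ x β (m : Fin n → ℤ), Fh (x + zcast m, β + ((m o : ℝ), 0)) = Fh (x, β) := fun x β m => by
    simp only [hFh, Prod.fst_add, Prod.snd_add, hQm, add_zero]
  set G := LG r Fh U with hG
  have hGC : ContDiff ℝ ∞ G := contDiff_LG r hFhC hU
  -- the model tube
  set φ : Vec n × ℝ → Vec n × ((Fin (r + 1) → ℝ × ℝ) × ℝ) := fun y =>
    (y.1, (Pi.single 0 (U y.1 + y.2, 0), U y.1)) with hφ
  have hφC : Continuous φ := by
    have hUc := hU.continuous
    refine continuous_fst.prodMk (Continuous.prodMk ?_ (by fun_prop))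
    exact (continuous_single (A := fun _ : Fin (r + 1) => ℝ × ℝ) 0).comp (by fun_prop)
  have hKc : IsCompact (φ '' (Set.Icc 0 1 ×ˢ Set.Icc (-a) a)) := (isCompact_Icc.prod isCompact_Icc).image hφC
  obtain ⟨δ, hδ, ht⟩ := tube hKc (isOpen_good hRopen hGC) (by
    rintro _ ⟨⟨x, d⟩, ⟨_, hd⟩, rfl⟩
    have hg : Good R Q (x, U x + d) := hgood _ _ (by
      rw [show U x + d - (x o - W x) = d by simp only [hUdef]; ring]; exact abs_le.2 hd)
    refine hg.congr (G' := G) (Filter.Eventually.of_forall fun y => ?_)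
    simp [hG, LG, TP_single, hFh])
  obtain ⟨ξ, dξ, b, g, hξC, hbC, hgC, hξd, hbd, hgd, hξm, hb0m, hbm, hgm, hb0, hbs, hgs, hdense, hinj⟩ :=
    zigzag r hr C a (δ / 2) hC ha (half_pos hδ)
  set υ : Vec n → ℝ := fun p => ξ (p o) with hυ
  set X : Vec n → Vec n := fun p => Function.update p o (ξ (p o) + W p) with hX
  set η : Fin (r + 1) → Vec n → ℝ × ℝ := fun k p => (b k (p o), g k (p o)) with hη
  have hυC : ContDiff ℝ ∞ υ := hξC.comp (contDiff_apply ℝ ℝ o)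
  have hXC : ContDiff ℝ ∞ X := contDiff_update' o contDiff_id (hυC.add hW)
  have hηC : ∀ k, ContDiff ℝ ∞ (η k) := fun k =>
    ((hbC k).comp (contDiff_apply ℝ ℝ o)).prodMk ((hgC k).comp (contDiff_apply ℝ ℝ o))
  have hUX : ∀ p, U (X p) = υ p := fun p => by
    simp only [hUdef, hX, hWo, Function.update_self, hυ]; ring
  have hXm : ∀ (m : Fin n → ℤ) (p : Vec n), X (p + zcast m) = X p + zcast m := fun m p => by
    simp only [hX, hWm]
    rw [← update_add_zcast]
    congr 1
    have : (p + zcast m) o = p o + m o := rfl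
    rw [this, hξm]; ring
  set q : Vec n → (Fin (r + 1) → ℝ × ℝ) × ℝ := fun p => (fun k => η k p, υ p) with hq
  have hqC : ContDiff ℝ ∞ q := (contDiff_pi.2 hηC).prodMk hυC
  have hζm : ∀ i, ∀ (m : Fin n → ℤ) (p : Vec n), PJ G i (X (p + zcast m), q (p + zcast m)) = PJ G i (X p, q p) := by
    intro i m p
    rw [hXm]
    refine PJ_shift (fun y => ?_) i (X p)
    have ho : (p + zcast m) o = p o + m o := rfl
    have h1 : (fun k => η k (p + zcast m)) = (fun k => η k p) +
        (Pi.single 0 ((m o : ℝ), (0 : ℝ)) : Fin (r + 1) → ℝ × ℝ) := by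
      funext k
      refine Fin.cases ?_ (fun k => ?_) k
      · simp [hη, ho, hb0m, hgm]
      · simp [hη, ho, hbm, hgm]
    simp only [hG, LG, hq, h1, TP_add, TP_single, hUm, hυ, ho, hξm]
    rw [add_sub_add_right_eq_sub, hFhm]
  have hR0 : ∀ p, X p ∈ Set.Icc (0 : Vec n) 1 → Good R G (X p, q p) := by
    intro p hp
    have hU' := hUX p
    have hb := hb0 (p o)
    refine ht (φ (X p, b 0 (p o) - ξ (p o))) ⟨_, ⟨hp, abs_le.1 hb⟩, rfl⟩ _ ?_
    simp only [hφ, hq, hU']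
    have hle : dist (fun k => η k p) (Pi.single 0 (υ p + (b 0 (p o) - ξ (p o)), 0) : Fin (r + 1) → ℝ × ℝ) ≤ δ / 2 := by
      refine (dist_pi_le_iff (by positivity)).2 fun k => ?_
      refine Fin.cases ?_ (fun k => ?_) k
      · have := hgs 0 (Nat.zero_le _) (p o)
        simp only [hη, hυ, Pi.single_eq_same, Prod.dist_eq, Real.dist_eq, Fin.val_zero, sub_zero]
        refine max_le ?_ this
        rw [show b 0 (p o) - (ξ (p o) + (b 0 (p o) - ξ (p o))) = 0 by ring, abs_zero]; positivity
      · rw [Pi.single_eq_of_ne (Fin.succ_ne_zero k)]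
        simp only [hη, Prod.dist_eq, Real.dist_eq, Fin.val_succ, Prod.fst_zero, Prod.snd_zero, sub_zero]
        exact max_le (hbs k.1 k.2 _) (hgs (k.1 + 1) k.2 _)
    rw [Prod.dist_eq, Prod.dist_eq, dist_self, dist_self]
    rw [max_eq_left dist_nonneg, max_eq_right dist_nonneg]
    linarith
  refine ⟨X, fun i p => PJ G i (X p, q p), hXC, ?_, ?_, hXm, fun i _ => hζm i, ?_, ?_, ?_, ?_⟩
  · intro i _
    exact (contDiff_PJ hGC i).comp (hXC.prodMk hqC)
  · intro i _ p e' v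
    exact iteratedFDeriv_perm (contDiff_slice hGC (q p)) i (X p) e' v
  · intro i hi p v w
    refine LG_integral r hFhC hU hXC hηC hυC hUX ?_ i hi p v w
    intro k p v
    have hpr : HasFDerivAt (fun p : Vec n => p o) (ContinuousLinearMap.proj (R := ℝ) (φ := fun _ : Fin n => ℝ) o) p :=
      (ContinuousLinearMap.proj (R := ℝ) (φ := fun _ : Fin n => ℝ) o).hasFDerivAt
    have h1 := (hξd (p o)).comp_hasFDerivAt p hpr
    have h2 := ((hbd k.1 k.2 (p o)).comp_hasFDerivAt p hpr).prodMk ((hgd k.1 k.2 (p o)).comp_hasFDerivAt p hpr)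
    have e1 : fderiv ℝ υ p = _ := h1.fderiv
    have e2 : fderiv ℝ (η k.castSucc) p = _ := h2.fderiv
    rw [e1, e2]
    simp [hη]
    constructor <;> ring
  · have hd : Dense ((fun p : Vec n => p o) ⁻¹' {t | dξ t ≠ 0}) := hdense.preimage (isOpenMap_eval o)
    refine hd.mono fun p hp => ?_
    have hp' : dξ (p o) ≠ 0 := hp
    have hinj : Function.Injective (fderiv ℝ X p) := by
      refine (injective_iff_map_eq_zero _).2 fun v hv => ?_
      have hcomp : ∀ i, fderiv ℝ (fun p => X p i) p v = 0 := fun i => by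
        rw [fderiv_apply (hXC.differentiable (by simp) p)]
        simp [hv]
      have hvi : ∀ i, i ≠ o → v i = 0 := fun i hi => by
        have h1 := hcomp i
        have : (fun p => X p i) = fun p : Vec n => p i := by
          funext p; simp [hX, Function.update_of_ne hi]
        rw [this] at h1
        have h2 : fderiv ℝ (fun p : Vec n => p i) p = _ :=
          ((ContinuousLinearMap.proj (R := ℝ) (φ := fun _ : Fin n => ℝ) i).hasFDerivAt (x := p)).fderiv
        rw [h2] at h1
        exact h1
      have hvs : v = Pi.single o (v o) := by
        funext i
        by_cases hi : i = o
        · subst hi; simp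
        · simp [hvi i hi, hi]
      have hWv : fderiv ℝ W p v = 0 := by
        have hWd := (hW.differentiable (by simp) p).hasFDerivAt.hasLineDerivAt v
        have hc : HasLineDerivAt ℝ W 0 p v := by
          have : (fun t : ℝ => W (p + t • v)) = fun _ => W p := by
            funext t
            have : p + t • v = Function.update p o (p o + t * v o) := by
              funext i
              by_cases hi : i = o
              · subst hi; simp
              · simp [hvi i hi, hi]
            rw [this, hWo]
          rw [HasLineDerivAt, this]
          exact hasDerivAt_const _ _
        exact hWd.unique hc
      have hpr : HasFDerivAt (fun p : Vec n => p o) (ContinuousLinearMap.proj (R := ℝ) (φ := fun _ : Fin n => ℝ) o) p :=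
        (ContinuousLinearMap.proj (R := ℝ) (φ := fun _ : Fin n => ℝ) o).hasFDerivAt
      have h1 := ((hξd (p o)).comp_hasFDerivAt p hpr).add (hW.differentiable (by simp) p).hasFDerivAt
      have h2 := hcomp o
      have : (fun p => X p o) = fun p : Vec n => ξ (p o) + W p := by
        funext p; simp [hX]
      rw [this] at h2
      have e1 : fderiv ℝ (fun p : Vec n => ξ (p o) + W p) p = _ := h1.fderiv
      rw [e1] at h2
      simp [hWv, hp'] at h2
      rw [hvs, h2]; simp
    exact ⟨hinj, (LinearMap.injective_iff_surjective (f := (fderiv ℝ X p).toLinearMap)).1 hinj⟩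
  · intro p q0 m hXe hζe
    have hζ0 : ∀ p, PJ G 0 (X p, q p) = (continuousMultilinearCurryFin0 ℝ (Vec n) (Vec ℓ)).symm
        (Q (X p, b 0 (p o)) + g 0 (p o) • e) := by
      intro p
      ext1 v
      simp only [PJ, iteratedFDeriv_zero_apply, continuousMultilinearCurryFin0_symm_apply]
      simp only [hG, LG, hq, hUX, sub_self, TP_zero, hFh, hη, Fin.val_zero]
      rfl
    rw [← hXm] at hXe
    have hζe' : PJ G 0 (X p, q p) = PJ G 0 (X (q0 + zcast m), q (q0 + zcast m)) := by
      rw [hζm]; exact hζe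
    generalize q0 + zcast m = y at hXe hζe'
    have hoth : ∀ i, i ≠ o → p i = y i := fun i hi => by
      have := congrFun hXe i
      simpa [hX, Function.update_of_ne hi] using this
    have hWe : W p = W y := by
      rw [← hWo p (y o)]
      congr 1
      funext i
      by_cases hi : i = o
      · subst hi; simp
      · rw [Function.update_of_ne hi, hoth i hi]
    have hξe : ξ (p o) = ξ (y o) := by
      have := congrFun hXe o
      simp only [hX, Function.update_self, hWe] at this
      linarith
    rw [hζ0, hζ0] at hζe'
    have hfr := (continuousMultilinearCurryFin0 ℝ (Vec n) (Vec ℓ)).symm.injective hζe'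
    rw [← hXe] at hfr
    have ht0 : p o = y o := by
      refine hinj _ _ hξe ?_
      have hU' : U (X p) = ξ (p o) := hUX p
      have h1 := hlip (X p) (b 0 (p o)) (b 0 (y o)) (by rw [hU']; exact hb0 _) (by rw [hU', hξe]; exact hb0 _)
      have h2 := norm_le_pi_norm (Q (X p, b 0 (p o)) - Q (X p, b 0 (y o))) (⟨0, hℓ⟩ : Fin ℓ)
      have h3 := congrFun hfr (⟨0, hℓ⟩ : Fin ℓ)
      simp only [Pi.add_apply, Pi.smul_apply, smul_eq_mul, he, mul_one] at h3
      rw [Pi.sub_apply, Real.norm_eq_abs] at h2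
      refine le_trans (le_of_eq ?_) (h2.trans h1)
      rw [show g 0 (p o) - g 0 (y o) = -(Q (X p, b 0 (p o)) ⟨0, hℓ⟩ - Q (X p, b 0 (y o)) ⟨0, hℓ⟩) by linarith, abs_neg]
    funext i
    by_cases hi : i = o
    · rw [hi]; exact ht0
    · exact hoth i hi
  · intro p
    obtain ⟨m, hm⟩ := reduce_cube (X p)
    have h1 := hR0 (p + zcast m) (by rwa [hXm])
    have h2 := hRinv _ _ (-m) h1
    simp only [hζm] at h2
    simp only [hXm, zcast_neg, add_neg_cancel_right] at h2
    exact h2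
end
end

section
/- (Integral lifts of exact isotropic maps; Proposition 5.6 of del Pino–Toussaint, in standard coordinates.) Fix integers m ≥ 1, n ≥ 1, ℓ ≥ 1, r ≥ 1. Let N ⊆ ℝ^m be a nonempty convex open set, let x : N → ℝⁿ and ξ : N → Sym^r(ℝⁿ,ℝ^ℓ) be smooth, and assume the isotropy condition: for every p ∈ N and all v, w ∈ ℝ^m, the symmetric (r−1)-linear maps (u₂,…,u_r) ↦ (fderiv ℝ ξ p v)(fderiv ℝ x p w, u₂,…,u_r) and (u₂,…,u_r) ↦ (fderiv ℝ ξ p w)(fderiv ℝ x p v, u₂,…,u_r) coincide (i.e. the pullback of the standard metasymplectic form Ω_can by (x, ξ) vanishes). Fix a point p₀ ∈ N and elements c_i ∈ Sym^i(ℝⁿ,ℝ^ℓ) for 0 ≤ i ≤ r−1. Then there exist smooth maps ζ_i : N → Sym^i(ℝⁿ,ℝ^ℓ), 0 ≤ i ≤ r, with ζ_r = ξ, such that the tuple (x, ζ_0,…,ζ_r) is integral and ζ_i(p₀) = c_i for all 0 ≤ i ≤ r−1; moreover this tuple is unique: any two integral tuples with base component x, top component ξ, and the same values at p₀ agree on N.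 -/
/- `ℝⁿ` in standard coordinates. -/
noncomputable section

/-- Extending a permutation of `Fin i` to `Fin (i+1)` by fixing `0`. -/
theorem symm_cons_perm {n ℓ i : ℕ} {A : SymMap n ℓ (i + 1)} (hA : IsSymmMap A)
    (e : Equiv.Perm (Fin i)) (a : Vec n) (u : Fin i → Vec n) :
    A (Fin.cons a (u ∘ e)) = A (Fin.cons a u) := by
  have h := hA (Equiv.Perm.decomposeFin.symm (0, e)) (Fin.cons a u)
  rw [← h]
  congr 1
  funext j
  refine Fin.cases ?_ (fun j => ?_) j
  · simp
  · simp

/-- Swapping the first two arguments of a symmetric map. -/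
theorem symm_cons_swap {n ℓ i : ℕ} {A : SymMap n ℓ (i + 2)} (hA : IsSymmMap A)
    (a b : Vec n) (u : Fin i → Vec n) :
    A (Fin.cons a (Fin.cons b u)) = A (Fin.cons b (Fin.cons a u)) := by
  have h := hA (Equiv.swap 0 1) (Fin.cons a (Fin.cons b u))
  rw [← h]
  congr 1
  funext j
  refine Fin.cases ?_ (fun j => Fin.cases ?_ (fun j => ?_) j) j
  · simp only [Function.comp, Equiv.swap_apply_left]; rfl
  · have : (Fin.succ 0 : Fin (i + 2)) = 1 := rfl
    simp only [Function.comp, this, Equiv.swap_apply_right]; rfl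
  · rw [Function.comp, Equiv.swap_apply_of_ne_of_ne]
    · rfl
    · exact Fin.succ_ne_zero _
    · intro h
      exact Fin.succ_ne_zero j (Fin.succ_injective _ h)

/-- Poincaré lemma for forms `L(A) ∘ dx`, in abstract normed spaces. -/
theorem poincare_aux {V X S T : Type*} [NormedAddCommGroup V] [NormedSpace ℝ V]
    [NormedAddCommGroup X] [NormedSpace ℝ X] [NormedAddCommGroup S] [NormedSpace ℝ S]
    [NormedAddCommGroup T] [NormedSpace ℝ T] [CompleteSpace T]
    {N : Set V} (hNopen : IsOpen N) (hNconv : Convex ℝ N)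
    {x : V → X} (hx : ContDiffOn ℝ (⊤ : ℕ∞) x N) (L : S →L[ℝ] X →L[ℝ] T)
    {A : V → S} (hA : ContDiffOn ℝ (⊤ : ℕ∞) A N)
    (hiso : ∀ p ∈ N, ∀ v w : V,
      L (fderiv ℝ A p v) (fderiv ℝ x p w) = L (fderiv ℝ A p w) (fderiv ℝ x p v))
    {p₀ : V} (c : T) :
    ∃ B : V → T, ContDiffOn ℝ (⊤ : ℕ∞) B N ∧ B p₀ = c ∧
      ∀ p ∈ N, HasFDerivAt B ((L (A p)).comp (fderiv ℝ x p)) p := by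
  let ω : V → V →L[ℝ] T := fun p => (L (A p)).comp (fderiv ℝ x p)
  have hdx : ContDiffOn ℝ (⊤ : ℕ∞) (fderiv ℝ x) N :=
    ((contDiffOn_infty_iff_fderiv_of_isOpen hNopen).1 hx).2
  have hLA : ContDiffOn ℝ (⊤ : ℕ∞) (fun p => L (A p)) N := L.contDiff.comp_contDiffOn hA
  have hω : ContDiffOn ℝ (⊤ : ℕ∞) ω N := hLA.clm_comp hdx
  have hdiff : ∀ p ∈ N, DifferentiableAt ℝ A p := fun p hp =>
    (hA.differentiableOn (by simp)).differentiableAt (hNopen.mem_nhds hp)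
  have hsymω : ∀ p ∈ N, ∀ v w, fderiv ℝ ω p v w = fderiv ℝ ω p w v := by
    intro p hp v w
    have h1 : HasFDerivAt (fun p => L (A p)) (L.comp (fderiv ℝ A p)) p :=
      L.hasFDerivAt.comp p (hdiff p hp).hasFDerivAt
    have h2 : HasFDerivAt (fderiv ℝ x) (fderiv ℝ (fderiv ℝ x) p) p :=
      ((hdx.differentiableOn (by simp)).differentiableAt (hNopen.mem_nhds hp)).hasFDerivAt
    have h3 := (h1.clm_comp h2).fderiv
    have h4 : IsSymmSndFDerivAt ℝ x p :=
      (hx.contDiffAt (hNopen.mem_nhds hp)).isSymmSndFDerivAt (by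
        rw [minSmoothness_of_isRCLikeNormedField]; 
        exact WithTop.coe_le_coe.2 (le_top : (2 : ℕ∞) ≤ ⊤))
    have h5 : fderiv ℝ ω p = _ := h3
    rw [h5]
    simp [h4.eq v w, hiso p hp v w]
  obtain ⟨f, hf⟩ := hNconv.exists_forall_hasFDerivAt_of_fderiv_symmetric hNopen
    (hω.differentiableOn (by simp)) hsymω
  have hB : ∀ p ∈ N, HasFDerivAt (fun p => f p + (c - f p₀)) (ω p) p := fun p hp =>
    (hf p hp).add_const _
  refine ⟨fun p => f p + (c - f p₀), ?_, by simp, hB⟩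
  refine (contDiffOn_infty_iff_fderiv_of_isOpen hNopen).2
    ⟨fun p hp => (hB p hp).differentiableAt.differentiableWithinAt, ?_⟩
  exact hω.congr fun p hp => (hB p hp).fderiv

/-- Two continuous linear images of a map agree if their derivatives agree. -/
theorem eq_aux {V T U : Type*} [NormedAddCommGroup V] [NormedSpace ℝ V]
    [NormedAddCommGroup T] [NormedSpace ℝ T] [NormedAddCommGroup U] [NormedSpace ℝ U]
    {N : Set V} (hNopen : IsOpen N) (hNconv : Convex ℝ N) {B : V → T} {ω : V → V →L[ℝ] T}
    (hB : ∀ p ∈ N, HasFDerivAt B (ω p) p) (a b : T →L[ℝ] U)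
    (hab : ∀ p ∈ N, ∀ v, a (ω p v) = b (ω p v)) {p₀ : V} (hp₀ : p₀ ∈ N)
    (h0 : a (B p₀) = b (B p₀)) : ∀ p ∈ N, a (B p) = b (B p) := by
  have ha : ∀ p ∈ N, HasFDerivAt (fun p => a (B p)) (a.comp (ω p)) p := fun p hp =>
    a.hasFDerivAt.comp p (hB p hp)
  have hb : ∀ p ∈ N, HasFDerivAt (fun p => b (B p)) (b.comp (ω p)) p := fun p hp =>
    b.hasFDerivAt.comp p (hB p hp)
  intro p hp
  refine hNopen.eqOn_of_fderiv_eq (𝕜 := ℝ) hNconv.isPreconnected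
    (fun p hp => (ha p hp).differentiableAt.differentiableWithinAt)
    (fun p hp => (hb p hp).differentiableAt.differentiableWithinAt) ?_ hp₀ h0 hp
  intro q hq
  rw [(ha q hq).fderiv, (hb q hq).fderiv]
  ext1 v
  exact hab q hq v

/-- One integration step, by the Poincaré lemma. -/
theorem lift_step {m n ℓ i : ℕ} {N : Set (Vec m)} (hNopen : IsOpen N) (hNconv : Convex ℝ N)
    {x : Vec m → Vec n} (hx : ContDiffOn ℝ (⊤ : ℕ∞) x N)
    {A : Vec m → SymMap n ℓ (i + 1)} (hA : ContDiffOn ℝ (⊤ : ℕ∞) A N)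
    (hsym : ∀ p ∈ N, IsSymmMap (A p))
    (hiso : ∀ p ∈ N, ∀ (v w : Vec m) (u : Fin i → Vec n),
      (fderiv ℝ A p v) (Fin.cons (fderiv ℝ x p w) u)
        = (fderiv ℝ A p w) (Fin.cons (fderiv ℝ x p v) u))
    {p₀ : Vec m} (hp₀ : p₀ ∈ N) (c : SymMap n ℓ i) (hc : IsSymmMap c) :
    ∃ B : Vec m → SymMap n ℓ i, ContDiffOn ℝ (⊤ : ℕ∞) B N ∧ (∀ p ∈ N, IsSymmMap (B p)) ∧
      B p₀ = c ∧ ∀ p ∈ N, ∀ (v : Vec m) (u : Fin i → Vec n),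
        (fderiv ℝ B p v) u = A p (Fin.cons (fderiv ℝ x p v) u) := by
  obtain ⟨B, h1, h2, h3⟩ := poincare_aux hNopen hNconv hx
    (continuousMultilinearCurryLeftEquiv ℝ (fun _ : Fin (i + 1) => Vec n)
      (Vec ℓ)).toContinuousLinearEquiv.toContinuousLinearMap hA
    (by
      intro p hp v w
      ext1 u
      exact hiso p hp v w u) (p₀ := p₀) c
  refine ⟨B, h1, ?_, h2, ?_⟩
  · intro p hp e u
    refine eq_aux hNopen hNconv h3
      (ContinuousMultilinearMap.apply ℝ (fun _ : Fin i => Vec n) (Vec ℓ) (u ∘ e))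
      (ContinuousMultilinearMap.apply ℝ (fun _ : Fin i => Vec n) (Vec ℓ) u) ?_ hp₀ ?_ p hp
    · intro q hq v
      exact symm_cons_perm (hsym q hq) e _ u
    · rw [h2]
      exact hc e u
  · intro p hp v u
    rw [(h3 p hp).fderiv]
    rfl

/-- Iterating the step downwards. -/
theorem lift_all {m n ℓ : ℕ} {N : Set (Vec m)} (hNopen : IsOpen N) (hNconv : Convex ℝ N)
    {x : Vec m → Vec n} (hx : ContDiffOn ℝ (⊤ : ℕ∞) x N)
    {p₀ : Vec m} (hp₀ : p₀ ∈ N) (c : (i : ℕ) → SymMap n ℓ i) (k : ℕ)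
    (hc : ∀ i < k, IsSymmMap (c i))
    (B : Vec m → SymMap n ℓ k) (hB : ContDiffOn ℝ (⊤ : ℕ∞) B N)
    (hsym : ∀ p ∈ N, IsSymmMap (B p))
    (A : Vec m → SymMap n ℓ (k + 1)) (hAsym : ∀ p ∈ N, IsSymmMap (A p))
    (hAB : ∀ p ∈ N, ∀ (v : Vec m) (u : Fin k → Vec n),
      (fderiv ℝ B p v) u = A p (Fin.cons (fderiv ℝ x p v) u)) :
    ∃ ζ : (i : ℕ) → Vec m → SymMap n ℓ i,
      (∀ i ≤ k, ContDiffOn ℝ (⊤ : ℕ∞) (ζ i) N) ∧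
      (∀ i ≤ k, ∀ p ∈ N, IsSymmMap (ζ i p)) ∧
      ζ k = B ∧
      (∀ i < k, ∀ p ∈ N, ∀ (v : Vec m) (w : Fin i → Vec n),
        (fderiv ℝ (ζ i) p v) w = ζ (i + 1) p (Fin.cons (fderiv ℝ x p v) w)) ∧
      (∀ i < k, ζ i p₀ = c i) := by
  induction k with
  | zero =>
    refine ⟨Function.update (fun _ _ => 0) 0 B, ?_, ?_, by simp, by simp, by simp⟩
    · intro i hi
      obtain rfl : i = 0 := by omega
      simpa using hB
    · intro i hi
      obtain rfl : i = 0 := by omega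
      simpa using hsym
  | succ k ih =>
    obtain ⟨C, hC, hCsym, hC0, hCB⟩ := lift_step hNopen hNconv hx hB hsym (by
      intro p hp v w u
      rw [hAB p hp, hAB p hp, symm_cons_swap (hAsym p hp)]) hp₀ (c k) (hc k (by omega))
    obtain ⟨ζ, h1, h2, h3, h4, h5⟩ := ih (fun i hi => hc i (by omega)) C hC hCsym B hsym hCB
    refine ⟨Function.update ζ (k + 1) B, ?_, ?_, by simp, ?_, ?_⟩
    · intro i hi
      rcases Nat.lt_or_ge k i with h | h
      · obtain rfl : i = k + 1 := by omega
        simpa using hB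
      · rw [Function.update_of_ne (by omega)]; exact h1 i h
    · intro i hi
      rcases Nat.lt_or_ge k i with h | h
      · obtain rfl : i = k + 1 := by omega
        simpa using hsym
      · rw [Function.update_of_ne (by omega)]; exact h2 i h
    · intro i hi
      rw [Function.update_of_ne (by omega)]
      rcases Nat.lt_or_ge i k with h | h
      · rw [Function.update_of_ne (by omega)]; exact h4 i h
      · obtain rfl : i = k := by omega
        rw [Function.update_self, h3]; exact hCB
    · intro i hi
      rw [Function.update_of_ne (by omega)]
      rcases Nat.lt_or_ge i k with h | h
      · exact h5 i h
      · obtain rfl : i = k := by omega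
        rw [h3]; exact hC0

/-- Integral lifts of exact isotropic maps (del Pino–Toussaint, Proposition 5.6),
in standard coordinates. Here `r = r' + 1 ≥ 1`. -/
theorem integral_lift_of_exact_isotropic
    (m n ℓ r' : ℕ) (hm : 1 ≤ m) (hn : 1 ≤ n) (hℓ : 1 ≤ ℓ)
    (N : Set (Vec m)) (hNopen : IsOpen N) (hNconv : Convex ℝ N) (hNne : N.Nonempty)
    (x : Vec m → Vec n) (ξ : Vec m → SymMap n ℓ (r' + 1))
    (hx : ContDiffOn ℝ (⊤ : ℕ∞) x N) (hξ : ContDiffOn ℝ (⊤ : ℕ∞) ξ N)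
    (hξsym : ∀ p ∈ N, IsSymmMap (ξ p))
    -- the isotropy condition: the pullback of `Ω_can` by `(x, ξ)` vanishes
    (hiso : ∀ p ∈ N, ∀ (v w : Vec m) (u : Fin r' → Vec n),
      (fderiv ℝ ξ p v) (Fin.cons (fderiv ℝ x p w) u)
        = (fderiv ℝ ξ p w) (Fin.cons (fderiv ℝ x p v) u))
    (p₀ : Vec m) (hp₀ : p₀ ∈ N)
    (c : (i : ℕ) → SymMap n ℓ i) (hc : ∀ i < r' + 1, IsSymmMap (c i)) :
    ∃ ζ : (i : ℕ) → Vec m → SymMap n ℓ i,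
      (∀ i ≤ r' + 1, ContDiffOn ℝ (⊤ : ℕ∞) (ζ i) N) ∧
      (∀ i ≤ r' + 1, ∀ p ∈ N, IsSymmMap (ζ i p)) ∧
      -- top component is ξ
      Set.EqOn (ζ (r' + 1)) ξ N ∧
      -- the tuple (x, ζ_0, …, ζ_{r'+1}) is integral
      (∀ i < r' + 1, ∀ p ∈ N, ∀ (v : Vec m) (w : Fin i → Vec n),
        (fderiv ℝ (ζ i) p v) w = ζ (i + 1) p (Fin.cons (fderiv ℝ x p v) w)) ∧
      -- prescribed initial values
      (∀ i < r' + 1, ζ i p₀ = c i) ∧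
      -- uniqueness
      (∀ ζ' : (i : ℕ) → Vec m → SymMap n ℓ i,
        (∀ i ≤ r' + 1, ContDiffOn ℝ (⊤ : ℕ∞) (ζ' i) N) →
        (∀ i ≤ r' + 1, ∀ p ∈ N, IsSymmMap (ζ' i p)) →
        Set.EqOn (ζ' (r' + 1)) ξ N →
        (∀ i < r' + 1, ∀ p ∈ N, ∀ (v : Vec m) (w : Fin i → Vec n),
          (fderiv ℝ (ζ' i) p v) w = ζ' (i + 1) p (Fin.cons (fderiv ℝ x p v) w)) →
        (∀ i < r' + 1, ζ' i p₀ = c i) →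
        ∀ i ≤ r' + 1, Set.EqOn (ζ' i) (ζ i) N) := by
  obtain ⟨C, hC, hCsym, hC0, hCB⟩ := lift_step hNopen hNconv hx hξ hξsym hiso hp₀ (c r')
    (hc r' (by omega))
  obtain ⟨ζ, h1, h2, h3, h4, h5⟩ := lift_all hNopen hNconv hx hp₀ c r'
    (fun i hi => hc i (by omega)) C hC hCsym ξ hξsym hCB
  have ex : ∃ ζ : (i : ℕ) → Vec m → SymMap n ℓ i,
      (∀ i ≤ r' + 1, ContDiffOn ℝ (⊤ : ℕ∞) (ζ i) N) ∧
      (∀ i ≤ r' + 1, ∀ p ∈ N, IsSymmMap (ζ i p)) ∧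
      Set.EqOn (ζ (r' + 1)) ξ N ∧
      (∀ i < r' + 1, ∀ p ∈ N, ∀ (v : Vec m) (w : Fin i → Vec n),
        (fderiv ℝ (ζ i) p v) w = ζ (i + 1) p (Fin.cons (fderiv ℝ x p v) w)) ∧
      (∀ i < r' + 1, ζ i p₀ = c i) := by
    refine ⟨Function.update ζ (r' + 1) ξ, ?_, ?_, ?_, ?_, ?_⟩
    · intro i hi
      rcases Nat.lt_or_ge r' i with h | h
      · obtain rfl : i = r' + 1 := by omega
        simpa using hξ
      · rw [Function.update_of_ne (by omega)]; exact h1 i h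
    · intro i hi
      rcases Nat.lt_or_ge r' i with h | h
      · obtain rfl : i = r' + 1 := by omega
        simpa using hξsym
      · rw [Function.update_of_ne (by omega)]; exact h2 i h
    · rw [Function.update_self]; exact Set.eqOn_refl _ _
    · intro i hi
      rw [Function.update_of_ne (by omega)]
      rcases Nat.lt_or_ge i r' with h | h
      · rw [Function.update_of_ne (by omega)]; exact h4 i h
      · obtain rfl : i = r' := by omega
        rw [Function.update_self, h3]; exact hCB
    · intro i hi
      rw [Function.update_of_ne (by omega)]
      rcases Nat.lt_or_ge i r' with h | h
      · exact h5 i h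
      · obtain rfl : i = r' := by omega
        rw [h3]; exact hC0
  clear h1 h2 h3 h4 h5 ζ
  obtain ⟨ζ, h1, h2, h3, h4, h5⟩ := ex
  refine ⟨ζ, h1, h2, h3, h4, h5, ?_⟩
  intro ζ' g1 _ g3 g4 g5
  have key : ∀ j i, i + j = r' + 1 → Set.EqOn (ζ' i) (ζ i) N := by
    intro j
    induction j with
    | zero =>
      intro i hi
      obtain rfl : i = r' + 1 := by omega
      exact g3.trans h3.symm
    | succ j ih =>
      intro i hi
      refine hNopen.eqOn_of_fderiv_eq (𝕜 := ℝ) hNconv.isPreconnected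
        ((g1 i (by omega)).differentiableOn (by simp))
        ((h1 i (by omega)).differentiableOn (by simp)) ?_ hp₀
        ((g5 i (by omega)).trans (h5 i (by omega)).symm)
      intro p hp
      ext1 v
      ext1 w
      rw [g4 i (by omega) p hp, h4 i (by omega) p hp, ih (i + 1) (by omega) hp]
  intro i hi
  exact key (r' + 1 - i) i (by omega)
end
end

section
/- (Integral maps project to isotropic maps; the key step of Corollary 5.5(1) and of the inductive closedness check in Proposition 5.6 of del Pino–Toussaint.) Let N be an open subset of a real normed vector space, and let B and W be real normed vector spaces. Let u : N → B and ζ : N → W be twice continuously differentiable, and let ξ : N → (B →L[ℝ] W) be continuously differentiable, and assume the integrality relation fderiv ℝ ζ p = (ξ p) ∘ (fderiv ℝ u p) for every p ∈ N. Then for every p ∈ N and all tangent vectors v, w: (fderiv ℝ ξ p v)(fderiv ℝ u p w) = (fderiv ℝ ξ p w)(fderiv ℝ u p v). (Equivalently, the pullback by (u, ξ) of the contraction 2-form (v₀+A₀, v₁+A₁) ↦ A₁(v₀) − A₀(v₁) vanishes identically.) -/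
/-- Integral maps project to isotropic maps (the key step of Corollary 5.5(1) and of the
inductive closedness check in Proposition 5.6 of del Pino–Toussaint). -/
theorem integral_maps_project_to_isotropic
    {E B W : Type*} [NormedAddCommGroup E] [NormedSpace ℝ E]
    [NormedAddCommGroup B] [NormedSpace ℝ B]
    [NormedAddCommGroup W] [NormedSpace ℝ W]
    (N : Set E) (hN : IsOpen N)
    (u : E → B) (ζ : E → W) (ξ : E → (B →L[ℝ] W))
    (hu : ContDiffOn ℝ 2 u N) (hζ : ContDiffOn ℝ 2 ζ N) (hξ : ContDiffOn ℝ 1 ξ N)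
    -- the integrality relation
    (hint : ∀ p ∈ N, fderiv ℝ ζ p = (ξ p).comp (fderiv ℝ u p)) :
    ∀ p ∈ N, ∀ v w : E,
      (fderiv ℝ ξ p v) (fderiv ℝ u p w) = (fderiv ℝ ξ p w) (fderiv ℝ u p v) := by
  intro p hp v w
  have hNp : N ∈ nhds p := hN.mem_nhds hp
  have hup : ContDiffAt ℝ 2 u p := hu.contDiffAt hNp
  have hξd : HasFDerivAt ξ (fderiv ℝ ξ p) p :=
    ((hξ.contDiffAt hNp).differentiableAt (by norm_num)).hasFDerivAt
  have hud : HasFDerivAt (fderiv ℝ u) (fderiv ℝ (fderiv ℝ u) p) p :=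
    ((hup.fderiv_right (m := 1) (by norm_num)).differentiableAt (by norm_num)).hasFDerivAt
  have hev : ∀ᶠ y in nhds p, HasFDerivAt ζ ((ξ y).comp (fderiv ℝ u y)) y := by
    filter_upwards [hNp] with y hy
    rw [← hint y hy]
    exact ((hζ.contDiffAt (hN.mem_nhds hy)).differentiableAt (by norm_num)).hasFDerivAt
  have hevu : ∀ᶠ y in nhds p, HasFDerivAt u (fderiv ℝ u y) y := by
    filter_upwards [hNp] with y hy
    exact ((hu.contDiffAt (hN.mem_nhds hy)).differentiableAt (by norm_num)).hasFDerivAt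
  have h1 := second_derivative_symmetric_of_eventually hev (hξd.clm_comp hud) v w
  have h2 := second_derivative_symmetric_of_eventually hevu hud v w
  simpa [h2] using h1
end

section
/- (Integral maps are immersed exactly where their metasymplectic projections are; Corollary 5.5(2) of del Pino–Toussaint, in standard coordinates.) Fix integers m ≥ 1, n ≥ 1, ℓ ≥ 1, r ≥ 1. Let N ⊆ ℝ^m be open and let (X, ζ_0,…,ζ_r) be an integral r-jet tuple on N. Then for every p ∈ N and every v ∈ ℝ^m: if fderiv ℝ X p v = 0 and fderiv ℝ ζ_r p v = 0, then fderiv ℝ ζ_i p v = 0 for all 0 ≤ i ≤ r. Consequently, for every p ∈ N, the linear map v ↦ (fderiv ℝ X p v, fderiv ℝ ζ_0 p v, …, fderiv ℝ ζ_r p v) is injective if and only if the linear map v ↦ (fderiv ℝ X p v, fderiv ℝ ζ_r p v) is injective; i.e. the integral map is an immersion at p if and only if its metasymplectic projection (X, ζ_r) is an immersion at p. -/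
/- `ℝⁿ` in standard coordinates. -/
noncomputable section

/-- Integral maps are immersed exactly where their metasymplectic projections are
(del Pino–Toussaint, Corollary 5.5(2)), in standard coordinates. -/
theorem integral_immersion_iff_metasymplectic_immersion
    (m n ℓ r : ℕ) (hm : 1 ≤ m) (hn : 1 ≤ n) (hℓ : 1 ≤ ℓ) (hr : 1 ≤ r)
    (N : Set (Vec m)) (hN : IsOpen N)
    (X : Vec m → Vec n) (ζ : (i : ℕ) → Vec m → SymMap n ℓ i)
    (hX : ContDiffOn ℝ (⊤ : ℕ∞) X N)
    (hζ : ∀ i ≤ r, ContDiffOn ℝ (⊤ : ℕ∞) (ζ i) N)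
    (hsym : ∀ i ≤ r, ∀ p ∈ N, IsSymmMap (ζ i p))
    -- integrality
    (hint : ∀ i < r, ∀ p ∈ N, ∀ (v : Vec m) (w : Fin i → Vec n),
      (fderiv ℝ (ζ i) p v) w = ζ (i + 1) p (Fin.cons (fderiv ℝ X p v) w)) :
    ∀ p ∈ N,
      -- kernels agree
      (∀ v : Vec m, fderiv ℝ X p v = 0 → fderiv ℝ (ζ r) p v = 0 →
        ∀ i ≤ r, fderiv ℝ (ζ i) p v = 0) ∧
      -- immersion iff the metasymplectic projection is an immersion
      (Function.Injective (fun v : Vec m =>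
          (fderiv ℝ X p v, fun i : Fin (r + 1) => fderiv ℝ (ζ i.1) p v))
        ↔ Function.Injective (fun v : Vec m => (fderiv ℝ X p v, fderiv ℝ (ζ r) p v))) := by
  intro p hp
  have key : ∀ v : Vec m, fderiv ℝ X p v = 0 → fderiv ℝ (ζ r) p v = 0 →
      ∀ i ≤ r, fderiv ℝ (ζ i) p v = 0 := by
    intro v h0 h1 i hi
    rcases hi.lt_or_eq with h | h
    · ext1 w
      rw [hint i h p hp v w, h0]
      exact (ζ (i + 1) p).map_coord_zero 0 rfl
    · subst h
      exact h1
  refine ⟨key, ?_, ?_⟩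
  · intro h a b hab
    have h1 := congrArg Prod.fst hab
    have h2 := congrArg Prod.snd hab
    dsimp only at h1 h2
    have hk := key (a - b) (by rw [map_sub, h1, sub_self]) (by rw [map_sub, h2, sub_self])
    apply h
    refine Prod.ext h1 (funext fun i => ?_)
    have := hk i.1 (Nat.lt_succ_iff.mp i.2)
    rw [map_sub] at this
    exact sub_eq_zero.mp this
  · intro h a b hab
    have h1 := congrArg Prod.fst hab
    have h2 := congrFun (congrArg Prod.snd hab) (Fin.last r)
    exact h (Prod.ext h1 h2)
end
end

section
/- (Lifting through the principal projection; Proposition 5.8 of del Pino–Toussaint, in standard coordinates.) Fix integers n ≥ 1, ℓ ≥ 1, r ≥ 1. Write points of ℝⁿ as t = (t', t_n) with t' ∈ ℝ^{n−1}, let e₁,…,e_n be the standard basis of ℝⁿ, let x_n : ℝⁿ → ℝ be smooth and set X(t) := (t', x_n(t)). Let z : ℝⁿ → ℝ^ℓ be smooth (the prescribed pure r-th derivative in the principal direction), and let χ_i : ℝ^{n−1} → Sym^i(ℝⁿ,ℝ^ℓ), 0 ≤ i ≤ r, be smooth maps (the initial integral datum) satisfying: (i) χ_r(q)(e_n,…,e_n)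 = z(q,0) for all q ∈ ℝ^{n−1}; (ii) for all 0 ≤ i < r, q ∈ ℝ^{n−1} and v' ∈ ℝ^{n−1}, fderiv ℝ χ_i q v' equals the i-linear map (w₁,…,w_i) ↦ χ_{i+1} q ((v', fderiv ℝ x_n (q,0) (v',0)), w₁,…,w_i). Then there exists exactly one tuple of smooth maps ζ_i : ℝⁿ → Sym^i(ℝⁿ,ℝ^ℓ), 0 ≤ i ≤ r, such that: (a) ζ_i(q,0) = χ_i(q) for all i and all q ∈ ℝ^{n−1}; (b) ζ_r(t)(e_n,…,e_n) = z(t) for all t ∈ ℝⁿ; (c) the tuple (X, ζ_0,…,ζ_r) is integral. Moreover, if the map t ↦ (X(t), z(t)) is injective, then so is the lift t ↦ (X(t), ζ_0(t),…,ζ_r(t)). -/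
/- `ℝⁿ` in standard coordinates. -/
noncomputable section

section helpers
open scoped ContDiff
set_option linter.unusedSectionVars false

lemma ppl_paramInt_hasFDeriv {V E : Type} [NormedAddCommGroup V] [NormedSpace ℝ V]
    [FiniteDimensional ℝ V] [NormedAddCommGroup E] [NormedSpace ℝ E] [CompleteSpace E]
    (G : V × ℝ → E) (hG : ContDiff ℝ ∞ G) (x₀ : V) :
    HasFDerivAt (fun x => ∫ s in (0:ℝ)..1, G (x, s))
      (∫ s in (0:ℝ)..1, (fderiv ℝ G (x₀, s)).comp (ContinuousLinearMap.inl ℝ V ℝ)) x₀ := by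
  have hc : Continuous (fun p : V × ℝ => (fderiv ℝ G p).comp (ContinuousLinearMap.inl ℝ V ℝ)) := by
    have := hG.continuous_fderiv (by simp)
    fun_prop
  have hGc := hG.continuous
  obtain ⟨C, hC⟩ := ((isCompact_closedBall x₀ (1:ℝ)).prod (isCompact_uIcc (a := (0:ℝ)) (b := 1))).exists_bound_of_continuousOn hc.continuousOn
  refine intervalIntegral.hasFDerivAt_integral_of_dominated_of_fderiv_le
    (F := fun x s => G (x, s))
    (F' := fun x s => (fderiv ℝ G (x, s)).comp (ContinuousLinearMap.inl ℝ V ℝ))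
    (bound := fun _ => C) (s := Metric.closedBall x₀ 1)
    (Metric.closedBall_mem_nhds x₀ one_pos) ?_ ?_ ?_ ?_ ?_ ?_
  · refine Filter.Eventually.of_forall fun x => ?_
    exact (show Continuous fun s => G (x, s) by fun_prop).aestronglyMeasurable
  · exact (show Continuous fun s => G (x₀, s) by fun_prop).intervalIntegrable _ _
  · exact (hc.comp (show Continuous fun s : ℝ => (x₀, s) by fun_prop)).aestronglyMeasurable
  · refine Filter.Eventually.of_forall fun s hs x hx => ?_
    exact hC (x, s) ⟨hx, Set.uIoc_subset_uIcc hs⟩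
  · simp
  · refine Filter.Eventually.of_forall fun s hs x hx => ?_
    have h1 : HasFDerivAt G (fderiv ℝ G (x, s)) (x, s) :=
      (hG.differentiable (by simp) _).hasFDerivAt
    exact h1.comp x (hasFDerivAt_prodMk_left x s)

lemma ppl_paramInt_nat {V : Type} [NormedAddCommGroup V] [NormedSpace ℝ V]
    [FiniteDimensional ℝ V] (n : ℕ) : ∀ {E : Type} [NormedAddCommGroup E] [NormedSpace ℝ E]
    [CompleteSpace E] (G : V × ℝ → E) (_ : ContDiff ℝ ∞ G),
    ContDiff ℝ n (fun x => ∫ s in (0:ℝ)..1, G (x, s)) := by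
  induction n with
  | zero =>
    intro E _ _ _ G hG
    have hGc := hG.continuous
    refine contDiff_zero.2 ?_
    exact intervalIntegral.continuous_parametric_intervalIntegral_of_continuous'
      (f := fun x s => G (x, s)) (by simpa [Function.uncurry_def] using hGc) 0 1
  | succ n ih =>
    intro E _ _ _ G hG
    push_cast
    refine contDiff_succ_iff_fderiv.2 ⟨fun x => (ppl_paramInt_hasFDeriv G hG x).differentiableAt,
      by simp, ?_⟩
    have : fderiv ℝ (fun x => ∫ s in (0:ℝ)..1, G (x, s)) = fun x =>
      ∫ s in (0:ℝ)..1, (fderiv ℝ G (x, s)).comp (ContinuousLinearMap.inl ℝ V ℝ) :=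
      funext fun x => (ppl_paramInt_hasFDeriv G hG x).fderiv
    rw [this]
    refine ih (fun p => (fderiv ℝ G p).comp (ContinuousLinearMap.inl ℝ V ℝ)) ?_
    have := (contDiff_infty_iff_fderiv.1 hG).2
    exact this.clm_comp contDiff_const

section gen
variable {V E : Type} [NormedAddCommGroup V] [NormedSpace ℝ V]
  [NormedAddCommGroup E] [NormedSpace ℝ E]

/-- primitive along `e` starting from the hyperplane `lam = 0` -/
def pplPrim (lam : V →L[ℝ] ℝ) (e : V) (g : V → E) (t : V) : E :=
  ∫ s in (0:ℝ)..lam t, g (t - lam t • e + s • e)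

lemma pplPrim_contDiff [FiniteDimensional ℝ V] [CompleteSpace E]
    (lam : V →L[ℝ] ℝ) (e : V) (g : V → E) (hg : ContDiff ℝ ∞ g) :
    ContDiff ℝ ∞ (pplPrim lam e g) := by
  have h : pplPrim lam e g = fun t => lam t •
      ∫ s in (0:ℝ)..1, g (t - lam t • e + (s * lam t) • e) := by
    funext t
    have := intervalIntegral.smul_integral_comp_mul_right
      (a := 0) (b := 1) (fun s => g (t - lam t • e + s • e)) (lam t)
    simp only [zero_mul, one_mul] at this
    rw [this, pplPrim]
  rw [h]
  refine lam.contDiff.smul ?_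
  refine contDiff_infty.2 fun n => ?_
  refine ppl_paramInt_nat n (fun p : V × ℝ => g (p.1 - lam p.1 • e + (p.2 * lam p.1) • e)) ?_
  refine hg.comp ?_
  fun_prop

lemma pplPrim_zero (lam : V →L[ℝ] ℝ) (e : V) (g : V → E) (t : V) (ht : lam t = 0) :
    pplPrim lam e g t = 0 := by simp [pplPrim, ht]

lemma pplPrim_fderiv [FiniteDimensional ℝ V] [CompleteSpace E]
    (lam : V →L[ℝ] ℝ) (e : V) (he : lam e = 1) (g : V → E) (hg : ContDiff ℝ ∞ g) (t : V) :
    fderiv ℝ (pplPrim lam e g) t e = g t := by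
  have hd : DifferentiableAt ℝ (pplPrim lam e g) t :=
    (pplPrim_contDiff lam e g hg).differentiable (by simp) t
  have hl : HasDerivAt (fun h : ℝ => t + h • e) e 0 := by
    simpa using ((hasDerivAt_id (0:ℝ)).smul_const e).const_add t
  have h1 : HasDerivAt (fun h : ℝ => pplPrim lam e g (t + h • e))
      (fderiv ℝ (pplPrim lam e g) t e) 0 := by
    have hd' : HasFDerivAt (pplPrim lam e g) (fderiv ℝ (pplPrim lam e g) t) (t + (0:ℝ) • e) := by
      simpa using hd.hasFDerivAt
    exact hd'.comp_hasDerivAt 0 hl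
  have h2 : HasDerivAt (fun h : ℝ => pplPrim lam e g (t + h • e)) (g t) 0 := by
    have hf : (fun h : ℝ => pplPrim lam e g (t + h • e)) = fun h : ℝ =>
        ∫ s in (0:ℝ)..(lam t + h), g (t - lam t • e + s • e) := by
      funext h
      simp only [pplPrim, map_add, map_smul, he, smul_eq_mul, mul_one]
      congr 1
      funext s
      congr 1
      rw [add_smul]; abel
    rw [hf]
    have hcont : Continuous fun s : ℝ => g (t - lam t • e + s • e) := by
      have := hg.continuous
      fun_prop
    have h3 : HasDerivAt (fun u : ℝ => ∫ s in (0:ℝ)..u, g (t - lam t • e + s • e))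
        (g t) (lam t + 0) := by
      have := intervalIntegral.integral_hasDerivAt_right (hcont.intervalIntegrable 0 (lam t + 0))
        (hcont.stronglyMeasurableAtFilter _ _) hcont.continuousAt
      simpa using this
    have h4 : HasDerivAt (fun h : ℝ => lam t + h) 1 0 := (hasDerivAt_id (0:ℝ)).const_add _
    simpa [Function.comp_def] using h3.scomp (0:ℝ) h4
  exact h1.unique h2

/-- a function with vanishing e-derivative vanishing on the hyperplane is zero -/
lemma ppl_zero_of_deriv (lam : V →L[ℝ] ℝ) (e : V) (he : lam e = 1) (g : V → E)
    (hg : Differentiable ℝ g) (h0 : ∀ t, lam t = 0 → g t = 0) (hd : ∀ t, fderiv ℝ g t e = 0)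
    (t : V) : g t = 0 := by
  have hh : ∀ s : ℝ, HasDerivAt (fun s : ℝ => g (t - lam t • e + s • e)) 0 s := by
    intro s
    have hl : HasDerivAt (fun h : ℝ => t - lam t • e + h • e) e s := by
      simpa using ((hasDerivAt_id s).smul_const e).const_add (t - lam t • e)
    have := (hg (t - lam t • e + s • e)).hasFDerivAt.comp_hasDerivAt s hl
    rwa [hd] at this
  have := is_const_of_deriv_eq_zero (fun s => (hh s).differentiableAt)
    (fun s => (hh s).deriv) (lam t) 0
  simp only [sub_add_cancel, zero_smul, add_zero] at this
  rw [this]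
  exact h0 _ (by simp [he])

def pplD (lam : V →L[ℝ] ℝ) (e : V) (x : V → ℝ) (w : V) (g : ℕ → V → E) (k : ℕ) (t : V) : E :=
  fderiv ℝ (g k) t (w - lam w • e) + (lam w - fderiv ℝ x t (w - lam w • e)) • g (k + 1) t

lemma pplD_contDiff (lam : V →L[ℝ] ℝ) (e : V) (x : V → ℝ) (hx : ContDiff ℝ ∞ x) (w : V)
    (g : ℕ → V → E) (hg : ∀ k, ContDiff ℝ ∞ (g k)) (k : ℕ) :
    ContDiff ℝ ∞ (pplD lam e x w g k) := by
  have h1 := (contDiff_infty_iff_fderiv.1 (hg k)).2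
  have h2 := (contDiff_infty_iff_fderiv.1 hx).2
  have h3 := hg (k+1)
  unfold pplD
  fun_prop

lemma pplD_fderiv (lam : V →L[ℝ] ℝ) (e : V) (x : V → ℝ) (hx : ContDiff ℝ ∞ x) (w : V)
    (g : ℕ → V → E) (hg : ∀ k, ContDiff ℝ ∞ (g k)) (k : ℕ) (t u : V) :
    fderiv ℝ (pplD lam e x w g k) t u =
      fderiv ℝ (fderiv ℝ (g k)) t u (w - lam w • e)
      + ((lam w - fderiv ℝ x t (w - lam w • e)) • fderiv ℝ (g (k + 1)) t u
        - (fderiv ℝ (fderiv ℝ x) t u (w - lam w • e)) • g (k + 1) t) := by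
  have h1 := ((contDiff_infty_iff_fderiv.1 (hg k)).2.differentiable (by simp) t).hasFDerivAt
  have h2 := ((contDiff_infty_iff_fderiv.1 hx).2.differentiable (by simp) t).hasFDerivAt
  have h3 := ((hg (k+1)).differentiable (by simp) t).hasFDerivAt
  have h := ((h1.clm_apply (hasFDerivAt_const (w - lam w • e) t)).add
    (((h2.clm_apply (hasFDerivAt_const (w - lam w • e) t)).const_sub (lam w)).smul h3))
  have h' : HasFDerivAt (pplD lam e x w g k) _ t := h
  rw [h'.fderiv]
  simp
  module

lemma ppl_symm2 (g : V → E) (hg : ContDiff ℝ ∞ g) (t u v : V) :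
    fderiv ℝ (fderiv ℝ g) t u v = fderiv ℝ (fderiv ℝ g) t v u :=
  (hg.contDiffAt.isSymmSndFDerivAt
    (by simpa using WithTop.coe_le_coe.2 (le_top : (2:ℕ∞) ≤ ⊤))).eq u v

lemma pplD_comm (lam : V →L[ℝ] ℝ) (e : V) (x : V → ℝ) (hx : ContDiff ℝ ∞ x) (u w : V)
    (g : ℕ → V → E) (hg : ∀ k, ContDiff ℝ ∞ (g k)) (k : ℕ) (t : V) :
    pplD lam e x u (pplD lam e x w g) k t = pplD lam e x w (pplD lam e x u g) k t := by
  rw [pplD, pplD_fderiv lam e x hx w g hg, pplD, pplD, pplD_fderiv lam e x hx u g hg, pplD]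
  rw [ppl_symm2 (g k) (hg k) t (w - lam w • e), ppl_symm2 x hx t (w - lam w • e)]
  module

lemma pplD_ode (lam : V →L[ℝ] ℝ) (e : V) (x : V → ℝ) (hx : ContDiff ℝ ∞ x) (w : V)
    (g : ℕ → V → E) (hg : ∀ k, ContDiff ℝ ∞ (g k)) (k : ℕ)
    (h1 : ∀ t, fderiv ℝ (g k) t e = fderiv ℝ x t e • g (k + 1) t)
    (h2 : ∀ t, fderiv ℝ (g (k + 1)) t e = fderiv ℝ x t e • g (k + 2) t) (t : V) :
    fderiv ℝ (pplD lam e x w g k) t e = fderiv ℝ x t e • pplD lam e x w g (k + 1) t := by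
  rw [pplD_fderiv lam e x hx w g hg, ppl_symm2 (g k) (hg k) t e, ppl_symm2 x hx t e, h2]
  set p := w - lam w • e with hp
  have h3 : fderiv ℝ (fderiv ℝ (g k)) t p e =
      fderiv ℝ x t e • fderiv ℝ (g (k+1)) t p + (fderiv ℝ (fderiv ℝ x) t p e) • g (k+1) t := by
    have a1 := ((contDiff_infty_iff_fderiv.1 (hg k)).2.differentiable (by simp) t).hasFDerivAt
    have a2 := ((contDiff_infty_iff_fderiv.1 hx).2.differentiable (by simp) t).hasFDerivAt
    have a3 := ((hg (k+1)).differentiable (by simp) t).hasFDerivAt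
    have b1 := a1.clm_apply (hasFDerivAt_const e t)
    have b2 := (a2.clm_apply (hasFDerivAt_const e t)).smul a3
    have : (fun t => fderiv ℝ (g k) t e) = fun t => fderiv ℝ x t e • g (k + 1) t := funext h1
    rw [this] at b1
    have := congrArg (fun L => L p) (b1.unique b2)
    simpa using this
  rw [h3, pplD, ← hp]
  module


lemma ppl_symm_step {i : ℕ} (A : (Fin (i + 2) → V) → E)
    (h1 : ∀ (w : V) (σ : Equiv.Perm (Fin (i + 1))) (v : Fin (i + 1) → V),
      A (Fin.cons w (v ∘ σ)) = A (Fin.cons w v))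
    (h2 : ∀ (u w : V) (v : Fin i → V),
      A (Fin.cons u (Fin.cons w v : Fin (i + 1) → V))
        = A (Fin.cons w (Fin.cons u v : Fin (i + 1) → V)))
    (σ : Equiv.Perm (Fin (i + 2))) : ∀ v : Fin (i + 2) → V, A (v ∘ σ) = A v := by
  have hσ : σ ∈ Submonoid.closure
      (Set.range fun j : Fin (i + 1) => Equiv.swap j.castSucc j.succ) := by
    rw [Equiv.Perm.mclosure_swap_castSucc_succ]; trivial
  induction hσ using Submonoid.closure_induction with
  | one => intro v; rfl
  | mul a b _ _ ha hb =>
    intro v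
    rw [← ha v, ← hb (v ∘ a)]
    rfl
  | mem s hs =>
    obtain ⟨j, rfl⟩ := hs
    intro v
    induction j using Fin.cases with
    | zero =>
      have e1 : v ∘ (Equiv.swap (0 : Fin (i+1)).castSucc (0 : Fin (i+1)).succ)
          = Fin.cons (v 1) (Fin.cons (v 0) (Fin.tail (Fin.tail v)) : Fin (i + 1) → V) := by
        funext m
        refine Fin.cases ?_ (fun m => ?_) m
        · simp
        · refine Fin.cases ?_ (fun m => ?_) m
          · simp [Equiv.swap_apply_def]
          · simp [Equiv.swap_apply_def, Fin.ext_iff, Fin.tail]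
      have e2 : v = Fin.cons (v 0) (Fin.cons (v 1) (Fin.tail (Fin.tail v)) : Fin (i + 1) → V) := by
        funext m
        refine Fin.cases ?_ (fun m => ?_) m
        · simp
        · refine Fin.cases ?_ (fun m => ?_) m
          · simp
          · simp [Fin.tail]
      rw [e1, h2, ← e2]
    | succ j =>
      have e1 : v ∘ (Equiv.swap j.succ.castSucc j.succ.succ)
          = Fin.cons (v 0) (Fin.tail v ∘ (Equiv.swap j.castSucc j.succ)) := by
        funext m
        refine Fin.cases ?_ (fun m => ?_) m
        · simp [Equiv.swap_apply_def, Fin.ext_iff]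
        · simp only [Function.comp, Fin.cons_succ, Fin.tail, Equiv.swap_apply_def, Fin.ext_iff]
          simp only [Fin.val_succ, Fin.val_castSucc, add_left_inj]
          split_ifs <;> simp
      show A (v ∘ (Equiv.swap j.succ.castSucc j.succ.succ)) = A v
      rw [e1, h1]
      simp

def pplH (lam : V →L[ℝ] ℝ) (e : V) (x : V → ℝ) (F : ℕ → V → E) :
    (i : ℕ) → ℕ → V → ContinuousMultilinearMap ℝ (fun _ : Fin i => V) E
  | 0, k, t => (continuousMultilinearCurryFin0 ℝ V E).symm (F k t)
  | i + 1, k, t => (continuousMultilinearCurryLeftEquiv ℝ (fun _ : Fin (i + 1) => V) E).symm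
      ((fderiv ℝ (pplH lam e x F i k) t).comp (ContinuousLinearMap.id ℝ V - lam.smulRight e)
        + (lam - (fderiv ℝ x t).comp (ContinuousLinearMap.id ℝ V - lam.smulRight e)).smulRight
          (pplH lam e x F i (k + 1) t))

variable (lam : V →L[ℝ] ℝ) (e : V) (x : V → ℝ) (F : ℕ → V → E)

lemma pplH_contDiff (hx : ContDiff ℝ ∞ x) (hF : ∀ k, ContDiff ℝ ∞ (F k)) (i : ℕ) :
    ∀ k, ContDiff ℝ ∞ (pplH lam e x F i k) := by
  induction i with
  | zero =>
    intro k
    exact (continuousMultilinearCurryFin0 ℝ V E).symm.contDiff.comp (hF k)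
  | succ i ih =>
    intro k
    have h1 := (contDiff_infty_iff_fderiv.1 (ih k)).2
    have h2 := (contDiff_infty_iff_fderiv.1 hx).2
    refine (continuousMultilinearCurryLeftEquiv ℝ (fun _ : Fin (i + 1) => V) E).symm.contDiff.comp
      ((h1.clm_comp contDiff_const).add
        ((contDiff_const.sub (h2.clm_comp contDiff_const)).smulRight (ih (k + 1))))

lemma ppl_eval_contDiff {N : Type} [NormedAddCommGroup N] [NormedSpace ℝ N] {i : ℕ}
    (f : N → ContinuousMultilinearMap ℝ (fun _ : Fin i => V) E)
    (hf : ContDiff ℝ ∞ f) (W : Fin i → V) : ContDiff ℝ ∞ (fun t => f t W) :=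
  (ContinuousMultilinearMap.apply ℝ (fun _ : Fin i => V) E W).contDiff.comp hf

lemma ppl_eval_fderiv {N : Type} [NormedAddCommGroup N] [NormedSpace ℝ N] {i : ℕ}
    (f : N → ContinuousMultilinearMap ℝ (fun _ : Fin i => V) E) (t : N)
    (hf : DifferentiableAt ℝ f t) (W : Fin i → V) (v : N) :
    fderiv ℝ (fun t => f t W) t v = fderiv ℝ f t v W := by
  have := (ContinuousMultilinearMap.apply ℝ (fun _ : Fin i => V) E W).hasFDerivAt.comp t
    hf.hasFDerivAt
  have h : HasFDerivAt (fun t => f t W) _ t := this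
  rw [h.fderiv]
  rfl

lemma pplH_succ (hx : ContDiff ℝ ∞ x) (hF : ∀ k, ContDiff ℝ ∞ (F k)) (i k : ℕ) (t w : V)
    (W : Fin i → V) :
    pplH lam e x F (i + 1) k t (Fin.cons w W)
      = pplD lam e x w (fun k t => pplH lam e x F i k t W) k t := by
  rw [pplD, ppl_eval_fderiv _ _ ((pplH_contDiff lam e x F hx hF i k).differentiable (by simp) t)]
  rw [pplH, continuousMultilinearCurryLeftEquiv_symm_apply]
  simp

lemma pplH_en (he : lam e = 1) (hx : ContDiff ℝ ∞ x) (hF : ∀ k, ContDiff ℝ ∞ (F k)) (i : ℕ) :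
    ∀ k t, pplH lam e x F i k t (fun _ => e) = F (k + i) t := by
  induction i with
  | zero => intro k t; simp [pplH]
  | succ i ih =>
    intro k t
    have : (fun _ : Fin (i + 1) => e) = Fin.cons e (fun _ : Fin i => e) := by
      funext m; refine Fin.cases ?_ (fun m => ?_) m <;> simp
    rw [this, pplH_succ lam e x F hx hF, pplD]
    simp [he, ih]
    congr 1; ring

lemma pplH_symm (hx : ContDiff ℝ ∞ x) (hF : ∀ k, ContDiff ℝ ∞ (F k)) (i : ℕ) :
    ∀ k t (σ : Equiv.Perm (Fin i)) (v : Fin i → V),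
      pplH lam e x F i k t (v ∘ σ) = pplH lam e x F i k t v := by
  induction i with
  | zero => intro k t σ v; congr 1; exact Subsingleton.elim _ _
  | succ i ih =>
    intro k t
    cases i with
    | zero =>
      intro σ v
      have : v ∘ σ = v := by
        funext m
        exact congrArg v (Subsingleton.elim (α := Fin 1) _ _)
      rw [this]
    | succ i =>
      refine ppl_symm_step (pplH lam e x F (i + 2) k t) ?_ ?_
      · intro w σ v
        rw [pplH_succ lam e x F hx hF, pplH_succ lam e x F hx hF]
        simp only [ih]
      · intro u w v
        rw [pplH_succ lam e x F hx hF, pplH_succ lam e x F hx hF]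
        have : ∀ w : V, (fun k t => pplH lam e x F (i+1) k t (Fin.cons w v)) =
            pplD lam e x w (fun k t => pplH lam e x F i k t v) := by
          intro w; funext k t; exact pplH_succ lam e x F hx hF i k t w v
        rw [this, this]
        exact pplD_comm lam e x hx u w _
          (fun k => ppl_eval_contDiff _ (pplH_contDiff lam e x F hx hF i k) v) k t

lemma pplH_ode (r : ℕ) (hx : ContDiff ℝ ∞ x) (hF : ∀ k, ContDiff ℝ ∞ (F k))
    (hode : ∀ k < r, ∀ t, fderiv ℝ (F k) t e = fderiv ℝ x t e • F (k + 1) t) (i : ℕ) :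
    ∀ k, i + k < r → ∀ (W : Fin i → V) t, fderiv ℝ (fun t => pplH lam e x F i k t W) t e
      = fderiv ℝ x t e • pplH lam e x F i (k + 1) t W := by
  induction i with
  | zero =>
    intro k hk W t
    simpa [pplH] using hode k (by omega) t
  | succ i ih =>
    intro k hk W t
    have hW : W = Fin.cons (W 0) (Fin.tail W) := by simp
    rw [hW]
    have : (fun t => pplH lam e x F (i+1) k t (Fin.cons (W 0) (Fin.tail W))) =
        pplD lam e x (W 0) (fun k t => pplH lam e x F i k t (Fin.tail W)) k := by
      funext t; exact pplH_succ lam e x F hx hF i k t _ _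
    rw [this, pplH_succ lam e x F hx hF]
    exact pplD_ode lam e x hx (W 0) _
          (fun k => ppl_eval_contDiff _ (pplH_contDiff lam e x F hx hF i k) _) k
          (ih k (by omega) _) (ih (k + 1) (by omega) _) t

lemma pplH_integral (he : lam e = 1) (r : ℕ) (hx : ContDiff ℝ ∞ x) (hF : ∀ k, ContDiff ℝ ∞ (F k))
    (hode : ∀ k < r, ∀ t, fderiv ℝ (F k) t e = fderiv ℝ x t e • F (k + 1) t) (i : ℕ) (hi : i < r)
    (t v : V) (W : Fin i → V) :
    fderiv ℝ (pplH lam e x F i 0) t v W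
      = pplH lam e x F (i + 1) 0 t (Fin.cons ((v - lam v • e) + fderiv ℝ x t v • e) W) := by
  rw [pplH_succ lam e x F hx hF, pplD,
    ← ppl_eval_fderiv _ _ ((pplH_contDiff lam e x F hx hF i 0).differentiable (by simp) t)]
  have h := pplH_ode lam e x F r hx hF hode i 0 (by omega) W t
  simp [he]
  rw [h]
  simp only [smul_smul, ← add_smul, zero_add]
  module

lemma ppl_vanish {N : Type} [NormedAddCommGroup N] [NormedSpace ℝ N] (r : ℕ)
    (η : (i : ℕ) → N → ContinuousMultilinearMap ℝ (fun _ : Fin i => V) E)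
    (hd : ∀ i < r, Differentiable ℝ (η i))
    (hs : ∀ i ≤ r, ∀ t (σ : Equiv.Perm (Fin i)) (v : Fin i → V), η i t (v ∘ σ) = η i t v)
    (h0 : ∀ i ≤ r, ∀ t, η i t (fun _ => e) = 0)
    (Y : N → N → V) (hY : ∀ t w, ∃ v, ∃ c : ℝ, w = Y t v + c • e)
    (hI : ∀ i < r, ∀ t v (W : Fin i → V), fderiv ℝ (η i) t v W = η (i + 1) t (Fin.cons (Y t v) W)) :
    ∀ i ≤ r, ∀ t, η i t = 0 := by
  have key : ∀ j : ℕ, ∀ i ≤ r, ∀ t (W : Fin i → V), (∀ m : Fin i, j ≤ m → W m = e) →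
      η i t W = 0 := by
    intro j
    induction j with
    | zero =>
      intro i hi t W hW
      rw [show W = fun _ => e from funext fun m => hW m (Nat.zero_le _)]
      exact h0 i hi t
    | succ j ih =>
      intro i hi t W hW
      cases i with
      | zero => exact ih 0 hi t W (fun m => m.elim0)
      | succ i =>
        have hW' : W = Fin.cons (W 0) (Fin.tail W) := by simp
        obtain ⟨v, c, hvc⟩ := hY t (W 0)
        have htail : ∀ m : Fin i, j ≤ m → Fin.tail W m = e := by
          intro m hm
          exact hW m.succ (by simp; omega)
        have a1 : η (i + 1) t (Fin.cons (Y t v) (Fin.tail W)) = 0 := by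
          rw [← hI i (by omega), ← ppl_eval_fderiv _ _ (hd i (by omega) t)]
          have : (fun t => η i t (Fin.tail W)) = fun _ => 0 := by
            funext t; exact ih i (by omega) t _ htail
          rw [this]; simp
        have a2 : η (i + 1) t (Fin.cons e (Fin.tail W)) = 0 := by
          have hrot := Fin.snoc_eq_cons_rotate (Fin.tail W) e
          have := hs (i + 1) hi t (finRotate _) (Fin.cons e (Fin.tail W))
          rw [← this]
          have h' : (Fin.cons e (Fin.tail W) : Fin (i + 1) → V) ∘ (finRotate (i + 1))
            = Fin.snoc (Fin.tail W) e := hrot.symm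
          rw [h']
          refine ih (i + 1) hi t _ ?_
          intro m
          refine Fin.lastCases ?_ (fun m => ?_) m
          · intro _; simp
          · intro hm
            rw [Fin.snoc_castSucc]
            exact htail m (by simpa using hm)
        rw [hW', hvc]
        have := (η (i + 1) t).cons_add (Fin.tail W) (Y t v) (c • e)
        rw [this, a1, (η (i + 1) t).cons_smul, a2]
        simp
  intro i hi t
  ext W : 1
  exact key i i hi t W (fun m hm => absurd m.2 (by omega))

lemma ppl_exists_F [FiniteDimensional ℝ V] [CompleteSpace E] (he : lam e = 1)
    (hx : ContDiff ℝ ∞ x) (r : ℕ) (z : V → E) (hz : ContDiff ℝ ∞ z)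
    (c : ℕ → V → E) (hc : ∀ k < r, ContDiff ℝ ∞ (c k)) (hc0 : ∀ k < r, ∀ t, fderiv ℝ (c k) t e = 0) :
    ∃ F : ℕ → V → E, (∀ k, ContDiff ℝ ∞ (F k)) ∧ F r = z ∧
      (∀ k < r, ∀ t, lam t = 0 → F k t = c k t) ∧
      (∀ k < r, ∀ t, fderiv ℝ (F k) t e = fderiv ℝ x t e • F (k + 1) t) := by
  by_cases hr : r = 0
  · subst hr
    exact ⟨fun _ => z, fun _ => hz, rfl, by simp, by simp⟩
  have hx' : ContDiff ℝ ∞ (fun t => fderiv ℝ x t e) :=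
    (contDiff_infty_iff_fderiv.1 hx).2.clm_apply contDiff_const
  let G : ℕ → V → E := fun j => Nat.rec z
    (fun j Gj t => c (r - (j + 1)) t + pplPrim lam e (fun t => fderiv ℝ x t e • Gj t) t) j
  have hG1 : ∀ j t, G (j + 1) t
      = c (r - (j + 1)) t + pplPrim lam e (fun t => fderiv ℝ x t e • G j t) t := fun j t => rfl
  have hGs : ∀ j, ContDiff ℝ ∞ (G j) := by
    intro j
    induction j with
    | zero => exact hz
    | succ j ih =>
      exact (hc _ (by omega)).add (pplPrim_contDiff lam e _ (hx'.smul ih))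
  refine ⟨fun k => G (r - k), fun k => hGs _, ?_, ?_, ?_⟩
  · simp only [Nat.sub_self]; rfl
  · intro k hk t ht
    have : r - k = (r - (k + 1)) + 1 := by omega
    have h2 : r - (r - (k + 1) + 1) = k := by omega
    simp only [this, hG1, h2, pplPrim_zero lam e _ t ht, add_zero]
  · intro k hk t
    have : r - k = (r - (k + 1)) + 1 := by omega
    have h2 : r - (r - (k + 1) + 1) = k := by omega
    have h3 : G (r - k) = fun t => c k t +
        pplPrim lam e (fun t => fderiv ℝ x t e • G (r - (k + 1)) t) t := by
      funext t; rw [this, hG1, h2]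
    have hs : ContDiff ℝ ∞ (fun t => fderiv ℝ x t e • G (r - (k + 1)) t) :=
      hx'.smul (hGs (r - (k + 1)))
    have a1 := ((hc k hk).differentiable (by simp) t).hasFDerivAt
    have a2 := ((pplPrim_contDiff lam e _ hs).differentiable (by simp) t).hasFDerivAt
    have a3 := a1.add a2
    have a4 : HasFDerivAt (G (r - k)) (fderiv ℝ (c k) t + fderiv ℝ
        (pplPrim lam e (fun t => fderiv ℝ x t e • G (r - (k + 1)) t)) t) t := by rw [h3]; exact a3
    show fderiv ℝ (G (r - k)) t e = _
    rw [a4.fderiv, ContinuousLinearMap.add_apply, hc0 k hk, zero_add]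
    exact pplPrim_fderiv lam e he _ hs t

end gen

end helpers

/-- Lifting through the principal projection (del Pino–Toussaint, Proposition 5.8),
in standard coordinates. Here `n = n' + 1 ≥ 1`, points of `ℝⁿ` are `t = (t', t_n)`,
`e_n` is the last standard basis vector, and `X t = (t', x_n t)`. -/
theorem principal_projection_lifting
    (n' ℓ r : ℕ) (hℓ : 1 ≤ ℓ) (hr : 1 ≤ r)
    (xn : Vec (n' + 1) → ℝ) (hxn : ContDiff ℝ (⊤ : ℕ∞) xn)
    (X : Vec (n' + 1) → Vec (n' + 1))
    (hX : X = fun t => Fin.snoc (Fin.init t) (xn t))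
    (en : Vec (n' + 1)) (hen : en = Pi.single (Fin.last n') 1)
    -- the prescribed pure r-th derivative in the principal direction
    (z : Vec (n' + 1) → Vec ℓ) (hz : ContDiff ℝ (⊤ : ℕ∞) z)
    -- the initial integral datum along {t_n = 0}
    (χ : (i : ℕ) → Vec n' → SymMap (n' + 1) ℓ i)
    (hχ : ∀ i ≤ r, ContDiff ℝ (⊤ : ℕ∞) (χ i))
    (hχsym : ∀ i ≤ r, ∀ q : Vec n', IsSymmMap (χ i q))
    -- (i) compatibility of the top component with z
    (hcompat : ∀ q : Vec n', χ r q (fun _ : Fin r => en) = z (Fin.snoc q 0))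
    -- (ii) integrality of the initial datum along horizontal directions
    (hinit : ∀ i < r, ∀ (q v' : Vec n') (w : Fin i → Vec (n' + 1)),
      (fderiv ℝ (χ i) q v') w
        = χ (i + 1) q (Fin.cons
            (Fin.snoc v' (fderiv ℝ xn (Fin.snoc q 0) (Fin.snoc v' 0))) w)) :
    ∃ ζ : (i : ℕ) → Vec (n' + 1) → SymMap (n' + 1) ℓ i,
      (∀ i ≤ r, ContDiff ℝ (⊤ : ℕ∞) (ζ i)) ∧
      (∀ i ≤ r, ∀ t : Vec (n' + 1), IsSymmMap (ζ i t)) ∧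
      -- (a) extends the initial datum
      (∀ i ≤ r, ∀ q : Vec n', ζ i (Fin.snoc q 0) = χ i q) ∧
      -- (b) realises the prescribed pure derivative
      (∀ t : Vec (n' + 1), ζ r t (fun _ : Fin r => en) = z t) ∧
      -- (c) the tuple (X, ζ) is integral
      (∀ i < r, ∀ (t v : Vec (n' + 1)) (w : Fin i → Vec (n' + 1)),
        (fderiv ℝ (ζ i) t v) w = ζ (i + 1) t (Fin.cons (fderiv ℝ X t v) w)) ∧
      -- uniqueness
      (∀ ζ' : (i : ℕ) → Vec (n' + 1) → SymMap (n' + 1) ℓ i,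
        (∀ i ≤ r, ContDiff ℝ (⊤ : ℕ∞) (ζ' i)) →
        (∀ i ≤ r, ∀ t : Vec (n' + 1), IsSymmMap (ζ' i t)) →
        (∀ i ≤ r, ∀ q : Vec n', ζ' i (Fin.snoc q 0) = χ i q) →
        (∀ t : Vec (n' + 1), ζ' r t (fun _ : Fin r => en) = z t) →
        (∀ i < r, ∀ (t v : Vec (n' + 1)) (w : Fin i → Vec (n' + 1)),
          (fderiv ℝ (ζ' i) t v) w = ζ' (i + 1) t (Fin.cons (fderiv ℝ X t v) w)) →
        ∀ i ≤ r, ζ' i = ζ i) ∧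
      -- moreover, injectivity of the principal projection forces injectivity of the lift
      (Function.Injective (fun t => (X t, z t)) →
        Function.Injective (fun t => (X t, fun i : Fin (r + 1) => ζ i.1 t))) := by
  have hxn' : ContDiff ℝ (⊤ : ℕ∞) xn := hxn
  let lam : Vec (n' + 1) →L[ℝ] ℝ := ContinuousLinearMap.proj (Fin.last n')
  have hlam : ∀ t, lam t = t (Fin.last n') := fun t => rfl
  have he : lam en = 1 := by simp [hlam, hen]
  have hsnoc : ∀ (t : Vec (n' + 1)) (c : ℝ),
      (Fin.snoc (Fin.init t) c : Vec (n' + 1)) = t - lam t • en + c • en := by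
    intro t c
    funext m
    refine Fin.lastCases ?_ (fun m => ?_) m
    · simp [hlam, hen]
    · simp [hen, Fin.init]
  let J : Vec n' →L[ℝ] Vec (n' + 1) :=
    ContinuousLinearMap.pi (fun m => Fin.lastCases 0 (fun j => ContinuousLinearMap.proj j) m)
  have hJ : ∀ q, (Fin.snoc q 0 : Vec (n' + 1)) = J q := by
    intro q
    funext m
    refine Fin.lastCases ?_ (fun m => ?_) m
    · simp [J]
    · simp [J]
  let I : Vec (n' + 1) →L[ℝ] Vec n' :=
    ContinuousLinearMap.pi (fun m => ContinuousLinearMap.proj m.castSucc)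
  have hI : ∀ t, Fin.init t = I t := fun t => rfl
  have hIJ : ∀ q, I (J q) = q := by
    intro q; rw [← hJ, ← hI]; simp
  have hIe : I en = 0 := by
    funext m; simp [I, hen]
  have hlJ : ∀ q, lam (J q) = 0 := by
    intro q; rw [← hJ, hlam]; simp
  have hJI : ∀ t, J (I t) = t - lam t • en := by
    intro t; rw [← hJ, ← hI, hsnoc]; simp
  have hsn : ∀ (v : Vec n') (c : ℝ), (Fin.snoc v c : Vec (n' + 1)) = J v + c • en := by
    intro v c
    have := hsnoc (J v) c
    rw [hI, hIJ, hlJ] at this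
    simpa using this
  have hXd : ∀ t v, fderiv ℝ X t v = (v - lam v • en) + fderiv ℝ xn t v • en := by
    intro t v
    have h1 : X = fun t => (ContinuousLinearMap.id ℝ (Vec (n' + 1)) - lam.smulRight en) t + xn t • en := by
      rw [hX]; funext t; rw [hsnoc]; simp
    have h2 := (hxn'.differentiable (by simp) t).hasFDerivAt.smul_const en
    have h3 : HasFDerivAt X ((ContinuousLinearMap.id ℝ (Vec (n' + 1)) - lam.smulRight en)
        + (fderiv ℝ xn t).smulRight en) t := by
      rw [h1]
      exact (ContinuousLinearMap.hasFDerivAt (ContinuousLinearMap.id ℝ (Vec (n' + 1)) - lam.smulRight en)).add h2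
    rw [h3.fderiv]
    simp
  let c : ℕ → Vec (n' + 1) → Vec ℓ := fun k t => χ k (I t) (fun _ => en)
  have hc : ∀ k < r, ContDiff ℝ (⊤ : ℕ∞) (c k) := fun k hk =>
    (ppl_eval_contDiff _ (hχ k hk.le) _).comp I.contDiff
  have hc0 : ∀ k < r, ∀ t, fderiv ℝ (c k) t en = 0 := by
    intro k hk t
    have h1 := (((ppl_eval_contDiff _ (hχ k hk.le) (fun _ => en)).differentiable
      (by simp)) (I t)).hasFDerivAt
    have h2 : HasFDerivAt (c k) _ t := h1.comp t I.hasFDerivAt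
    rw [h2.fderiv]
    simp [hIe]
  obtain ⟨F, hF, hFr, hF0, hode⟩ := ppl_exists_F lam en xn he hxn' r z hz c hc hc0
  have hζs := pplH_contDiff lam en xn F hxn' hF
  have hζsym := pplH_symm lam en xn F hxn' hF
  have hζen := pplH_en lam en xn F he hxn' hF
  have hζint := pplH_integral lam en xn F he r hxn' hF hode
  have ha : ∀ i ≤ r, ∀ q : Vec n', pplH lam en xn F i 0 (Fin.snoc q 0) = χ i q := by
    have hdiff : ∀ i ≤ r, ∀ q, HasFDerivAt (fun q => pplH lam en xn F i 0 (J q) - χ i q)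
        ((fderiv ℝ (pplH lam en xn F i 0) (J q)).comp J - fderiv ℝ (χ i) q) q := by
      intro i hi q
      exact (((hζs i 0).differentiable (by simp) (J q)).hasFDerivAt.comp q J.hasFDerivAt).sub
        ((hχ i hi).differentiable (by simp) q).hasFDerivAt
    have := ppl_vanish en r (fun i q => pplH lam en xn F i 0 (J q) - χ i q)
      (fun i hi q => (hdiff i hi.le q).differentiableAt)
      (by
        intro i hi q σ v
        simp only [sub_apply]
        rw [hζsym, hχsym i hi q σ v])
      (by
        intro i hi q
        simp only [sub_apply]
        rw [hζen, zero_add]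
        rcases hi.lt_or_eq with h | h
        · rw [hF0 i h _ (hlJ q)]
          simp only [c, hIJ, sub_self]
        · subst h
          rw [hFr, hcompat, hJ, sub_self])
      (fun q v => J v + fderiv ℝ xn (J q) (J v) • en)
      (by
        intro q w
        refine ⟨I w, lam w - fderiv ℝ xn (J q) (J (I w)), ?_⟩
        rw [hJI]
        module)
      (by
        intro i hi q v W
        rw [(hdiff i hi.le q).fderiv]
        have h1 := hinit i hi q v W
        rw [hsn, hJ, hJ] at h1
        have h2 := hζint i hi (J q) (J v) W
        rw [hlJ, zero_smul, sub_zero] at h2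
        simp only [sub_apply,
          ContinuousLinearMap.comp_apply]
        rw [h1, h2])
    intro i hi q
    rw [hJ]
    exact sub_eq_zero.1 (this i hi q)
  have hb : ∀ t, pplH lam en xn F r 0 t (fun _ : Fin r => en) = z t := by
    intro t; rw [hζen, zero_add, hFr]
  have hcc : ∀ i < r, ∀ (t v : Vec (n' + 1)) (w : Fin i → Vec (n' + 1)),
        (fderiv ℝ (pplH lam en xn F i 0) t v) w
          = pplH lam en xn F (i + 1) 0 t (Fin.cons (fderiv ℝ X t v) w) := by
    intro i hi t v w
    rw [hζint i hi, hXd]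
  refine ⟨fun i => pplH lam en xn F i 0, fun i _ => hζs i 0, fun i _ t => hζsym i 0 t, ha, hb, hcc,
    ?_, ?_⟩
  · intro ζ' hs' hsym' ha' hb' hc'
    have hdiff : ∀ i ≤ r, ∀ t, HasFDerivAt (fun t => ζ' i t - pplH lam en xn F i 0 t)
        (fderiv ℝ (ζ' i) t - fderiv ℝ (pplH lam en xn F i 0) t) t := by
      intro i hi t
      exact ((hs' i hi).differentiable (by simp) t).hasFDerivAt.sub
        ((hζs i 0).differentiable (by simp) t).hasFDerivAt
    have hint : ∀ i < r, ∀ t v (W : Fin i → Vec (n' + 1)),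
        fderiv ℝ (fun t => ζ' i t - pplH lam en xn F i 0 t) t v W
          = (ζ' (i + 1) t - pplH lam en xn F (i + 1) 0 t) (Fin.cons (fderiv ℝ X t v) W) := by
      intro i hi t v W
      rw [(hdiff i hi.le t).fderiv]
      simp only [sub_apply]
      rw [hc' i hi, hcc i hi]
    have hpure : ∀ j, ∀ i, i + j = r → ∀ t,
        (ζ' i t - pplH lam en xn F i 0 t) (fun _ => en) = 0 := by
      intro j
      induction j with
      | zero =>
        intro i hi t
        obtain rfl : i = r := by omega
        rw [sub_apply, hb', hb, sub_self]
      | succ j ih =>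
        intro i hi t
        refine ppl_zero_of_deriv lam en he
          (fun t => (ζ' i t - pplH lam en xn F i 0 t) (fun _ => en)) ?_ ?_ ?_ t
        · exact (ppl_eval_contDiff _ ((hs' i (by omega)).sub (hζs i 0)) _).differentiable (by simp)
        · intro t ht
          have : t = Fin.snoc (I t) 0 := by rw [hJ, hJI, ht]; simp
          rw [this, ha' i (by omega), ha i (by omega), sub_self]
          rfl
        · intro t
          rw [ppl_eval_fderiv (fun t => ζ' i t - pplH lam en xn F i 0 t) t
            (hdiff i (by omega) t).differentiableAt, hint i (by omega), hXd, he]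
          simp only [one_smul, sub_self, zero_add]
          rw [ContinuousMultilinearMap.cons_smul]
          have hcons : (Fin.cons en (fun _ : Fin i => en) : Fin (i + 1) → Vec (n' + 1))
              = fun _ => en := by
            funext m; refine Fin.cases ?_ (fun m => ?_) m <;> simp
          rw [hcons, ih (i + 1) (by omega), smul_zero]
    have := ppl_vanish en r (fun i t => ζ' i t - pplH lam en xn F i 0 t)
      (fun i hi t => (hdiff i hi.le t).differentiableAt)
      (by
        intro i hi t σ v
        simp only [sub_apply]
        rw [hζsym, hsym' i hi t σ v])
      (fun i hi t => hpure (r - i) i (by omega) t)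
      (fun t v => fderiv ℝ X t v)
      (by
        intro t w
        refine ⟨w, lam w - fderiv ℝ xn t w, ?_⟩
        rw [hXd]
        module)
      hint
    intro i hi
    funext t
    exact sub_eq_zero.1 (this i hi t)
  · intro hinj s t hst
    apply hinj
    have h1 := congrArg Prod.fst hst
    have h2 := congrFun (congrArg Prod.snd hst) (Fin.last r)
    have h3 : pplH lam en xn F r 0 s = pplH lam en xn F r 0 t := h2
    refine Prod.ext h1 ?_
    show z s = z t
    rw [← hb s, ← hb t, h3]
end
end

section
/- (Uniqueness of the integral lift of a multi-section; Lemma 6.2 of del Pino–Toussaint, in standard coordinates.) Fix integers n ≥ 1, ℓ ≥ 1, r ≥ 1. Let M ⊆ ℝⁿ be open and let X : M → ℝⁿ be a smooth map such that the set U := {p ∈ M : fderiv ℝ X p is a linear isomorphism} is dense in M. Suppose (X, ζ_0,…,ζ_r) and (X, ζ'_0,…,ζ'_r) are two integral r-jet tuples on M with the same front, i.e. ζ_0 = ζ'_0. Then ζ_i = ζ'_i for every 0 ≤ i ≤ r. -/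
/- `ℝⁿ` in standard coordinates. -/
noncomputable section

/-- Uniqueness of the integral lift of a multi-section (del Pino–Toussaint, Lemma 6.2),
in standard coordinates. -/
theorem uniqueness_of_integral_lift
    (n ℓ r : ℕ) (hn : 1 ≤ n) (hℓ : 1 ≤ ℓ) (hr : 1 ≤ r)
    (M : Set (Vec n)) (hM : IsOpen M)
    (X : Vec n → Vec n) (hX : ContDiffOn ℝ (⊤ : ℕ∞) X M)
    -- the graphicality locus is dense in M
    (hdense : M ⊆ closure {p | p ∈ M ∧ Function.Bijective ⇑(fderiv ℝ X p)})
    (ζ ζ' : (i : ℕ) → Vec n → SymMap n ℓ i)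
    (hζ : ∀ i ≤ r, ContDiffOn ℝ (⊤ : ℕ∞) (ζ i) M)
    (hζ' : ∀ i ≤ r, ContDiffOn ℝ (⊤ : ℕ∞) (ζ' i) M)
    (hsym : ∀ i ≤ r, ∀ p ∈ M, IsSymmMap (ζ i p))
    (hsym' : ∀ i ≤ r, ∀ p ∈ M, IsSymmMap (ζ' i p))
    -- both tuples are integral
    (hint : ∀ i < r, ∀ p ∈ M, ∀ (v : Vec n) (w : Fin i → Vec n),
      (fderiv ℝ (ζ i) p v) w = ζ (i + 1) p (Fin.cons (fderiv ℝ X p v) w))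
    (hint' : ∀ i < r, ∀ p ∈ M, ∀ (v : Vec n) (w : Fin i → Vec n),
      (fderiv ℝ (ζ' i) p v) w = ζ' (i + 1) p (Fin.cons (fderiv ℝ X p v) w))
    -- same front
    (hfront : Set.EqOn (ζ 0) (ζ' 0) M) :
    ∀ i ≤ r, Set.EqOn (ζ i) (ζ' i) M := by
  intro i
  induction i with
  | zero => exact fun _ => hfront
  | succ i ih =>
    intro hi
    have hE := ih (by omega)
    refine Set.EqOn.of_subset_closure (s := {p | p ∈ M ∧ Function.Bijective ⇑(fderiv ℝ X p)})
      ?_ (hζ _ hi).continuousOn (hζ' _ hi).continuousOn (fun p hp => hp.1) hdense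
    rintro p ⟨hp, hb⟩
    have hev : ζ i =ᶠ[nhds p] ζ' i := by
      filter_upwards [hM.mem_nhds hp] with q hq using hE hq
    ext1 w
    obtain ⟨v, hv⟩ := hb.2 (w 0)
    have h1 := hint i (by omega) p hp v (Fin.tail w)
    have h2 := hint' i (by omega) p hp v (Fin.tail w)
    rw [hv] at h1 h2
    have hw : (Fin.cons (w 0) (Fin.tail w) : Fin (i + 1) → Vec n) = w := Fin.cons_self_tail w
    rw [hw] at h1 h2
    rw [← h1, ← h2, hev.fderiv_eq]
end
end
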